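/- Let q be a power of an odd prime, F_q a finite field with q elements, and G = GSp(2n, F_q). If χ is the character of an irreducible finite-dimensional complex representation of G and χ is real-valued, then ε(χ) = 1, i.e. (1/|G|) Σ_{g∈G} χ(g²) = 1. -/

import Mathlib

open Matrix CategoryTheory
open scoped Classical

noncomputable section

/-- The Frobenius–Schur indicator of a complex-valued function on a finite group. -/
def fsIndicator (G : Type*) [Group G] [Fintype G] (χ : G → ℂ) : ℂ :=
  (Fintype.card G : ℂ)⁻¹ * ∑ g : G, χ (g * g)

/-- The twisted Frobenius–Schur indicator of a complex-valued function on a finite group,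
with respect to a map `σ`. -/
def twistedFSIndicator (G : Type*) [Group G] [Fintype G] (σ : G → G) (χ : G → ℂ) : ℂ :=
  (Fintype.card G : ℂ)⁻¹ * ∑ g : G, χ (g * σ g)

/-- A complex-valued function is real-valued if all its values are real. -/
def IsRealValued {G : Type*} (χ : G → ℂ) : Prop := ∀ g : G, ∃ r : ℝ, χ g = (r : ℂ)

/-- The Gaussian binomial coefficient `binom(m,k)_q` as a real number. -/
def gbinom (m k : ℕ) (q : ℝ) : ℝ := ∏ i ∈ Finset.Icc 1 k, (q ^ (m - k + i) - 1) / (q ^ i - 1)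

section Groups

variable {N F : Type*} [Fintype N] [DecidableEq N] [Field F]

theorem sim_one (J : Matrix N N F) :
    ((1 : GL N F) : Matrix N N F)ᵀ * J * ((1 : GL N F) : Matrix N N F) = ((1 : Fˣ) : F) • J := by
  simp

theorem sim_mul {J : Matrix N N F} (a b : GL N F) (c d : Fˣ)
    (hc : (a : Matrix N N F)ᵀ * J * (a : Matrix N N F) = (c : F) • J)
    (hd : (b : Matrix N N F)ᵀ * J * (b : Matrix N N F) = (d : F) • J) :
    ((a * b : GL N F) : Matrix N N F)ᵀ * J * ((a * b : GL N F) : Matrix N N F)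
      = ((c * d : Fˣ) : F) • J := by
  calc ((a * b : GL N F) : Matrix N N F)ᵀ * J * ((a * b : GL N F) : Matrix N N F)
      = (b : Matrix N N F)ᵀ * ((a : Matrix N N F)ᵀ * J * (a : Matrix N N F)) *
          (b : Matrix N N F) := by
        rw [show ((a * b : GL N F) : Matrix N N F) = (a : Matrix N N F) * b from rfl,
          transpose_mul]
        simp only [Matrix.mul_assoc]
    _ = (b : Matrix N N F)ᵀ * ((c : F) • J) * (b : Matrix N N F) := by rw [hc]
    _ = (c : F) • ((b : Matrix N N F)ᵀ * J * (b : Matrix N N F)) := by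
        rw [Matrix.mul_smul, Matrix.smul_mul]
    _ = (c : F) • ((d : F) • J) := by rw [hd]
    _ = ((c * d : Fˣ) : F) • J := by rw [smul_smul, Units.val_mul]

theorem sim_inv {J : Matrix N N F} (a : GL N F) (c : Fˣ)
    (hc : (a : Matrix N N F)ᵀ * J * (a : Matrix N N F) = (c : F) • J) :
    ((a⁻¹ : GL N F) : Matrix N N F)ᵀ * J * ((a⁻¹ : GL N F) : Matrix N N F)
      = ((c⁻¹ : Fˣ) : F) • J := by
  have ht : ((a⁻¹ : GL N F) : Matrix N N F)ᵀ * (a : Matrix N N F)ᵀ = 1 := by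
    rw [← transpose_mul, a.mul_inv, transpose_one]
  have key : ((a⁻¹ : GL N F) : Matrix N N F)ᵀ * ((a : Matrix N N F)ᵀ * J * (a : Matrix N N F)) *
      ((a⁻¹ : GL N F) : Matrix N N F) = J := by
    calc ((a⁻¹ : GL N F) : Matrix N N F)ᵀ * ((a : Matrix N N F)ᵀ * J * (a : Matrix N N F)) *
        ((a⁻¹ : GL N F) : Matrix N N F)
        = (((a⁻¹ : GL N F) : Matrix N N F)ᵀ * (a : Matrix N N F)ᵀ) * J *
          ((a : Matrix N N F) * ((a⁻¹ : GL N F) : Matrix N N F)) := by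
          simp only [Matrix.mul_assoc]
      _ = J := by rw [ht, a.mul_inv, Matrix.one_mul, Matrix.mul_one]
  have key2 : ((a⁻¹ : GL N F) : Matrix N N F)ᵀ * ((c : F) • J) * ((a⁻¹ : GL N F) : Matrix N N F)
      = (c : F) • (((a⁻¹ : GL N F) : Matrix N N F)ᵀ * J * ((a⁻¹ : GL N F) : Matrix N N F)) := by
    rw [Matrix.mul_smul, Matrix.smul_mul]
  have h3 : (c : F) • (((a⁻¹ : GL N F) : Matrix N N F)ᵀ * J *
      ((a⁻¹ : GL N F) : Matrix N N F)) = J := by rw [← key2, ← hc, key]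
  calc ((a⁻¹ : GL N F) : Matrix N N F)ᵀ * J * ((a⁻¹ : GL N F) : Matrix N N F)
      = ((c⁻¹ : Fˣ) : F) • ((c : F) • (((a⁻¹ : GL N F) : Matrix N N F)ᵀ * J *
          ((a⁻¹ : GL N F) : Matrix N N F))) := by
        rw [smul_smul, ← Units.val_mul, inv_mul_cancel, Units.val_one, one_smul]
    _ = ((c⁻¹ : Fˣ) : F) • J := by rw [h3]

/-- The similitude group of the bilinear form given by the matrix `J`:  all invertible
matrices `g` with `gᵀ * J * g = c • J` for some nonzero scalar `c` (the similitude of `g`). -/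
def similitudeGroup (J : Matrix N N F) : Subgroup (GL N F) where
  carrier := {g | ∃ c : Fˣ, (g : Matrix N N F)ᵀ * J * (g : Matrix N N F) = (c : F) • J}
  one_mem' := ⟨1, sim_one J⟩
  mul_mem' := by rintro a b ⟨c, hc⟩ ⟨d, hd⟩; exact ⟨c * d, sim_mul a b c d hc hd⟩
  inv_mem' := by rintro a ⟨c, hc⟩; exact ⟨c⁻¹, sim_inv a c hc⟩

/-- The isometry group of the bilinear form given by the matrix `J`:  all invertible
matrices `g` with `gᵀ * J * g = J`. -/
def fixGroup (J : Matrix N N F) : Subgroup (GL N F) where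
  carrier := {g | (g : Matrix N N F)ᵀ * J * (g : Matrix N N F) = J}
  one_mem' := by simp
  mul_mem' := by
    intro a b ha hb
    have := sim_mul (J := J) a b 1 1 (by simpa using ha) (by simpa using hb)
    simpa using this
  inv_mem' := by
    intro a ha
    have := sim_inv (J := J) a 1 (by simpa using ha)
    simpa using this

/-- The group of isometries of determinant one of the bilinear form given by the matrix `J`. -/
def specialFixGroup (J : Matrix N N F) : Subgroup (GL N F) where
  carrier := {g | (g : Matrix N N F)ᵀ * J * (g : Matrix N N F) = J ∧
    ((g : Matrix N N F)).det = 1}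
  one_mem' := ⟨by simp, by simp⟩
  mul_mem' := by
    rintro a b ⟨ha1, ha2⟩ ⟨hb1, hb2⟩
    refine ⟨(fixGroup J).mul_mem ha1 hb1, ?_⟩
    rw [show ((a * b : GL N F) : Matrix N N F) = (a : Matrix N N F) * b from rfl,
      Matrix.det_mul, ha2, hb2, one_mul]
  inv_mem' := by
    rintro a ⟨ha1, ha2⟩
    refine ⟨(fixGroup J).inv_mem ha1, ?_⟩
    have h := congrArg Matrix.det a.mul_inv
    rw [Matrix.det_mul, ha2, one_mul, Matrix.det_one] at h
    exact h

/-- The connected component of the similitude group of the symmetric bilinear form on a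
`2 * m`-dimensional space given by the matrix `J`:  all similitudes `g`, with similitude
character `μ`, such that `det g = μ(g) ^ m`. -/
def connSimilitudeGroup (J : Matrix N N F) (m : ℕ) : Subgroup (GL N F) where
  carrier := {g | ∃ c : Fˣ, (g : Matrix N N F)ᵀ * J * (g : Matrix N N F) = (c : F) • J ∧
    ((g : Matrix N N F)).det = (c : F) ^ m}
  one_mem' := ⟨1, sim_one J, by simp⟩
  mul_mem' := by
    rintro a b ⟨c, hc1, hc2⟩ ⟨d, hd1, hd2⟩
    refine ⟨c * d, sim_mul a b c d hc1 hd1, ?_⟩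
    rw [show ((a * b : GL N F) : Matrix N N F) = (a : Matrix N N F) * b from rfl,
      Matrix.det_mul, hc2, hd2, Units.val_mul, mul_pow]
  inv_mem' := by
    rintro a ⟨c, hc1, hc2⟩
    refine ⟨c⁻¹, sim_inv a c hc1, ?_⟩
    have h := congrArg Matrix.det a.mul_inv
    rw [Matrix.det_mul, hc2, Matrix.det_one] at h
    have hc : ((c : F) ^ m)⁻¹ = ((c⁻¹ : Fˣ) : F) ^ m := by
      rw [← inv_pow]
      norm_cast
    rw [← hc]
    exact (inv_eq_of_mul_eq_one_right h).symm

theorem neg_one_mem_similitudeGroup (J : Matrix N N F) : (-1 : GL N F) ∈ similitudeGroup J := by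
  refine ⟨1, ?_⟩
  have h : ((-1 : GL N F) : Matrix N N F) = -1 := by simp
  rw [h]
  simp

/-- The standard symplectic form matrix `[[0, I], [-I, 0]]`. -/
def Jsp (n : ℕ) (F : Type*) [Field F] : Matrix (Fin n ⊕ Fin n) (Fin n ⊕ Fin n) F :=
  Matrix.fromBlocks 0 1 (-1) 0

/-- The standard split symmetric form matrix `[[0, I], [I, 0]]`. -/
def Jsplit (n : ℕ) (F : Type*) [Field F] : Matrix (Fin n ⊕ Fin n) (Fin n ⊕ Fin n) F :=
  Matrix.fromBlocks 0 1 1 0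

/-- A symmetric matrix `J` of size `2n` is split if it is congruent to `[[0, I], [I, 0]]`. -/
def IsSplit {n : ℕ} (J : Matrix (Fin n ⊕ Fin n) (Fin n ⊕ Fin n) F) : Prop :=
  ∃ P : GL (Fin n ⊕ Fin n) F,
    (P : Matrix (Fin n ⊕ Fin n) (Fin n ⊕ Fin n) F)ᵀ * J * P = Jsplit n F

/-- The symplectic similitude group `GSp(2n, F)`. -/
def GSp (n : ℕ) (F : Type*) [Field F] : Subgroup (GL (Fin n ⊕ Fin n) F) :=
  similitudeGroup (Jsp n F)

/-- The symplectic group `Sp(2n, F)`. -/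
def Sp (n : ℕ) (F : Type*) [Field F] : Subgroup (GL (Fin n ⊕ Fin n) F) :=
  fixGroup (Jsp n F)


/-- The underlying matrix of an element of a matrix subgroup. -/
def matOf {S : Subgroup (GL N F)} (g : ↥S) : Matrix N N F := ((g : GL N F) : Matrix N N F)

end Groups

noncomputable instance subgroupFintype {G : Type*} [Group G] [Finite G] (S : Subgroup G) :
    Fintype S := Fintype.ofFinite _

namespace TwistedForm

section Basic

variable {G : Type} [Group G] {V : Type} [AddCommGroup V] [Module ℂ V]

theorem isIrreducible_of_forall [Nontrivial V] (ρ : Representation ℂ G V)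
    (h : ∀ W : Submodule ℂ V, (∀ g, ∀ v ∈ W, ρ g v ∈ W) → W = ⊥ ∨ W = ⊤) : ρ.IsIrreducible := by
  have : Nontrivial (Subrepresentation ρ) := by
    refine ⟨⟨⊥, ⊤, fun hbt => ?_⟩⟩
    have : (⊥ : Submodule ℂ V) = ⊤ := congrArg Subrepresentation.toSubmodule hbt
    exact bot_ne_top this
  refine ⟨fun W => ?_⟩
  rcases h W.toSubmodule W.apply_mem_toSubmodule with h | h
  · left; exact Subrepresentation.toSubmodule_injective h
  · right; exact Subrepresentation.toSubmodule_injective h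

theorem eq_bot_or_eq_top {ρ : Representation ℂ G V} (hρ : ρ.IsIrreducible)
    (W : Submodule ℂ V) (hW : ∀ g, ∀ v ∈ W, ρ g v ∈ W) : W = ⊥ ∨ W = ⊤ := by
  rcases hρ.eq_bot_or_eq_top ⟨W, fun g v hv => hW g v hv⟩ with h | h
  · left; exact congrArg Subrepresentation.toSubmodule h
  · right; exact congrArg Subrepresentation.toSubmodule h

theorem nontrivial_of_isIrreducible {ρ : Representation ℂ G V} (hρ : ρ.IsIrreducible) :
    Nontrivial V := by
  by_contra hV
  rw [not_nontrivial_iff_subsingleton] at hV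
  obtain ⟨a, b, hab⟩ := hρ.toNontrivial
  refine hab (Subrepresentation.toSubmodule_injective (Subsingleton.elim _ _))

/-- The restriction of a representation to a stable subspace. -/
def subrep (ρ : Representation ℂ G V) (W : Submodule ℂ V) (hW : ∀ g, ∀ v ∈ W, ρ g v ∈ W) :
    Representation ℂ G W :=
  Subrepresentation.toRepresentation (ρ := ρ) ⟨W, fun g v hv => hW g v hv⟩

@[simp] theorem coe_subrep (ρ : Representation ℂ G V) (W : Submodule ℂ V)
    (hW : ∀ g, ∀ v ∈ W, ρ g v ∈ W) (g : G) (w : W) : (subrep ρ W hW g w : V) = ρ g w := rfl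

theorem exists_stable_isCompl [Finite G] (ρ : Representation ℂ G V) (W : Submodule ℂ V)
    (hW : ∀ g, ∀ v ∈ W, ρ g v ∈ W) :
    ∃ C : Submodule ℂ V, (∀ g, ∀ v ∈ C, ρ g v ∈ C) ∧ IsCompl W C := by
  have : NeZero (Nat.card G : ℂ) := ⟨by simp [Nat.card_eq_zero, ‹Finite G›]⟩
  have hs : ρ.IsSemisimpleRepresentation :=
    (Representation.isSemisimpleRepresentation_iff_isSemisimpleModule_asModule ρ).2 inferInstance
  obtain ⟨C, hC⟩ := hs.exists_isCompl ⟨W, fun g v hv => hW g v hv⟩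
  refine ⟨C.toSubmodule, C.apply_mem_toSubmodule, ?_, ?_⟩
  · rw [disjoint_iff]
    exact congrArg Subrepresentation.toSubmodule hC.inf_eq_bot
  · rw [codisjoint_iff]
    exact congrArg Subrepresentation.toSubmodule hC.sup_eq_top

theorem exists_isIrreducible_le [FiniteDimensional ℂ V] (ρ : Representation ℂ G V)
    (W : Submodule ℂ V) (hW : ∀ g, ∀ v ∈ W, ρ g v ∈ W) (h0 : W ≠ ⊥) :
    ∃ (S : Submodule ℂ V) (hS : ∀ g, ∀ v ∈ S, ρ g v ∈ S), S ≤ W ∧ S ≠ ⊥ ∧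
      (subrep ρ S hS).IsIrreducible := by
  obtain ⟨S, ⟨hS, hSW, hS0⟩, hmin⟩ := WellFounded.has_min
    (wellFounded_lt : WellFounded ((· < ·) : Submodule ℂ V → Submodule ℂ V → Prop))
    {S | (∀ g, ∀ v ∈ S, ρ g v ∈ S) ∧ S ≤ W ∧ S ≠ ⊥} ⟨W, hW, le_rfl, h0⟩
  refine ⟨S, hS, hSW, hS0, ?_⟩
  have : Nontrivial S := (Submodule.nontrivial_iff_ne_bot).2 hS0
  refine isIrreducible_of_forall _ fun T hT => ?_
  by_cases hT0 : T = ⊥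
  · exact Or.inl hT0
  right
  have h1 : T.map S.subtype ≤ S := Submodule.map_subtype_le S T
  have h2 : ¬ T.map S.subtype < S := by
    refine hmin _ ⟨?_, h1.trans hSW, ?_⟩
    · rintro g _ ⟨t, ht, rfl⟩
      exact ⟨_, hT g t ht, rfl⟩
    · intro h
      exact hT0 (Submodule.map_injective_of_injective S.subtype_injective
        (h.trans (Submodule.map_bot _).symm))
  have h3 : T.map S.subtype = S := by
    by_contra h; exact h2 (lt_of_le_of_ne h1 h)
  rw [eq_top_iff]
  intro x _
  have : (x : V) ∈ T.map S.subtype := by rw [h3]; exact x.2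
  obtain ⟨t, ht, htx⟩ := this
  have : t = x := Subtype.ext htx
  exact this ▸ ht

variable [FiniteDimensional ℂ V]

theorem character_eq_add_of_isCompl (ρ : Representation ℂ G V) (W C : Submodule ℂ V)
    (hW : ∀ g, ∀ v ∈ W, ρ g v ∈ W) (hC : ∀ g, ∀ v ∈ C, ρ g v ∈ C) (h : IsCompl W C) (g : G) :
    ρ.character g = (subrep ρ W hW).character g + (subrep ρ C hC).character g := by
  have hint : DirectSum.IsInternal (fun b : Bool => cond b W C) :=
    (DirectSum.isInternal_submodule_iff_isCompl _ (i := true) (j := false) (by simp)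
      (by ext b; cases b <;> simp)).2 h
  have := LinearMap.trace_eq_sum_trace_restrict hint (f := ρ g)
    (by intro b; cases b; exacts [hC g, hW g])
  rw [Fintype.sum_bool] at this
  exact this

open scoped ComplexOrder in
theorem character_inv_eq_star [Finite G] (ρ : Representation ℂ G V) (g : G) :
    ρ.character g⁻¹ = star (ρ.character g) := by
  have := Fintype.ofFinite G
  let b := Module.finBasis ℂ V
  let A : G → Matrix _ _ ℂ := fun g => LinearMap.toMatrix b b (ρ g)
  have hA : ∀ x y, A (x * y) = A x * A y := fun x y => by
    simp [A, LinearMap.toMatrix_mul]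
  have hA1 : A 1 = 1 := by simp [A]
  let P := ∑ x, (A x)ᴴ * A x
  have hP : P.PosDef := by
    have : P = (A 1)ᴴ * A 1 + ∑ x ∈ Finset.univ.erase 1, (A x)ᴴ * A x :=
      (Finset.add_sum_erase _ _ (Finset.mem_univ _)).symm
    rw [this, hA1]
    refine Matrix.PosDef.add_posSemidef (by simpa using Matrix.PosDef.one) ?_
    exact Matrix.posSemidef_sum _ fun i _ => Matrix.posSemidef_conjTranspose_mul_self _
  have hu : IsUnit P := hP.isUnit
  have hinv : (A g)ᴴ * P * A g = P := by
    simp only [P, Finset.mul_sum, Finset.sum_mul]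
    refine Fintype.sum_equiv (Equiv.mulRight g) _ _ fun x => ?_
    simp [hA, Matrix.conjTranspose_mul, Matrix.mul_assoc]
  have htr : ∀ x, ρ.character x = (A x).trace := fun x =>
    LinearMap.trace_eq_matrix_trace ℂ b (ρ x)
  have h1 : P * A g⁻¹ = (A g)ᴴ * P := by
    calc P * A g⁻¹ = (A g)ᴴ * P * (A g * A g⁻¹) := by
          rw [← Matrix.mul_assoc, hinv]
      _ = _ := by rw [← hA, mul_inv_cancel, hA1, Matrix.mul_one]
  obtain ⟨u, hu⟩ := hu
  have h2 : A g⁻¹ = (↑u⁻¹ : Matrix _ _ ℂ) * ((A g)ᴴ * P) := by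
    rw [← h1, ← hu, ← Matrix.mul_assoc, Units.inv_mul, Matrix.one_mul]
  rw [htr, htr, h2, Matrix.trace_mul_comm, Matrix.mul_assoc, ← hu, Units.mul_inv, Matrix.mul_one,
    Matrix.trace_conjTranspose]

theorem character_mul_character_inv [Finite G] (ρ : Representation ℂ G V) (g : G) :
    ρ.character g * ρ.character g⁻¹ = ((Complex.normSq (ρ.character g) : ℝ) : ℂ) := by
  rw [character_inv_eq_star, Complex.star_def, Complex.mul_conj]

theorem sum_character_mul_inv [Fintype G] {U : Type} [AddCommGroup U] [Module ℂ U]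
    [FiniteDimensional ℂ U] (σ : Representation ℂ G U) (ρ : Representation ℂ G V) :
    ∑ g : G, σ.character g * ρ.character g⁻¹ =
      Fintype.card G * (Module.finrank ℂ (Representation.IntertwiningMap ρ σ) : ℂ) := by
  have hc : (Nat.card G : ℂ) ≠ 0 := by simp
  have : Invertible (Nat.card G : ℂ) := invertibleOfNonzero hc
  rw [← Representation.card_inv_mul_sum_char_mul_char_eq_finrank, ← Nat.card_eq_fintype_card,
    mul_inv_cancel_left₀ hc]

theorem sum_normSq_of_isIrreducible [Fintype G] {ρ : Representation ℂ G V}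
    (hρ : ρ.IsIrreducible) :
    ∑ g : G, Complex.normSq (ρ.character g) = Fintype.card G := by
  have h := sum_character_mul_inv ρ ρ
  have := hρ
  rw [Representation.IsIrreducible.finrank_intertwiningMap_self, Nat.cast_one, mul_one] at h
  simp only [character_mul_character_inv] at h
  exact_mod_cast h

theorem card_le_sum_normSq [Fintype G] [Nontrivial V] (ρ : Representation ℂ G V) :
    (Fintype.card G : ℝ) ≤ ∑ g : G, Complex.normSq (ρ.character g) := by
  have h := sum_character_mul_inv ρ ρ
  simp only [character_mul_character_inv] at h
  have h' : ∑ g : G, Complex.normSq (ρ.character g) =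
      Fintype.card G * (Module.finrank ℂ (Representation.IntertwiningMap ρ ρ) : ℝ) := by
    exact_mod_cast h
  rw [h']
  have : FiniteDimensional ℂ (Representation.IntertwiningMap ρ ρ) :=
    FiniteDimensional.of_injective
      ({ toFun := fun f => f.toLinearMap
         map_add' := fun _ _ => rfl
         map_smul' := fun _ _ => rfl } : Representation.IntertwiningMap ρ ρ →ₗ[ℂ] V →ₗ[ℂ] V)
      (Representation.IntertwiningMap.toLinearMap_injective _ _)
  have : Nontrivial (Representation.IntertwiningMap ρ ρ) := by
    obtain ⟨v, hv⟩ := exists_ne (0 : V)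
    refine ⟨⟨Representation.IntertwiningMap.id ρ, 0, fun h => hv ?_⟩⟩
    simpa using congrArg (fun f : Representation.IntertwiningMap ρ ρ => f v) h
  have : 1 ≤ Module.finrank ℂ (Representation.IntertwiningMap ρ ρ) := Module.finrank_pos
  have : (1 : ℝ) ≤ (Module.finrank ℂ (Representation.IntertwiningMap ρ ρ) : ℝ) := by
    exact_mod_cast this
  have hp : (0 : ℝ) ≤ Fintype.card G := by positivity
  nlinarith

end Basic

section Twisted

variable {M : Type} [Group M] {V : Type} [AddCommGroup V] [Module ℂ V]

/-- A bilinear form `B` is `ι`-invariant if `B (x v) (ι(x) w) = B v w`. -/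
def IsTwisted (ι : MulAut M) (ρ : Representation ℂ M V) (B : V →ₗ[ℂ] V →ₗ[ℂ] ℂ) : Prop :=
  ∀ x v w, B (ρ x v) (ρ (ι x) w) = B v w

/-- No irreducible representation of `M` carries a nonzero alternating `ι`-invariant form. -/
def NoAlt (ι : MulAut M) : Prop :=
  ∀ (V : Type) [AddCommGroup V] [Module ℂ V] [FiniteDimensional ℂ V] (ρ : Representation ℂ M V),
    ρ.IsIrreducible → ∀ B : V →ₗ[ℂ] V →ₗ[ℂ] ℂ, B.IsAlt → IsTwisted ι ρ B → B = 0

theorem isAlt_of_skew {B : V →ₗ[ℂ] V →ₗ[ℂ] ℂ} (h : ∀ v w, B v w = - B w v) : B.IsAlt := by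
  intro v
  have := h v v
  have h2 : (2 : ℂ) * B v v = 0 := by linear_combination this
  simpa using h2

theorem character_eq_of_isConj [FiniteDimensional ℂ V] (ρ : Representation ℂ M V) {x y : M}
    (h : IsConj x y) : ρ.character x = ρ.character y := by
  obtain ⟨c, rfl⟩ := isConj_iff.1 h
  rw [Representation.char_conj]

theorem IsTwisted.compl₂_of_mul {ι ι' : MulAut M} {m : M} (hm : m * ι m = 1)
    (hι : ∀ x, ι' x = m * ι x * m⁻¹) {ρ : Representation ℂ M V} {B : V →ₗ[ℂ] V →ₗ[ℂ] ℂ}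
    (hB : B.IsAlt) (hT : IsTwisted ι' ρ B) :
    (B.compl₂ (ρ m)).IsAlt ∧ IsTwisted ι ρ (B.compl₂ (ρ m)) := by
  have hιm : ι m = m⁻¹ := (inv_eq_of_mul_eq_one_right hm).symm
  have key : ∀ v w, B (ρ m v) w = B v (ρ m w) := fun v w => by
    have := hT m v (ρ m w)
    rw [hι, hιm, mul_inv_cancel, one_mul, Representation.inv_self_apply] at this
    exact this
  refine ⟨isAlt_of_skew fun v w => ?_, fun x v w => ?_⟩
  · rw [LinearMap.compl₂_apply, LinearMap.compl₂_apply, ← key, ← hB.neg]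
  · have := hT x v (ρ m w)
    rw [LinearMap.compl₂_apply, LinearMap.compl₂_apply, ← this, hι, ← Module.End.mul_apply,
      ← Module.End.mul_apply, ← map_mul, ← map_mul, inv_mul_cancel_right]

theorem NoAlt.of_mul {ι ι' : MulAut M} (h : NoAlt ι) (m : M) (hm : m * ι m = 1)
    (hι : ∀ x, ι' x = m * ι x * m⁻¹) : NoAlt ι' := by
  intro V _ _ _ ρ hρ B hB hT
  have hB' := IsTwisted.compl₂_of_mul hm hι hB hT
  have h0 := h V ρ hρ _ hB'.1 hB'.2
  ext v w
  have := LinearMap.congr_fun₂ h0 v (ρ m⁻¹ w)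
  rwa [LinearMap.compl₂_apply, Representation.self_inv_apply] at this

theorem NoAlt.of_surjective {K : Type} [Group K] {κ : MulAut K} {ι : MulAut M} (h : NoAlt κ)
    (j : K →* M) (hj : Function.Surjective j) (hκ : ∀ x, ι (j x) = j (κ x)) : NoAlt ι := by
  intro V _ _ _ ρ hρ B hB hT
  have := nontrivial_of_isIrreducible hρ
  refine h V (ρ.comp j) (isIrreducible_of_forall _ fun W hW => ?_) B hB fun x v w => ?_
  · refine eq_bot_or_eq_top hρ W fun g v hv => ?_
    obtain ⟨x, rfl⟩ := hj g
    exact hW x v hv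
  · have := hT (j x) v w
    rw [hκ] at this
    exact this

theorem IsTwisted.apply_right {ι : MulAut M} (hι : ∀ x, ι (ι x) = x) {ρ : Representation ℂ M V}
    {B : V →ₗ[ℂ] V →ₗ[ℂ] ℂ} (h : IsTwisted ι ρ B) (x : M) (v w : V) :
    B v (ρ x w) = B (ρ (ι x)⁻¹ v) w := by
  have := h (ι x) (ρ (ι x)⁻¹ v) w
  rwa [hι, Representation.self_inv_apply] at this

theorem exists_maximal_isotropic [FiniteDimensional ℂ V] (ρ : Representation ℂ M V)
    (B : V →ₗ[ℂ] V →ₗ[ℂ] ℂ) :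
    ∃ L : Submodule ℂ V, ((∀ g, ∀ v ∈ L, ρ g v ∈ L) ∧ ∀ v ∈ L, ∀ w ∈ L, B v w = 0) ∧
      ∀ L' : Submodule ℂ V, (∀ g, ∀ v ∈ L', ρ g v ∈ L') → (∀ v ∈ L', ∀ w ∈ L', B v w = 0) →
        ¬ L < L' := by
  obtain ⟨L, hL, hmax⟩ := WellFounded.has_min
    (wellFounded_gt : WellFounded ((· > ·) : Submodule ℂ V → Submodule ℂ V → Prop))
    {L | (∀ g, ∀ v ∈ L, ρ g v ∈ L) ∧ ∀ v ∈ L, ∀ w ∈ L, B v w = 0} ⟨⊥, by simp, by simp⟩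
  exact ⟨L, hL, fun L' h1 h2 => hmax L' ⟨h1, h2⟩⟩

theorem ker_eq_bot_of_ne_zero {ι : MulAut M} {ρ : Representation ℂ M V} (hρ : ρ.IsIrreducible)
    (hι : ∀ x, ι (ι x) = x)
    {B : V →ₗ[ℂ] V →ₗ[ℂ] ℂ} (hT : IsTwisted ι ρ B) (h0 : B ≠ 0) : LinearMap.ker B = ⊥ := by
  refine (eq_bot_or_eq_top hρ _ fun g v hv => ?_).resolve_right fun h =>
    h0 (LinearMap.ker_eq_top.1 h)
  rw [LinearMap.mem_ker] at hv ⊢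
  ext w
  have := hT.apply_right hι (ι g)⁻¹ v w
  rw [← map_inv, hι, inv_inv] at this
  rw [← this, hv]; rfl

variable [FiniteDimensional ℂ V]

theorem exists_half_character [Finite M] {ι : MulAut M} (hι : ∀ x, ι (ι x) = x) (hN : NoAlt ι)
    (ρ : Representation ℂ M V) {B : V →ₗ[ℂ] V →ₗ[ℂ] ℂ} (hB : B.IsAlt) (hT : IsTwisted ι ρ B)
    (hnd : ∀ v, (∀ w, B v w = 0) → v = 0) :
    ∃ (L : Submodule ℂ V) (hL : ∀ g, ∀ v ∈ L, ρ g v ∈ L), ∀ x,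
      ρ.character x = (subrep ρ L hL).character x + (subrep ρ L hL).character (ι x⁻¹) := by
  obtain ⟨L, ⟨hL, hLi⟩, hmax⟩ := exists_maximal_isotropic ρ B
  obtain ⟨C, hC, hLC⟩ := exists_stable_isCompl ρ L hL
  refine ⟨L, hL, fun x => ?_⟩
  let D : Submodule ℂ V :=
    { carrier := {c | c ∈ C ∧ ∀ l ∈ L, B l c = 0}
      add_mem' := fun {a b} ha hb => ⟨C.add_mem ha.1 hb.1, fun l hl => by
        rw [map_add, ha.2 l hl, hb.2 l hl, add_zero]⟩
      zero_mem' := ⟨C.zero_mem, fun l _ => map_zero _⟩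
      smul_mem' := fun c a ha => ⟨C.smul_mem c ha.1, fun l hl => by
        rw [map_smul, ha.2 l hl, smul_zero]⟩ }
  have hD : ∀ g, ∀ v ∈ D, ρ g v ∈ D := fun g v hv => ⟨hC g v hv.1, fun l hl => by
    rw [hT.apply_right hι]
    exact hv.2 _ (hL _ _ hl)⟩
  have hD0 : D = ⊥ := by
    by_contra hD0
    obtain ⟨S, hS, hSD, hS0, hSirr⟩ := exists_isIrreducible_le ρ D hD hD0
    have hBS := hN S (subrep ρ S hS) hSirr (B.domRestrict₁₂ S S) (fun v => hB v)
      (fun x v w => hT x v w)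
    have hBS' : ∀ v ∈ S, ∀ w ∈ S, B v w = 0 := fun v hv w hw =>
      LinearMap.congr_fun₂ hBS ⟨v, hv⟩ ⟨w, hw⟩
    have hLS : ∀ l ∈ L, ∀ s ∈ S, B l s = 0 := fun l hl s hs => (hSD hs).2 l hl
    refine hmax (L ⊔ S) ?_ ?_ ?_
    · intro g v hv
      obtain ⟨l, hl, s, hs, rfl⟩ := Submodule.mem_sup.1 hv
      rw [map_add]
      exact Submodule.add_mem_sup (hL g l hl) (hS g s hs)
    · intro v hv w hw
      obtain ⟨l, hl, s, hs, rfl⟩ := Submodule.mem_sup.1 hv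
      obtain ⟨l', hl', s', hs', rfl⟩ := Submodule.mem_sup.1 hw
      rw [map_add, map_add, LinearMap.add_apply, LinearMap.add_apply, hLi l hl l' hl',
        hLS l hl s' hs', hBS' s hs s' hs', ← hB.neg, hLS l' hl' s hs]
      simp
    · refine lt_of_le_of_ne le_sup_left fun h => hS0 ?_
      have h1 : S ≤ L := by rw [h]; exact le_sup_right
      have h2 : S ≤ C := fun s hs => (hSD hs).1
      exact le_bot_iff.1 (hLC.disjoint h1 h2)
  have hinj : Function.Injective ((B.domRestrict₁₂ L C).flip) := by
    rw [← LinearMap.ker_eq_bot, LinearMap.ker_eq_bot']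
    intro c hc
    have : (c : V) ∈ D := ⟨c.2, fun l hl => LinearMap.congr_fun hc ⟨l, hl⟩⟩
    rw [hD0, Submodule.mem_bot] at this
    exact Subtype.ext this
  have hinj' : Function.Injective (B.domRestrict₁₂ L C) := by
    rw [← LinearMap.ker_eq_bot, LinearMap.ker_eq_bot']
    intro l hl
    refine Subtype.ext (hnd l fun w => ?_)
    have : w ∈ L ⊔ C := by rw [hLC.sup_eq_top]; trivial
    obtain ⟨l', hl', c, hc, rfl⟩ := Submodule.mem_sup.1 this
    rw [map_add, hLi l l.2 l' hl', zero_add]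
    exact LinearMap.congr_fun hl ⟨c, hc⟩
  have hdim : Module.finrank ℂ C = Module.finrank ℂ (Module.Dual ℂ L) := by
    refine le_antisymm (LinearMap.finrank_le_finrank_of_injective hinj) ?_
    have := LinearMap.finrank_le_finrank_of_injective hinj'
    rw [Subspace.dual_finrank_eq] at this ⊢
    exact this
  let φ : C ≃ₗ[ℂ] Module.Dual ℂ L := LinearEquiv.ofInjectiveOfFinrankEq _ hinj hdim
  have hφ : ∀ (c : C) (l : L), φ c l = B l c := fun c l => rfl
  rw [character_eq_add_of_isCompl ρ L C hL hC hLC]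
  congr 1
  have : φ.conj (subrep ρ C hC x) = Module.Dual.transpose (subrep ρ L hL (ι x⁻¹)) := by
    rw [LinearEquiv.conj_apply]
    ext f l
    obtain ⟨c, rfl⟩ := φ.surjective f
    simp only [LinearMap.comp_apply, LinearEquiv.coe_coe, LinearEquiv.symm_apply_apply, hφ,
      coe_subrep, Module.Dual.transpose_apply]
    rw [hT.apply_right hι, ← map_inv ι x]
  calc (subrep ρ C hC).character x = LinearMap.trace ℂ _ (φ.conj (subrep ρ C hC x)) :=
        (LinearMap.trace_conj' _ _).symm
    _ = _ := by rw [this]; exact LinearMap.trace_transpose' _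

theorem four_mul_card_le_sum_normSq [Fintype M] [Nontrivial V] {ι : MulAut M}
    (hι : ∀ x, ι (ι x) = x) (hN : NoAlt ι) (hI : ∀ x, IsConj (ι x) x⁻¹)
    (ρ : Representation ℂ M V) {B : V →ₗ[ℂ] V →ₗ[ℂ] ℂ} (hB : B.IsAlt) (hT : IsTwisted ι ρ B)
    (hnd : ∀ v, (∀ w, B v w = 0) → v = 0) :
    4 * (Fintype.card M : ℝ) ≤ ∑ g : M, Complex.normSq (ρ.character g) := by
  obtain ⟨L, hL, h⟩ := exists_half_character hι hN ρ hB hT hnd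
  have h' : ∀ x, ρ.character x = 2 * (subrep ρ L hL).character x := fun x => by
    have := hI x⁻¹
    rw [inv_inv] at this
    rw [h, character_eq_of_isConj (subrep ρ L hL) this]
    ring
  have hLn : Nontrivial L := by
    by_contra hLn
    rw [not_nontrivial_iff_subsingleton] at hLn
    have h1 := h' 1
    rw [Representation.char_one, Representation.char_one,
      Module.finrank_zero_of_subsingleton (M := L), Nat.cast_zero, mul_zero] at h1
    exact Module.finrank_pos.ne' (Nat.cast_eq_zero.1 h1)
  have := card_le_sum_normSq (subrep ρ L hL)
  simp only [h', map_mul, ← Finset.mul_sum]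
  have h2 : Complex.normSq 2 = 4 := by norm_num [Complex.normSq_apply]
  rw [h2]
  linarith

theorem NoAlt.of_injective {K : Type} [Group K] [Finite M] [Finite K] {κ : MulAut K} {ι : MulAut M}
    (h : NoAlt κ) (hκ : ∀ x, κ (κ x) = x) (hι : ∀ x, ι (ι x) = x) (hI : ∀ x, IsConj (κ x) x⁻¹)
    (j : K →* M) (hj : Function.Injective j) (hjκ : ∀ x, ι (j x) = j (κ x))
    (hcard : Nat.card M < 4 * Nat.card K) : NoAlt ι := by
  intro V _ _ _ ρ hρ B hB hT
  by_contra h0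
  have := nontrivial_of_isIrreducible hρ
  have hker := ker_eq_bot_of_ne_zero hρ hι hT h0
  have := Fintype.ofFinite M
  have := Fintype.ofFinite K
  have h1 := four_mul_card_le_sum_normSq hκ h hI (ρ.comp j) hB
    (fun x v w => by have := hT (j x) v w; rw [hjκ] at this; exact this)
    (fun v hv => by
      rw [← Submodule.mem_bot ℂ, ← hker, LinearMap.mem_ker]; ext w; exact hv w)
  have h2 := sum_normSq_of_isIrreducible hρ
  have h3 : ∑ g : K, Complex.normSq (Representation.character (ρ.comp j) g) ≤
      ∑ g : M, Complex.normSq (ρ.character g) := by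
    calc _ = ∑ g ∈ Finset.univ.map ⟨j, hj⟩, Complex.normSq (ρ.character g) := by
          rw [Finset.sum_map]; rfl
      _ ≤ _ := Finset.sum_le_sum_of_subset_of_nonneg (Finset.subset_univ _)
        fun _ _ _ => Complex.normSq_nonneg _
  rw [Nat.card_eq_fintype_card, Nat.card_eq_fintype_card] at hcard
  have h4 : (Fintype.card M : ℝ) < 4 * Fintype.card K := by exact_mod_cast hcard
  linarith

theorem NoAlt.of_commute [Finite M] (ι : MulAut M) (hM : ∀ x y : M, x * y = y * x) : NoAlt ι := by
  intro V _ _ _ ρ hρ B hB _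
  have : IsMulCommutative M := ⟨⟨hM⟩⟩
  have h1 : Module.finrank ℂ V = 1 :=
    Representation.IsIrreducible.finrank_eq_one_of_isMulCommutative ρ
  obtain ⟨e, he, hspan⟩ := finrank_eq_one_iff'.1 h1
  ext v w
  obtain ⟨a, rfl⟩ := hspan v
  obtain ⟨b, rfl⟩ := hspan w
  simp [hB e]

end Twisted

section Product

theorem exists_twisted_form_of_character {M : Type} [Group M] [Finite M] {V : Type} [AddCommGroup V]
    [Module ℂ V] [FiniteDimensional ℂ V] {ι : MulAut M}
    {ρ : Representation ℂ M V} (hρ : ρ.IsIrreducible)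
    (hχ : ∀ x, ρ.character (ι x⁻¹) = ρ.character x) :
    ∃ B : V →ₗ[ℂ] V →ₗ[ℂ] ℂ, IsTwisted ι ρ B ∧ B ≠ 0 ∧
      ∀ B', IsTwisted ι ρ B' → ∃ c : ℂ, c • B = B' := by
  have := Fintype.ofFinite M
  let σ : Representation ℂ M (Module.Dual ℂ V) :=
    Representation.dual (ρ.comp (ι : M ≃* M).toMonoidHom)
  have hσ : ∀ x f w, σ x f w = f (ρ (ι x⁻¹) w) := fun x f w => rfl
  have hiff : ∀ B : V →ₗ[ℂ] V →ₗ[ℂ] ℂ, (∀ x v, B (ρ x v) = σ x (B v)) ↔ IsTwisted ι ρ B := by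
    intro B
    constructor
    · intro h x v w
      rw [h, hσ, map_inv ι, Representation.inv_self_apply]
    · intro h x v
      ext w
      rw [hσ, ← h x v, map_inv ι, Representation.self_inv_apply]
  have hchar : ∀ x, σ.character x = ρ.character x := fun x =>
    (Representation.char_dual _ _).trans (hχ x)
  have h1 := sum_character_mul_inv σ ρ
  simp only [hchar] at h1
  rw [sum_character_mul_inv ρ ρ, Representation.IsIrreducible.finrank_intertwiningMap_self] at h1
  have h2 : Module.finrank ℂ (Representation.IntertwiningMap ρ σ) = 1 := by
    have := mul_left_cancel₀ (by simp) h1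
    exact_mod_cast this.symm
  obtain ⟨f, hf, hspan⟩ := finrank_eq_one_iff'.1 h2
  refine ⟨f.toLinearMap, (hiff _).1 fun x v => f.isIntertwining ρ σ x v, fun h => hf ?_, ?_⟩
  · exact Representation.IntertwiningMap.ext h
  · intro B' hB'
    obtain ⟨c, hc⟩ := hspan (B'.intertwiningMap_of_isIntertwiningMap ρ σ ((hiff B').2 hB'))
    exact ⟨c, congrArg Representation.IntertwiningMap.toLinearMap hc⟩

theorem exists_twisted_form {M : Type} [Group M] [Finite M] {V : Type} [AddCommGroup V]
    [Module ℂ V] [FiniteDimensional ℂ V] {ι : MulAut M} (hI : ∀ x, IsConj (ι x) x⁻¹)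
    {ρ : Representation ℂ M V} (hρ : ρ.IsIrreducible) :
    ∃ B : V →ₗ[ℂ] V →ₗ[ℂ] ℂ, IsTwisted ι ρ B ∧ B ≠ 0 ∧
      ∀ B', IsTwisted ι ρ B' → ∃ c : ℂ, c • B = B' :=
  exists_twisted_form_of_character hρ fun x => by
    have := hI x⁻¹
    rw [inv_inv] at this
    exact character_eq_of_isConj ρ this

theorem IsTwisted.flip {M : Type} [Group M] {V : Type} [AddCommGroup V]
    [Module ℂ V] {ι : MulAut M} (hι : ∀ x, ι (ι x) = x) {ρ : Representation ℂ M V}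
    {B : V →ₗ[ℂ] V →ₗ[ℂ] ℂ} (h : IsTwisted ι ρ B) : IsTwisted ι ρ B.flip := fun x v w => by
  have := h (ι x) w v
  rwa [hι] at this

theorem NoAlt.symm_of_isTwisted {M : Type} [Group M] {V : Type} [AddCommGroup V]
    [Module ℂ V] [FiniteDimensional ℂ V] {ι : MulAut M} (hN : NoAlt ι)
    (hι : ∀ x, ι (ι x) = x) {ρ : Representation ℂ M V} (hρ : ρ.IsIrreducible)
    {B : V →ₗ[ℂ] V →ₗ[ℂ] ℂ} (h : IsTwisted ι ρ B) (v w : V) : B v w = B w v := by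
  have h0 : B - B.flip = 0 := by
    refine hN V ρ hρ _ (fun v => by simp) fun x v w => ?_
    have h1 := h x v w
    have h2 := h.flip hι x v w
    simp only [LinearMap.sub_apply]
    rw [h1, h2]
  exact sub_eq_zero.1 (LinearMap.congr_fun₂ h0 v w)

theorem NoAlt.prod {M₁ M₂ : Type} [Group M₁] [Group M₂] [Finite M₁] {ι₁ : MulAut M₁}
    {ι₂ : MulAut M₂} (h₁ : NoAlt ι₁) (h₂ : NoAlt ι₂) (hι₁ : ∀ x, ι₁ (ι₁ x) = x)
    (hI₁ : ∀ x, IsConj (ι₁ x) x⁻¹) :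
    NoAlt (MulEquiv.prodCongr ι₁ ι₂ : MulAut (M₁ × M₂)) := by
  intro V _ _ _ ρ hρ B hB hT
  have hVn := nontrivial_of_isIrreducible hρ
  set ρ₁ : Representation ℂ M₁ V := ρ.comp (MonoidHom.inl M₁ M₂) with hρ₁
  set ρ₂ : Representation ℂ M₂ V := ρ.comp (MonoidHom.inr M₁ M₂) with hρ₂
  have hρ12 : ∀ x y v, ρ (x, y) v = ρ₁ x (ρ₂ y v) := fun x y v => by
    rw [hρ₁, hρ₂, MonoidHom.comp_apply, MonoidHom.comp_apply, ← Module.End.mul_apply, ← map_mul]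
    simp
  have hρ21 : ∀ x y v, ρ (x, y) v = ρ₂ y (ρ₁ x v) := fun x y v => by
    rw [hρ₁, hρ₂, MonoidHom.comp_apply, MonoidHom.comp_apply, ← Module.End.mul_apply, ← map_mul]
    simp
  have hT₁ : IsTwisted ι₁ ρ₁ B := fun x v w => by
    have h := hT (x, 1) v w
    have h' : (MulEquiv.prodCongr ι₁ ι₂ : MulAut (M₁ × M₂)) (x, 1) = (ι₁ x, 1) :=
      Prod.ext rfl (map_one ι₂)
    rwa [h'] at h
  have hT₂ : IsTwisted ι₂ ρ₂ B := fun x v w => by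
    have h := hT (1, x) v w
    have h' : (MulEquiv.prodCongr ι₁ ι₂ : MulAut (M₁ × M₂)) (1, x) = (1, ι₂ x) :=
      Prod.ext (map_one ι₁) rfl
    rwa [h'] at h
  obtain ⟨S, hS, -, hS0, hSirr⟩ := exists_isIrreducible_le ρ₁ ⊤ (by simp) top_ne_bot
  set σ := subrep ρ₁ S hS with hσ
  obtain ⟨B₁, hB₁, hB₁0, huniq⟩ := exists_twisted_form hI₁ hSirr
  have hsymm := h₁.symm_of_isTwisted hι₁ hSirr hB₁
  obtain ⟨s, hs⟩ : ∃ s, B₁ s s ≠ 0 := by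
    by_contra! hcon
    exact hB₁0 (h₁ S σ hSirr B₁ hcon hB₁)
  let IsI : (S →ₗ[ℂ] V) → Prop := fun f => ∀ x v, f (σ x v) = ρ₁ x (f v)
  have hpost : ∀ f, IsI f → ∀ y, IsI (ρ₂ y ∘ₗ f) := fun f hf y x v => by
    rw [LinearMap.comp_apply, hf, LinearMap.comp_apply, ← hρ21, hρ12]
  have hform : ∀ f g, IsI f → IsI g → B (f s) (g s) = 0 → ∀ v w, B (f v) (g w) = 0 := by
    intro f g hf hg h0 v w
    obtain ⟨c, hc⟩ := huniq (B.compl₁₂ f g) fun x v w => by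
      rw [LinearMap.compl₁₂_apply, LinearMap.compl₁₂_apply, hf, hg]
      exact hT₁ x _ _
    have hc' : ∀ v w, c * B₁ v w = B (f v) (g w) := fun v w => LinearMap.congr_fun₂ hc v w
    rw [← hc' s s] at h0
    rw [← hc', (mul_eq_zero.1 h0).resolve_right hs, zero_mul]
  let X : Submodule ℂ V :=
    { carrier := {x | ∃ f, IsI f ∧ f s = x}
      add_mem' := by
        rintro _ _ ⟨f, hf, rfl⟩ ⟨g, hg, rfl⟩
        exact ⟨f + g, fun x v => by simp [hf x v, hg x v], rfl⟩
      zero_mem' := ⟨0, fun x v => by simp, rfl⟩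
      smul_mem' := by
        rintro c _ ⟨f, hf, rfl⟩
        exact ⟨c • f, fun x v => by simp [hf x v], rfl⟩ }
  have hX : ∀ g, ∀ v ∈ X, ρ₂ g v ∈ X := by
    rintro y _ ⟨f, hf, rfl⟩
    exact ⟨_, hpost f hf y, rfl⟩
  have hX0 : X ≠ ⊥ := by
    intro h
    have hsX : (s : V) ∈ X := ⟨S.subtype, fun x v => rfl, rfl⟩
    rw [h, Submodule.mem_bot] at hsX
    have hs0 : s = 0 := Subtype.ext hsX
    exact hs (by simp [hs0])
  obtain ⟨Y, hY, hYX, hY0, hYirr⟩ := exists_isIrreducible_le ρ₂ X hX hX0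
  have hBY : ∀ v ∈ Y, ∀ w ∈ Y, B v w = 0 := fun v hv w hw =>
    LinearMap.congr_fun₂ (h₂ Y (subrep ρ₂ Y hY) hYirr (B.domRestrict₁₂ Y Y) (fun v => hB v)
      (fun x v w => hT₂ x v w)) ⟨v, hv⟩ ⟨w, hw⟩
  let T : Set V := {u | ∃ f v, IsI f ∧ f s ∈ Y ∧ f v = u}
  have hU : ∀ g, ∀ v ∈ Submodule.span ℂ T, ρ g v ∈ Submodule.span ℂ T := by
    rintro ⟨x, y⟩ v hv
    refine Submodule.span_induction (p := fun v _ => ρ (x, y) v ∈ Submodule.span ℂ T) ?_ (by simp)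
      (fun a b _ _ ha hb => by rw [map_add]; exact Submodule.add_mem _ ha hb)
      (fun c a _ ha => by rw [map_smul]; exact Submodule.smul_mem _ c ha) hv
    rintro _ ⟨f, v, hf, hfs, rfl⟩
    rw [hρ21, ← hf]
    exact Submodule.subset_span ⟨_, σ x v, hpost f hf y, hY y _ hfs, rfl⟩
  have hUtop : Submodule.span ℂ T = ⊤ := by
    refine (eq_bot_or_eq_top hρ _ hU).resolve_left fun h => hY0 ?_
    rw [eq_bot_iff, ← h]
    intro y hy
    obtain ⟨f, hf, rfl⟩ := hYX hy
    exact Submodule.subset_span ⟨f, s, hf, hy, rfl⟩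
  refine LinearMap.ext_on hUtop ?_
  rintro _ ⟨f, v, hf, hfs, rfl⟩
  refine LinearMap.ext_on hUtop ?_
  rintro _ ⟨g, w, hg, hgs, rfl⟩
  exact hform f g hf hg (hBY _ hfs _ hgs) v w

end Product

section Integrality

theorem isIntegral_trace_of_pow_succ_eq {V : Type} [AddCommGroup V] [Module ℂ V]
    [FiniteDimensional ℂ V] (A : V →ₗ[ℂ] V) {d : ℕ} (hd : 0 < d) (hA : A ^ (d + 1) = A) :
    IsIntegral ℤ (LinearMap.trace ℂ V A) := by
  have hs : A.charpoly.Splits := IsAlgClosed.splits _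
  rw [Module.End.trace_eq_sum_roots_charpoly_of_splits hs]
  refine IsIntegral.multiset_sum fun μ hμ => ?_
  have hev : Module.End.HasEigenvalue A μ :=
    (Module.End.hasEigenvalue_iff_isRoot_charpoly A μ).2 (Polynomial.isRoot_of_mem_roots hμ)
  obtain ⟨v, hv⟩ := hev.exists_hasEigenvector
  have h1 : μ ^ (d + 1) = μ := by
    have h := hv.pow_apply (d + 1)
    rw [hA, hv.apply_eq_smul] at h
    exact (smul_left_injective ℂ hv.2 h).symm
  refine ⟨Polynomial.X ^ (d + 1) - Polynomial.X, Polynomial.monic_X_pow_sub ?_, by simp [h1]⟩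
  rw [Polynomial.degree_X]
  exact_mod_cast Nat.lt_add_of_pos_left hd

variable {P : Type} [Group P] [Fintype P]

theorem isIntegral_character {V : Type} [AddCommGroup V] [Module ℂ V]
    [FiniteDimensional ℂ V] (ρ : Representation ℂ P V) (g : P) :
    IsIntegral ℤ (ρ.character g) :=
  isIntegral_trace_of_pow_succ_eq _ (Fintype.card_pos (α := P)) (by
    rw [pow_succ, ← map_pow, pow_card_eq_one, map_one, one_mul])

theorem isIntegral_average_trace {V : Type} [AddCommGroup V] [Module ℂ V]
    [FiniteDimensional ℂ V] (ρ : Representation ℂ P V) (Z : V →ₗ[ℂ] V) {d : ℕ} (hd : 0 < d)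
    (hZ : Z ^ d = 1) (hc : ∀ u, Z * ρ u = ρ u * Z) :
    IsIntegral ℤ ((Fintype.card P : ℂ)⁻¹ * ∑ u, LinearMap.trace ℂ V (Z * ρ u)) := by
  have hP : (Fintype.card P : ℂ) ≠ 0 := by simp
  set π : V →ₗ[ℂ] V := (Fintype.card P : ℂ)⁻¹ • ∑ u, ρ u with hπ
  have hmul : ∀ u, ρ u * π = π := fun u => by
    rw [hπ, mul_smul_comm, Finset.mul_sum]
    congr 1
    exact Fintype.sum_equiv (Equiv.mulLeft u) _ _ fun x => (map_mul ρ u x).symm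
  have hππ : π * π = π := by
    conv_lhs => rw [hπ]
    rw [smul_mul_assoc, Finset.sum_mul, Finset.sum_congr rfl fun u _ => hmul u, Finset.sum_const,
      Finset.card_univ, ← Nat.cast_smul_eq_nsmul ℂ, smul_smul, inv_mul_cancel₀ hP, one_smul]
  have hcomm : Commute Z π := by
    rw [hπ]
    exact Commute.smul_right (Commute.sum_right _ _ _ fun u _ => hc u) _
  have hpow : ∀ n : ℕ, π ^ (n + 1) = π := fun n => by
    induction n with
    | zero => simp
    | succ n ih => rw [pow_succ, ih, hππ]
  have htr : (Fintype.card P : ℂ)⁻¹ * ∑ u, LinearMap.trace ℂ V (Z * ρ u) =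
      LinearMap.trace ℂ V (Z * π) := by
    rw [hπ, mul_smul_comm, map_smul, Finset.mul_sum _ _ Z, map_sum, smul_eq_mul]
  rw [htr]
  refine isIntegral_trace_of_pow_succ_eq _ hd ?_
  rw [hcomm.mul_pow, hpow, pow_succ, hZ, one_mul]

/-- The permutation representation on functions. -/
def permRep (P X : Type) [Group P] [MulAction P X] : Representation ℂ P (X → ℂ) where
  toFun u := LinearMap.funLeft ℂ ℂ (fun x => u⁻¹ • x)
  map_one' := by ext; simp [LinearMap.funLeft]
  map_mul' u v := by ext; simp [LinearMap.funLeft, mul_smul]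

/-- The number of fixed points of `u` on `X`. -/
def fixCount {P : Type} (X : Type) [Group P] [MulAction P X] [Fintype X] (u : P) : ℕ :=
  (Finset.univ.filter fun x : X => u • x = x).card

theorem trace_permRep {P : Type} [Group P] (X : Type) [MulAction P X] [Fintype X] (u : P) :
    LinearMap.trace ℂ (X → ℂ) (permRep P X u) = fixCount X u := by
  rw [LinearMap.trace_eq_matrix_trace ℂ (Pi.basisFun ℂ X), Matrix.trace, fixCount,
    Finset.card_filter, Nat.cast_sum]
  refine Finset.sum_congr rfl fun x _ => ?_
  rw [Matrix.diag_apply, LinearMap.toMatrix_apply]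
  simp only [permRep, Pi.basisFun_apply, Pi.basisFun_repr, MonoidHom.coe_mk, OneHom.coe_mk,
    LinearMap.funLeft_apply, Pi.single_apply, inv_smul_eq_iff, Nat.cast_ite, Nat.cast_one,
    Nat.cast_zero]
  simp only [eq_comm]

theorem exists_rep_fixCount_pow {P : Type} [Group P] (X : Type) [MulAction P X] [Fintype X] {V : Type}
    [AddCommGroup V] [Module ℂ V] [FiniteDimensional ℂ V] (ρ : Representation ℂ P V)
    (Z : V →ₗ[ℂ] V) {d : ℕ} (hZ : Z ^ d = 1) (hc : ∀ u, Z * ρ u = ρ u * Z) (k : ℕ) :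
    ∃ (V' : Type) (_ : AddCommGroup V') (_ : Module ℂ V') (_ : FiniteDimensional ℂ V')
      (ρ' : Representation ℂ P V') (Z' : V' →ₗ[ℂ] V'), Z' ^ d = 1 ∧
      (∀ u, Z' * ρ' u = ρ' u * Z') ∧ ∀ u, LinearMap.trace ℂ V' (Z' * ρ' u) =
        (fixCount X u : ℂ) ^ k * LinearMap.trace ℂ V (Z * ρ u) := by
  induction k with
  | zero => exact ⟨V, _, _, inferInstance, ρ, Z, hZ, hc, by simp⟩
  | succ k ih =>
    obtain ⟨V', _, _, _, ρ', Z', h1, h2, h3⟩ := ih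
    refine ⟨TensorProduct ℂ (X → ℂ) V', inferInstance, inferInstance, inferInstance,
      (permRep P X).tprod ρ', TensorProduct.map 1 Z', ?_, ?_, ?_⟩
    · rw [TensorProduct.map_pow, one_pow, h1, TensorProduct.map_one]
    · intro u
      rw [Representation.tprod_apply, ← TensorProduct.map_mul, ← TensorProduct.map_mul, h2,
        one_mul, mul_one]
    · intro u
      rw [Representation.tprod_apply, ← TensorProduct.map_mul, one_mul,
        LinearMap.trace_tensorProduct', h3, trace_permRep]
      ring

theorem isIntegral_average_fixCount (X : Type) [MulAction P X] [Fintype X] {V : Type}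
    [AddCommGroup V] [Module ℂ V] [FiniteDimensional ℂ V] (ρ : Representation ℂ P V)
    (Z : V →ₗ[ℂ] V) {d : ℕ} (hd : 0 < d) (hZ : Z ^ d = 1) (hc : ∀ u, Z * ρ u = ρ u * Z) (k : ℕ) :
    IsIntegral ℤ ((Fintype.card P : ℂ)⁻¹ *
      ∑ u, (fixCount X u : ℂ) ^ k * LinearMap.trace ℂ V (Z * ρ u)) := by
  obtain ⟨V', _, _, _, ρ', Z', h1, h2, h3⟩ := exists_rep_fixCount_pow X ρ Z hZ hc k
  simp only [← h3]
  exact isIntegral_average_trace ρ' Z' hd h1 h2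

end Integrality

section FixCount

variable {C : Type} [Group C] {X : Type} [MulAction C X] [Fintype X]

theorem fixCount_conj (g u : C) : fixCount X (g * u * g⁻¹) = fixCount X u := by
  refine Finset.card_equiv (MulAction.toPerm g⁻¹) fun x => ?_
  simp only [Finset.mem_filter, Finset.mem_univ, true_and, MulAction.toPerm_apply, mul_smul]
  rw [eq_inv_smul_iff]

theorem fixCount_inv (u : C) : fixCount X u⁻¹ = fixCount X u := by
  unfold fixCount
  congr 1
  ext x
  simp only [Finset.mem_filter, Finset.mem_univ, true_and]
  rw [inv_smul_eq_iff, eq_comm]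

/-- An element of `2`-power order. -/
def IsTwoElt (u : C) : Prop := ∃ j : ℕ, u ^ 2 ^ j = 1

theorem isTwoElt_conj (g u : C) : IsTwoElt (g * u * g⁻¹) ↔ IsTwoElt u := by
  simp [IsTwoElt, conj_pow]

theorem IsTwoElt.odd_fixCount [Finite C] {u : C} (hu : IsTwoElt u) (hX : Odd (Fintype.card X)) :
    Odd (fixCount X u) := by
  obtain ⟨j, hj⟩ := hu
  have hp : IsPGroup 2 (Subgroup.zpowers u) := by
    rintro ⟨_, n, rfl⟩
    refine ⟨j, Subtype.ext ?_⟩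
    change (u ^ n) ^ 2 ^ j = 1
    rw [← zpow_natCast, ← _root_.zpow_mul, mul_comm, _root_.zpow_mul, zpow_natCast, hj, _root_.one_zpow]
  have : Fact (Nat.Prime 2) := ⟨Nat.prime_two⟩
  have h := hp.card_modEq_card_fixedPoints X
  have h2 : Nat.card (MulAction.fixedPoints (Subgroup.zpowers u) X) = fixCount X u := by
    rw [fixCount]
    refine Nat.subtype_card _ fun x => ?_
    simp only [Finset.mem_filter, Finset.mem_univ, true_and, MulAction.mem_fixedPoints]
    refine ⟨fun hx m => ?_, fun h => h ⟨u, Subgroup.mem_zpowers u⟩⟩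
    obtain ⟨m, hm⟩ := m
    have : Subgroup.zpowers u ≤ MulAction.stabilizer C x := by
      rw [Subgroup.zpowers_le]
      exact hx
    exact this hm
  rw [h2, Nat.card_eq_fintype_card] at h
  rw [Nat.odd_iff] at hX ⊢
  rw [← h, hX]

variable [Fintype C]

theorem sum_fixCount_mul (P : Subgroup C) (hP : IsPGroup 2 P) (ψ : C → ℂ)
    (hψ : ∀ g u, ψ (g * u * g⁻¹) = ψ u) [Fintype P] [Fintype (C ⧸ P)] :
    ∑ u ∈ Finset.univ.filter (IsTwoElt (C := C)), (fixCount (C ⧸ P) u : ℂ) * ψ u =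
      Fintype.card (C ⧸ P) * ∑ u : P, ψ u := by
  have h1 : ∀ u, (fixCount (C ⧸ P) u : ℂ) * ψ u =
      ∑ x : C ⧸ P, if u • x = x then ψ u else 0 := fun u => by
    rw [fixCount, Finset.card_filter, Nat.cast_sum, Finset.sum_mul]
    refine Finset.sum_congr rfl fun x _ => ?_
    split_ifs <;> simp
  simp only [h1]
  rw [Finset.sum_comm, ← nsmul_eq_mul, ← Finset.card_univ (α := C ⧸ P), ← Finset.sum_const]
  refine Finset.sum_congr rfl fun x _ => ?_
  induction x using QuotientGroup.induction_on with
  | H g =>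
  rw [Finset.sum_filter]
  have hmem : ∀ v : C, (g * v * g⁻¹) • (g : C ⧸ P) = g ↔ v ∈ P := fun v => by
    rw [MulAction.Quotient.smul_coe, smul_eq_mul, inv_mul_cancel_right, eq_comm, QuotientGroup.eq,
      inv_mul_cancel_left]
  calc _ = ∑ v : C, if v ∈ P then ψ v else 0 := by
        refine (Fintype.sum_equiv (MulAut.conj g).toEquiv _ _ fun v => ?_).symm
        simp only [MulEquiv.toEquiv_eq_coe, MulEquiv.coe_toEquiv, MulAut.conj_apply, isTwoElt_conj,
          hmem, hψ]
        by_cases hv : v ∈ P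
        · have : IsTwoElt v := by
            obtain ⟨j, hj⟩ := hP ⟨v, hv⟩
            exact ⟨j, congrArg Subtype.val hj⟩
          simp [hv, this]
        · simp [hv]
    _ = _ := by
        rw [← Finset.sum_filter]
        refine Finset.sum_subtype _ (fun v => ?_) _
        simp

end FixCount

theorem fixCount_mulAut {C : Type} [Group C] (P : Subgroup C) [Fintype (C ⧸ P)] (ι : MulAut C)
    (hι : ∀ x, ι (ι x) = x) (hP : ∀ x ∈ P, ι x ∈ P) (u : C) :
    fixCount (C ⧸ P) (ι u) = fixCount (C ⧸ P) u := by
  have hP' : ∀ x, ι x ∈ P ↔ x ∈ P := fun x => ⟨fun h => by have := hP _ h; rwa [hι] at this, hP x⟩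
  let e : C ⧸ P ≃ C ⧸ P := Quotient.congr ι.toEquiv fun a b => by
    change QuotientGroup.leftRel P a b ↔ QuotientGroup.leftRel P (ι a) (ι b)
    rw [QuotientGroup.leftRel_apply, QuotientGroup.leftRel_apply, ← map_inv, ← map_mul, hP']
  have he : ∀ (v : C) x, e (v • x) = ι v • e x := fun v x => by
    induction x using QuotientGroup.induction_on with
    | H g =>
    change ((ι (v * g) : C) : C ⧸ P) = ((ι v * ι g : C) : C ⧸ P)
    rw [map_mul]
  refine (Finset.card_equiv e fun x => ?_).symm
  simp only [Finset.mem_filter, Finset.mem_univ, true_and]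
  rw [← he, e.injective.eq_iff]

section TwoElements

variable {C V U : Type} [Group C] [Fintype C] [AddCommGroup V] [Module ℂ V] [FiniteDimensional ℂ V]
  [AddCommGroup U] [Module ℂ U] [FiniteDimensional ℂ U]

open scoped TensorProduct in
theorem isIntegral_average_mul_character_inv (P : Subgroup C) (X : Type) [MulAction P X] [Fintype X]
    (σ : Representation ℂ C V) {z : C} (hz : ∀ u, z * u = u * z)
    (ξ : Representation ℂ P U) (Z : U →ₗ[ℂ] U) {d : ℕ} (hd : 0 < d)
    (hZ : Z ^ d = 1) (hc : ∀ u, Z * ξ u = ξ u * Z) (k : ℕ) :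
    IsIntegral ℤ ((Fintype.card P : ℂ)⁻¹ * ∑ u : P, (fixCount X u : ℂ) ^ k *
      (LinearMap.trace ℂ U (Z * ξ u) * σ.character (z * u)⁻¹)) := by
  have h := isIntegral_average_fixCount X (ξ.tprod (σ.dual.comp P.subtype))
    (TensorProduct.map Z (σ.dual z)) (d := d * Fintype.card C)
    (Nat.mul_pos hd Fintype.card_pos) ?_ ?_ k
  · convert h using 5 with u
    change _ = LinearMap.trace ℂ (U ⊗[ℂ] Module.Dual ℂ V)
      (TensorProduct.map Z (σ.dual z) ∘ₗ TensorProduct.map (ξ u) (σ.dual u))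
    rw [← TensorProduct.map_comp, LinearMap.trace_tensorProduct']
    congr 1
    change _ = LinearMap.trace ℂ _ (σ.dual z * σ.dual u)
    rw [← map_mul]
    change _ = LinearMap.trace ℂ _ (Module.Dual.transpose (R := ℂ) (σ (z * u)⁻¹))
    rw [LinearMap.trace_transpose']
    rfl
  · rw [TensorProduct.map_pow, pow_mul, hZ, one_pow, mul_comm d, pow_mul, ← map_pow,
      pow_card_eq_one, map_one, one_pow, TensorProduct.map_one]
  · intro u
    change TensorProduct.map Z (σ.dual z) ∘ₗ TensorProduct.map (ξ u) (σ.dual u) =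
      TensorProduct.map (ξ u) (σ.dual u) ∘ₗ TensorProduct.map Z (σ.dual z)
    rw [← TensorProduct.map_comp, ← TensorProduct.map_comp]
    congr 1
    · exact hc u
    · change σ.dual z * σ.dual u = σ.dual u * σ.dual z
      rw [← map_mul, hz, map_mul]

theorem exists_isIntegral_sum_normSq_twoElt (σ : Representation ℂ C V) {z : C}
    (hz : ∀ u, z * u = u * z) (P : Subgroup C) (hP : IsPGroup 2 P) (hodd : Odd P.index)
    (ι : MulAut C) (hι : ∀ x, ι (ι x) = x) (hιP : ∀ x ∈ P, ι x ∈ P)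
    (ξ : Representation ℂ P U) (Z : U →ₗ[ℂ] U) {d : ℕ} (hd : 0 < d)
    (hZ : Z ^ d = 1) (hc : ∀ u, Z * ξ u = ξ u * Z)
    (hχ : ∀ u : P, σ.character (z * u) = LinearMap.trace ℂ U (Z * ξ u) +
      LinearMap.trace ℂ U (Z * ξ ⟨ι (u : C)⁻¹, hιP _ (P.inv_mem u.2)⟩)) :
    ∃ a : ℂ, IsIntegral ℤ a ∧
      ((∑ u ∈ Finset.univ.filter (IsTwoElt (C := C)), Complex.normSq (σ.character (z * u)) : ℝ) : ℂ) =
        2 * Nat.card P * a := by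
  have : Fact (Nat.Prime 2) := ⟨Nat.prime_two⟩
  set φ : C → ℂ := fun u => σ.character (z * u) * σ.character (z * u)⁻¹ with hφ
  set m : C → ℕ := fun u => fixCount (C ⧸ P) u with hm
  have hφconj : ∀ g u, φ (g * u * g⁻¹) = φ u := fun g u => by
    have h1 : z * (g * u * g⁻¹) = g * (z * u) * g⁻¹ := by
      rw [← mul_assoc, ← mul_assoc, hz g]
      simp only [mul_assoc]
    simp only [hφ, h1]
    congr 1
    · exact character_eq_of_isConj σ (isConj_iff.2 ⟨g⁻¹, by group⟩)
    · exact character_eq_of_isConj σ (isConj_iff.2 ⟨g⁻¹, by group⟩)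
  obtain ⟨r, hr⟩ := IsPGroup.iff_card.1 hP
  have hmodd : ∀ u, IsTwoElt u → Odd (m u) := fun u hu =>
    hu.odd_fixCount (by rwa [← Nat.card_eq_fintype_card])
  obtain ⟨k, hk⟩ : ∃ k, Nat.totient (2 * Nat.card P) = k + 1 :=
    ⟨_, (Nat.succ_pred_eq_of_pos (Nat.totient_pos.2 (Nat.mul_pos two_pos Nat.card_pos))).symm⟩
  have hc' : ∀ u, IsTwoElt u → ∃ c : ℕ, (m u) ^ (k + 1) = 1 + 2 * Nat.card P * c := fun u hu => by
    have hcop : Nat.Coprime (m u) (2 * Nat.card P) := by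
      rw [hr, ← pow_succ']
      exact Nat.Coprime.pow_right _ (Nat.coprime_two_right.2 (hmodd u hu))
    have h1 := Nat.ModEq.pow_totient hcop
    rw [hk] at h1
    have h2 : 1 ≤ m u ^ (k + 1) := Nat.one_le_pow _ _ (hmodd u hu).pos
    obtain ⟨c, hc⟩ := (Nat.modEq_iff_dvd' h2).1 h1.symm
    exact ⟨c, by omega⟩
  choose! c hc'' using hc'
  set a := (Fintype.card P : ℂ)⁻¹ * ∑ u : P, (fixCount (C ⧸ P) u : ℂ) ^ k *
      (LinearMap.trace ℂ U (Z * ξ u) * σ.character (z * u)⁻¹) with ha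
  have hai : IsIntegral ℤ a := isIntegral_average_mul_character_inv P (C ⧸ P) σ hz ξ Z hd hZ hc k
  have hcard : (Fintype.card P : ℂ) ≠ 0 := by simp
  have hmP : ∀ u : P, fixCount (C ⧸ P) u = m u := fun u => rfl
  let e : P ≃ P :=
    { toFun := fun u => ⟨ι (u : C)⁻¹, hιP _ (P.inv_mem u.2)⟩
      invFun := fun u => ⟨ι (u : C)⁻¹, hιP _ (P.inv_mem u.2)⟩
      left_inv := fun u => Subtype.ext (by simp [hι])
      right_inv := fun u => Subtype.ext (by simp [hι]) }
  have hee : ∀ u, e (e u) = u := e.left_inv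
  have hχe : ∀ u : P, σ.character (z * u) = LinearMap.trace ℂ U (Z * ξ u) +
      LinearMap.trace ℂ U (Z * ξ (e u)) := hχ
  have hme : ∀ u : P, m (e u) = m u := fun u => by
    change fixCount (C ⧸ P) (ι (u : C)⁻¹) = fixCount (C ⧸ P) (u : C)
    rw [fixCount_mulAut P ι hι hιP, fixCount_inv]
  have hse : ∀ u : P, σ.character (z * e u)⁻¹ = σ.character (z * u)⁻¹ := fun u => by
    rw [character_inv_eq_star, character_inv_eq_star, hχe, hχe, hee, add_comm]
  have hsumP : ∑ u : P, (m u : ℂ) ^ k * φ u = 2 * Fintype.card P * a := by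
    have h2 : ∑ u : P, (m u : ℂ) ^ k * (LinearMap.trace ℂ U (Z * ξ (e u)) * σ.character (z * u)⁻¹) =
        ∑ u : P, (m u : ℂ) ^ k * (LinearMap.trace ℂ U (Z * ξ u) * σ.character (z * u)⁻¹) :=
      Fintype.sum_equiv e _ _ fun u => by rw [hme, hse]
    calc ∑ u : P, (m u : ℂ) ^ k * φ u = ∑ u : P, ((m u : ℂ) ^ k *
          (LinearMap.trace ℂ U (Z * ξ u) * σ.character (z * u)⁻¹) +
          (m u : ℂ) ^ k * (LinearMap.trace ℂ U (Z * ξ (e u)) * σ.character (z * u)⁻¹)) := by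
          refine Finset.sum_congr rfl fun u _ => ?_
          simp only [hφ]
          rw [hχe u]
          ring
      _ = 2 * Fintype.card P * a := by
          rw [Finset.sum_add_distrib, h2, ha, mul_assoc, mul_inv_cancel_left₀ hcard, two_mul]
          rfl
  have hψ := sum_fixCount_mul P hP (fun u => (m u : ℂ) ^ k * φ u) fun g u => by
    simp only [hφconj, hm, fixCount_conj]
  rw [hsumP] at hψ
  refine ⟨Fintype.card (C ⧸ P) * a - ∑ u ∈ Finset.univ.filter (IsTwoElt (C := C)), c u * φ u,
    ?_, ?_⟩
  · refine IsIntegral.sub (IsIntegral.mul (isIntegral_natCast _) hai) (IsIntegral.sum _ fun u _ => ?_)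
    exact IsIntegral.mul (isIntegral_natCast _)
      ((isIntegral_character σ _).mul (isIntegral_character σ _))
  · have hS : ∑ u ∈ Finset.univ.filter (IsTwoElt (C := C)), (fixCount (C ⧸ P) u : ℂ) *
        ((m u : ℂ) ^ k * φ u) = ∑ u ∈ Finset.univ.filter (IsTwoElt (C := C)), φ u +
        2 * Nat.card P * ∑ u ∈ Finset.univ.filter (IsTwoElt (C := C)), c u * φ u := by
      rw [Finset.mul_sum, ← Finset.sum_add_distrib]
      refine Finset.sum_congr rfl fun u hu => ?_
      have h := hc'' u (Finset.mem_filter.1 hu).2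
      have h' : (m u : ℂ) ^ (k + 1) = 1 + 2 * Nat.card P * c u := by exact_mod_cast h
      change (m u : ℂ) * _ = _
      rw [← mul_assoc, ← pow_succ', h']
      ring
    rw [hS] at hψ
    have hL : ((∑ u ∈ Finset.univ.filter (IsTwoElt (C := C)),
        Complex.normSq (σ.character (z * u)) : ℝ) : ℂ) =
        ∑ u ∈ Finset.univ.filter (IsTwoElt (C := C)), φ u := by
      rw [Complex.ofReal_sum]
      exact Finset.sum_congr rfl fun u _ => (character_mul_character_inv σ _).symm
    rw [hL, Nat.card_eq_fintype_card] 
    rw [Nat.card_eq_fintype_card] at hψ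
    linear_combination hψ

end TwoElements

section OddPart

variable {N V : Type} [Group N] [Fintype N] [AddCommGroup V] [Module ℂ V] [FiniteDimensional ℂ V]

/-- The restriction of an involutive automorphism to an invariant subgroup. -/
def restrictAut (ι : MulAut N) (hι : ∀ x, ι (ι x) = x) (M : Subgroup N) (hM : ∀ x ∈ M, ι x ∈ M) :
    MulAut M where
  toFun x := ⟨ι x, hM x x.2⟩
  invFun x := ⟨ι x, hM x x.2⟩
  left_inv x := Subtype.ext (hι x)
  right_inv x := Subtype.ext (hι x)
  map_mul' x y := Subtype.ext (map_mul ι (x : N) y)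

@[simp] theorem coe_restrictAut {N : Type} [Group N] (ι : MulAut N) (hι : ∀ x, ι (ι x) = x) (M : Subgroup N)
    (hM : ∀ x ∈ M, ι x ∈ M) (x : M) : (restrictAut ι hι M hM x : N) = ι x := rfl

theorem exists_isIntegral_sum_normSq_centralizer (σ : Representation ℂ N V) (z : N) (ι : MulAut N)
    (hι : ∀ x, ι (ι x) = x) (hz : ι z = z⁻¹) (P M : Subgroup N) (hιP : ∀ x ∈ P, ι x ∈ P)
    (hιM : ∀ x ∈ M, ι x ∈ M) (hP : IsPGroup 2 P) (hPz : P ≤ Subgroup.centralizer {z})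
    (hodd : Odd (P.relIndex (Subgroup.centralizer {z}))) (hzM : z ∈ M) (hPM : P ≤ M)
    (hN : NoAlt (restrictAut ι hι M hιM)) {B : V →ₗ[ℂ] V →ₗ[ℂ] ℂ} (hB : B.IsAlt)
    (hT : IsTwisted ι σ B) (hnd : ∀ v, (∀ w, B v w = 0) → v = 0) :
    ∃ a : ℂ, IsIntegral ℤ a ∧
      ((∑ u ∈ Finset.univ.filter (IsTwoElt (C := Subgroup.centralizer {z})),
        Complex.normSq (σ.character (z * u)) : ℝ) : ℂ) = 2 * Nat.card P * a := by
  set C := Subgroup.centralizer {z} with hC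
  have hzC : z ∈ C := Subgroup.mem_centralizer_singleton_iff.2 rfl
  have hιC : ∀ x ∈ C, ι x ∈ C := fun x hx => by
    rw [hC, Subgroup.mem_centralizer_singleton_iff] at hx ⊢
    have h := congrArg ι hx
    rw [map_mul, map_mul, hz] at h
    have h' : Commute (ι x) z⁻¹ := h
    exact Commute.inv_right_iff.1 h'
  have hz' : ∀ u : C, (⟨z, hzC⟩ : C) * u = u * ⟨z, hzC⟩ := fun u =>
    Subtype.ext (Subgroup.mem_centralizer_singleton_iff.1 u.2).symm
  obtain ⟨L, hL, hχ⟩ := exists_half_character (ι := restrictAut ι hι M hιM)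
    (fun x => Subtype.ext (hι x)) hN (σ.comp M.subtype) hB
    (fun x v w => hT x v w) hnd
  let j : P.subgroupOf C →* M :=
    { toFun := fun u => ⟨u, hPM u.2⟩
      map_one' := rfl
      map_mul' := fun _ _ => rfl }
  obtain ⟨a, ha, hs⟩ := exists_isIntegral_sum_normSq_twoElt (C := C) (σ.comp C.subtype) hz'
    (P.subgroupOf C) (hP.comap_of_injective C.subtype C.subtype_injective) hodd
    (restrictAut ι hι C hιC) (fun x => Subtype.ext (hι x)) (fun x hx => hιP x hx)
    ((subrep _ L hL).comp j) (subrep _ L hL ⟨z, hzM⟩) (d := Fintype.card M) Fintype.card_pos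
    (by rw [← map_pow, pow_card_eq_one, map_one])
    (fun u => by
      change subrep _ L hL _ * subrep _ L hL (j u) = subrep _ L hL (j u) * subrep _ L hL _
      rw [← map_mul, ← map_mul]
      congr 1
      exact Subtype.ext (congrArg (fun x : C => (x : N)) (hz' u)))
    (fun u => by
      change σ.character (z * u) = LinearMap.trace ℂ L (subrep _ L hL _ * subrep _ L hL (j u)) +
        LinearMap.trace ℂ L (subrep _ L hL _ * subrep _ L hL ⟨ι (u : N)⁻¹, _⟩)
      rw [← map_mul, ← map_mul]
      have h := hχ (⟨z, hzM⟩ * j u)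
      refine h.trans ?_
      congr 1
      refine congrArg (fun x => LinearMap.trace ℂ L (subrep _ L hL x)) (Subtype.ext ?_)
      change ι (z * (u : N))⁻¹ = z * ι (u : N)⁻¹
      have hu := congrArg Subtype.val (hz' u)
      change z * (u : N) = u * z at hu
      rw [hu, _root_.mul_inv_rev, map_mul, map_inv, hz, inv_inv])
  refine ⟨a, ha, hs.trans ?_⟩
  rw [Nat.card_congr (Subgroup.subgroupOfEquivOfLe hPz).toEquiv]

theorem sum_fiber_eq_sum_isTwoElt {α m e : ℕ} (hα : Fintype.card N = 2 ^ α * m) (h0 : e ≡ 0 [MOD 2 ^ α])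
    (h1 : e ≡ 1 [MOD m]) (hm : Odd m) {z : N} (hz : z ^ m = 1) (f : N → ℝ) :
    ∑ x ∈ Finset.univ.filter (fun x : N => x ^ e = z), f x =
      ∑ u ∈ Finset.univ.filter (IsTwoElt (C := Subgroup.centralizer {z})), f (z * u) := by
  symm
  have hcard : ∀ x : N, x ^ (2 ^ α * m) = 1 := fun x => by rw [← hα, pow_card_eq_one]
  have hze : z ^ e = z := by
    rw [pow_eq_pow_of_modEq h1 hz, pow_one]
  refine Finset.sum_bij (fun u _ => z * u) ?_ ?_ ?_ fun _ _ => rfl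
  · intro u hu
    have hcomm : Commute z (u : N) := (Subgroup.mem_centralizer_singleton_iff.1 u.2).symm
    obtain ⟨j, hj⟩ := (Finset.mem_filter.1 hu).2
    have hj' : (u : N) ^ 2 ^ j = 1 := congrArg Subtype.val hj
    have hue : (u : N) ^ 2 ^ α = 1 := by
      rw [← orderOf_dvd_iff_pow_eq_one]
      have h2 : orderOf (u : N) ∣ 2 ^ α * m := orderOf_dvd_of_pow_eq_one (hcard u)
      have h3 : orderOf (u : N) ∣ 2 ^ j := orderOf_dvd_of_pow_eq_one hj'
      exact (((Nat.coprime_two_left.2 hm).pow_left j).coprime_dvd_left h3).dvd_of_dvd_mul_right h2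
    simp only [Finset.mem_filter, Finset.mem_univ, true_and]
    rw [hcomm.mul_pow, hze, pow_eq_pow_of_modEq h0 hue, pow_zero, mul_one]
  · intro u _ v _ h
    exact Subtype.ext (mul_left_cancel h)
  · intro x hx
    have hx : x ^ e = z := (Finset.mem_filter.1 hx).2
    have hc : Commute x z := hx ▸ (Commute.refl x).pow_right e
    refine ⟨⟨z⁻¹ * x, ?_⟩, ?_, ?_⟩
    · rw [Subgroup.mem_centralizer_singleton_iff]
      rw [hc.symm.inv_left.eq, inv_mul_cancel_right, hc.symm.inv_left.eq.symm, mul_inv_cancel_left]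
    · simp only [Finset.mem_filter, Finset.mem_univ, true_and]
      refine ⟨α, Subtype.ext ?_⟩
      change (z⁻¹ * x) ^ 2 ^ α = 1
      rw [hc.symm.inv_left.mul_pow, inv_pow, inv_mul_eq_one, ← hx, ← pow_mul]
      refine pow_eq_pow_of_modEq ?_ (hcard x)
      rw [mul_comm e]
      simpa using h1.mul_left' (2 ^ α)
    · exact mul_inv_cancel_left z x

theorem false_of_isTwisted {σ : Representation ℂ N V} (hσ : σ.IsIrreducible)
    (h : ∀ z : N, Odd (orderOf z) → ∃ P : Subgroup N, IsPGroup 2 P ∧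
      P ≤ Subgroup.centralizer {z} ∧ Odd (P.relIndex (Subgroup.centralizer {z})) ∧
      ∃ a : ℂ, IsIntegral ℤ a ∧
      ((∑ u ∈ Finset.univ.filter (IsTwoElt (C := Subgroup.centralizer {z})),
        Complex.normSq (σ.character (z * u)) : ℝ) : ℂ) = 2 * Nat.card P * a) : False := by
  obtain ⟨α, m, hm, hα⟩ := Nat.exists_eq_two_pow_mul_odd (n := Fintype.card N) Fintype.card_ne_zero
  have hcop : Nat.Coprime (2 ^ α) m := (Nat.coprime_two_left.2 hm).pow_left α
  obtain ⟨e, he0, he1⟩ := Nat.chineseRemainder hcop 0 1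
  set f : N → ℝ := fun x => Complex.normSq (σ.character x) with hf
  set T : N → ℝ := fun z => ∑ x ∈ Finset.univ.filter (fun x : N => x ^ e = z), f x with hT
  have hfc : ∀ g x, f (g * x * g⁻¹) = f x := fun g x => by
    simp only [hf]
    rw [character_eq_of_isConj σ (x := g * x * g⁻¹) (y := x) (isConj_iff.2 ⟨g⁻¹, by group⟩)]
  have hTc : ∀ g z, T (g * z * g⁻¹) = T z := fun g z => by
    refine (Finset.sum_equiv (MulAut.conj g).toEquiv (fun x => ?_) fun x _ => ?_).symm
    · simp [conj_pow]
    · exact (hfc g x).symm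
  have hsum : ∑ z, T z = Fintype.card N := by
    rw [← sum_normSq_of_isIrreducible hσ]
    exact Finset.sum_fiberwise _ _ _
  have hcl : ∀ c : ConjClasses N, ∃ b : ℂ, IsIntegral ℤ b ∧
      ((∑ z ∈ Finset.univ.filter (fun z : N => ConjClasses.mk z = c), T z : ℝ) : ℂ) =
        2 ^ (α + 1) * b := fun c => by
    obtain ⟨z, rfl⟩ := ConjClasses.exists_rep c
    have hconst : ∀ y ∈ Finset.univ.filter (fun y : N => ConjClasses.mk y = ConjClasses.mk z),
        T y = T z := fun y hy => by
      have hy := (Finset.mem_filter.1 hy).2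
      rw [ConjClasses.mk_eq_mk_iff_isConj, isConj_comm] at hy
      obtain ⟨g, rfl⟩ := isConj_iff.1 hy
      exact hTc g z
    rw [Finset.sum_congr rfl hconst, Finset.sum_const]
    by_cases hz : z ^ m = 1
    · have hzodd : Odd (orderOf z) := hm.of_dvd_nat (orderOf_dvd_of_pow_eq_one hz)
      obtain ⟨P, hP, hPz, hodd, a, ha, hs⟩ := h z hzodd
      have hTz : (T z : ℂ) = 2 * Nat.card P * a := by
        rw [← hs, ← sum_fiber_eq_sum_isTwoElt hα he0 he1 hm hz f]
      have hdvd : 2 ^ α ∣ (Finset.univ.filter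
          (fun y : N => ConjClasses.mk y = ConjClasses.mk z)).card * Nat.card P := by
        have h1 : (Finset.univ.filter (fun y : N => ConjClasses.mk y = ConjClasses.mk z)).card *
            Nat.card (Subgroup.centralizer {z}) = Fintype.card N := by
          rw [Subgroup.nat_card_centralizer_nat_card_stabilizer, ← Nat.card_eq_fintype_card,
            mul_comm]
          refine Eq.trans ?_ (Subgroup.card_mul_index (MulAction.stabilizer (ConjAct N) z))
          rw [MulAction.index_stabilizer, ConjAct.orbit_eq_carrier_conjClasses,
            ← Set.ncard_coe_finset]
          congr 2
          ext y
          simp [ConjClasses.mem_carrier_iff_mk_eq]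
        have h2 := Subgroup.card_mul_index (P.subgroupOf (Subgroup.centralizer {z}))
        rw [Nat.card_congr (Subgroup.subgroupOfEquivOfLe hPz).toEquiv] at h2
        rw [← h2, ← mul_assoc, hα] at h1
        exact ((Nat.coprime_two_left.2 hodd).pow_left α).dvd_of_dvd_mul_right ⟨m, h1⟩
      obtain ⟨r, hr⟩ := hdvd
      refine ⟨r * a, (isIntegral_natCast _).mul ha, ?_⟩
      rw [nsmul_eq_mul, Complex.ofReal_mul, hTz, Complex.ofReal_natCast]
      have hr' : ((Finset.univ.filter (fun y : N => ConjClasses.mk y = ConjClasses.mk z)).card : ℂ) *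
        Nat.card P = 2 ^ α * r := by exact_mod_cast hr
      linear_combination 2 * a * hr'
    · refine ⟨0, isIntegral_zero, ?_⟩
      have : T z = 0 := by
        refine Finset.sum_eq_zero fun x hx => absurd ?_ hz
        rw [← (Finset.mem_filter.1 hx).2, ← pow_mul]
        have hem : e * m ≡ 0 [MOD 2 ^ α * m] := by simpa using he0.mul_right' m
        rw [pow_eq_pow_of_modEq hem (hα ▸ pow_card_eq_one), pow_zero]
      simp [this]
  choose b hb hTb using hcl
  have hfin : (Fintype.card N : ℂ) = 2 ^ (α + 1) * ∑ c, b c := by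
    rw [Finset.mul_sum, Finset.sum_congr rfl fun c _ => (hTb c).symm, ← Complex.ofReal_sum,
      Finset.sum_fiberwise, hsum, Complex.ofReal_natCast]
  have hmb : algebraMap ℚ ℂ (m / 2) = ∑ c, b c := by
    rw [hα] at hfin
    push_cast at hfin
    have h2 : (2 : ℂ) ^ α ≠ 0 := pow_ne_zero _ two_ne_zero
    rw [pow_succ, mul_assoc] at hfin
    have := mul_left_cancel₀ h2 hfin
    simp only [map_div₀, map_natCast, map_ofNat]
    rw [this]
    ring
  have hint : IsIntegral ℤ (algebraMap ℚ ℂ (m / 2)) := hmb ▸ IsIntegral.sum _ fun c _ => hb c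
  rw [isIntegral_algebraMap_iff (algebraMap ℚ ℂ).injective, IsIntegrallyClosed.isIntegral_iff] at hint
  obtain ⟨y, hy⟩ := hint
  have hy' : (2 * y : ℚ) = m := by
    rw [eq_intCast] at hy
    rw [hy]
    ring
  have hy'' : 2 * y = m := by exact_mod_cast hy'
  obtain ⟨r, hr⟩ := hm
  omega

end OddPart

section TwoGroups

variable {Q : Type} [Group Q]

theorem exists_sq_mem_of_lt [Finite Q] (hQ : IsPGroup 2 Q) {A D : Subgroup Q} [A.Normal] [D.Normal]
    (h : A < D) : ∃ x ∈ D, x ∉ A ∧ x ^ 2 ∈ A ∧ ∀ g, x⁻¹ * (g * x * g⁻¹) ∈ A := by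
  have : Fact (Nat.Prime 2) := ⟨Nat.prime_two⟩
  obtain ⟨d, hd, hdA⟩ := SetLike.exists_of_lt h
  set E : Subgroup (Q ⧸ A) := D.map (QuotientGroup.mk' A) with hE
  have hEn : E.Normal := Subgroup.Normal.map ‹_› _ (QuotientGroup.mk'_surjective A)
  have hQA : IsPGroup 2 (ConjAct (Q ⧸ A)) := (hQ.to_quotient A).of_equiv ConjAct.toConjAct
  have hE2 : IsPGroup 2 E := (hQ.to_quotient A).to_subgroup E
  have hnt : Nontrivial E := ⟨⟨⟨d, Subgroup.mem_map_of_mem _ hd⟩, 1, fun h => hdA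
    ((QuotientGroup.eq_one_iff d).1 (congrArg Subtype.val h))⟩⟩
  obtain ⟨n, hn0, hn⟩ := hE2.nontrivial_iff_card.mp hnt
  obtain ⟨y, hy, hy1⟩ := hQA.exists_fixed_point_of_prime_dvd_card_of_fixed_point E
    (hn.symm ▸ dvd_pow_self _ hn0.ne') (a := 1) fun g => smul_one g
  obtain ⟨j, hj⟩ : ∃ j, y ^ 2 ^ j ≠ 1 ∧ (y ^ 2 ^ j) ^ 2 = 1 := by
    have hex : ∃ j, y ^ 2 ^ j = 1 := hE2 y
    have h0 : Nat.find hex ≠ 0 := fun h0 => by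
      have := Nat.find_spec hex
      rw [h0, pow_zero, pow_one] at this
      exact hy1 this.symm
    obtain ⟨j, hj⟩ := Nat.exists_eq_succ_of_ne_zero h0
    refine ⟨j, Nat.find_min hex (by omega), ?_⟩
    rw [← pow_mul, ← pow_succ, ← Nat.succ_eq_add_one, ← hj]
    exact Nat.find_spec hex
  have hyc : ∀ g : Q ⧸ A, g * (y : Q ⧸ A) * g⁻¹ = y := fun g =>
    congrArg Subtype.val (hy (ConjAct.toConjAct g))
  obtain ⟨x, hx, hxy⟩ := Subgroup.mem_map.1 (y ^ 2 ^ j).2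
  have hxy' : (x : Q ⧸ A) = (y : Q ⧸ A) ^ 2 ^ j := hxy
  refine ⟨x, hx, fun hxA => hj.1 (Subtype.ext ?_), ?_, fun g => ?_⟩
  · change (y : Q ⧸ A) ^ 2 ^ j = 1
    rw [← hxy', (QuotientGroup.eq_one_iff x).2 hxA]
  · rw [← QuotientGroup.eq_one_iff, QuotientGroup.mk_pow, hxy']
    exact congrArg Subtype.val hj.2
  · rw [← QuotientGroup.eq_one_iff]
    change (x : Q ⧸ A)⁻¹ * ((g : Q ⧸ A) * x * (g : Q ⧸ A)⁻¹) = 1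
    rw [hxy', ← conj_pow, hyc, inv_mul_cancel]

theorem mem_zpowers_zpow_of_odd {a : Q} (ha : IsTwoElt a) {i : ℤ} (hi : Odd i) :
    a ∈ Subgroup.zpowers (a ^ i) := by
  obtain ⟨j, hj⟩ := ha
  have hc : IsCoprime i ((2 : ℤ) ^ j) := IsCoprime.pow_right (Int.isCoprime_two_right.2 hi)
  obtain ⟨u, v, huv⟩ := hc
  refine ⟨u, ?_⟩
  change (a ^ i) ^ u = a
  have h2 : a ^ ((2 : ℤ) ^ j) = 1 := by
    rw [← hj, ← zpow_natCast]
    push_cast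
    rfl
  conv_rhs => rw [← _root_.zpow_one a, ← huv, _root_.zpow_add, mul_comm v, _root_.zpow_mul a (2 ^ j),
    h2, _root_.one_zpow, mul_one, mul_comm, _root_.zpow_mul]

theorem eq_one_or_eq_of_sq_eq_one {a e y : Q} (ha : IsTwoElt a) (he : e ∈ Subgroup.zpowers a)
    (he2 : e ^ 2 = 1) (he1 : e ≠ 1) (hy : y ∈ Subgroup.zpowers a) (hy2 : y ^ 2 = 1) :
    y = 1 ∨ y = e := by
  obtain ⟨j, hj⟩ := ha
  obtain ⟨n, -, hn⟩ := (Nat.dvd_prime_pow Nat.prime_two).1 (orderOf_dvd_of_pow_eq_one hj)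
  rcases n with _ | n
  · rw [pow_zero, orderOf_eq_one_iff] at hn
    rw [hn, Subgroup.zpowers_one_eq_bot, Subgroup.mem_bot] at he
    exact absurd he he1
  have hw2 : (a ^ 2 ^ n) ^ 2 = 1 := by rw [← pow_mul, ← pow_succ, ← hn, pow_orderOf_eq_one]
  have key : ∀ x ∈ Subgroup.zpowers a, x ^ 2 = 1 → x = 1 ∨ x = a ^ 2 ^ n := by
    rintro _ ⟨m, rfl⟩ hm
    change (a ^ m) ^ 2 = 1 at hm
    change a ^ m = 1 ∨ a ^ m = _
    rw [← zpow_natCast, ← _root_.zpow_mul, ← orderOf_dvd_iff_zpow_eq_one, hn, pow_succ] at hm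
    push_cast at hm
    obtain ⟨c, rfl⟩ := Int.dvd_of_mul_dvd_mul_right two_ne_zero hm
    have h1 : a ^ ((2 : ℤ) ^ n * c) = (a ^ 2 ^ n) ^ c := by
      rw [_root_.zpow_mul, ← zpow_natCast]
      push_cast
      rfl
    rw [h1]
    rcases Int.even_or_odd' c with ⟨r, rfl | rfl⟩
    · left
      rw [_root_.zpow_mul, zpow_ofNat, hw2, _root_.one_zpow]
    · right
      rw [_root_.zpow_add, _root_.zpow_mul, zpow_ofNat, hw2, _root_.one_zpow, one_mul, _root_.zpow_one]
  rcases key e he he2 with h | h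
  · exact absurd h he1
  · rw [h]
    exact key y hy hy2

theorem zpowers_normal {a : Q} (h : ∀ g, g * a * g⁻¹ ∈ Subgroup.zpowers a) :
    (Subgroup.zpowers a).Normal := by
  refine ⟨?_⟩
  rintro _ ⟨m, rfl⟩ g
  change g * a ^ m * g⁻¹ ∈ _
  rw [← conj_zpow]
  exact Subgroup.zpow_mem _ (h g) m

theorem exists_zpowers_normal [Finite Q] (hQ : IsPGroup 2 Q) (P : Subgroup Q) [P.Normal] {e : Q}
    (heP : e ∈ P) (he2 : e ^ 2 = 1) (he1 : e ≠ 1) (hec : ∀ g, g * e = e * g)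
    (h : ∀ t ∈ P, t ^ 2 = 1 → t ≠ 1 → t ≠ e → ∃ g, g * t * g⁻¹ ≠ t ∧ g * t * g⁻¹ ≠ t * e) :
    ∃ a ∈ P, (∀ g, g * a * g⁻¹ ∈ Subgroup.zpowers a) ∧ (Subgroup.zpowers a).relIndex P ≤ 2 := by
  set S : Set Q := {a | a ∈ P ∧ (∀ g, g * a * g⁻¹ ∈ Subgroup.zpowers a) ∧ e ∈ Subgroup.zpowers a}
    with hS
  obtain ⟨a, ⟨haP, haN, hea⟩, hmax⟩ := (Set.toFinite S).exists_maximalFor orderOf S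
    ⟨e, heP, fun g => by rw [hec, mul_inv_cancel_right]; exact Subgroup.mem_zpowers e,
      Subgroup.mem_zpowers e⟩
  refine ⟨a, haP, haN, ?_⟩
  have hA := zpowers_normal haN
  set A := Subgroup.zpowers a with hAdef
  have hAP : A ≤ P := by rwa [hAdef, Subgroup.zpowers_le]
  have haA : a ∈ A := Subgroup.mem_zpowers a
  have hA2 : ∀ y : Q, IsTwoElt y := fun y => hQ y
  have hAc : ∀ y ∈ A, ∀ z ∈ A, y * z = z * y := by
    rintro _ ⟨i, rfl⟩ _ ⟨j, rfl⟩
    exact ((Commute.refl a).zpow_zpow i j).eq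
  have hAe : ∀ y ∈ A, y ^ 2 = 1 → y = 1 ∨ y = e := fun y hy hy2 =>
    eq_one_or_eq_of_sq_eq_one (hA2 a) hea he2 he1 hy hy2
  have hno : ∀ t ∈ P, t ∉ A → t ^ 2 = 1 → (∀ g, t⁻¹ * (g * t * g⁻¹) ∈ A) →
      (∀ y ∈ A, (t * y) ^ 2 = 1 → y ^ 2 = 1) → False := fun t htP htA ht2 htg hty => by
    obtain ⟨g, hg1, hg2⟩ := h t htP ht2 (fun h => htA (h ▸ A.one_mem)) (fun h => htA (h ▸ hea))
    have hgt : g * t * g⁻¹ = t * (t⁻¹ * (g * t * g⁻¹)) := (mul_inv_cancel_left _ _).symm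
    have hy2 := hty _ (htg g) (by rw [← hgt, conj_pow, ht2, mul_one, mul_inv_cancel])
    rcases hAe _ (htg g) hy2 with h1 | h1
    · exact hg1 (by rw [hgt, h1, mul_one])
    · exact hg2 (by rw [hgt, h1])
  have hshift : ∀ x, (∀ g, x⁻¹ * (g * x * g⁻¹) ∈ A) → ∀ d ∈ A, ∀ g,
      (x * d)⁻¹ * (g * (x * d) * g⁻¹) ∈ A := fun x hx d hd g => by
    have h1 : (x * d)⁻¹ * (g * (x * d) * g⁻¹) =
      d⁻¹ * (x⁻¹ * (g * x * g⁻¹)) * (g * d * g⁻¹) := by group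
    rw [h1]
    exact A.mul_mem (A.mul_mem (A.inv_mem hd) (hx g)) (hA.conj_mem d hd g)
  -- the centralizer of `a` in `P`
  have hcent : ∀ x ∈ P, x * a = a * x → x ∈ A := by
    by_contra! hcon
    obtain ⟨x₀, hx₀P, hx₀a, hx₀A⟩ := hcon
    have hD : (P ⊓ Subgroup.centralizer (A : Set Q)).Normal := inferInstance
    have hcA : ∀ x, x ∈ Subgroup.centralizer (A : Set Q) ↔ x * a = a * x := fun x => by
      rw [hAdef, Subgroup.zpowers_eq_closure, Subgroup.centralizer_closure,
        Subgroup.mem_centralizer_singleton_iff]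
    have hlt : A < P ⊓ Subgroup.centralizer (A : Set Q) := by
      refine lt_of_le_of_ne (le_inf hAP ?_) fun heq => hx₀A ?_
      · intro y hy
        rw [hcA]
        exact hAc y hy a haA
      · rw [heq]
        exact ⟨hx₀P, (hcA x₀).2 hx₀a⟩
    obtain ⟨x, ⟨hxP, hxa⟩, hxA, hx2, hxg⟩ := exists_sq_mem_of_lt hQ hlt
    have hxa : ∀ y ∈ A, Commute x y := fun y hy =>
      ((Subgroup.mem_centralizer_iff.1 hxa) y hy).symm
    obtain ⟨i, hi⟩ := hx2
    change a ^ i = x ^ 2 at hi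
    rcases Int.even_or_odd' i with ⟨c, rfl | rfl⟩
    · have hd : a ^ (-c) ∈ A := Subgroup.zpow_mem _ haA _
      refine hno (x * a ^ (-c)) (P.mul_mem hxP (hAP hd)) (fun hm => hxA ?_) ?_
        (hshift x hxg _ hd) fun y hy hty => ?_
      · exact (A.mul_mem_cancel_right hd).1 hm
      · rw [(hxa _ hd).mul_pow, ← hi, ← zpow_natCast, ← _root_.zpow_mul, ← _root_.zpow_add]
        simp [mul_comm]
      · have hc : Commute (x * a ^ (-c)) y := (hxa y hy).mul_left (hAc _ hd y hy)
        have ht2 : (x * a ^ (-c)) ^ 2 = 1 := by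
          rw [(hxa _ hd).mul_pow, ← hi, ← zpow_natCast, ← _root_.zpow_mul, ← _root_.zpow_add]
          simp [mul_comm]
        rwa [hc.mul_pow, ht2, one_mul] at hty
    · have hax : a ∈ Subgroup.zpowers x := by
        have := mem_zpowers_zpow_of_odd (hA2 a) (i := 2 * c + 1) ⟨c, rfl⟩
        rw [hi] at this
        exact Subgroup.zpowers_le.2 (Subgroup.pow_mem _ (Subgroup.mem_zpowers x) 2) this
      have hAx : A ≤ Subgroup.zpowers x := by rwa [hAdef, Subgroup.zpowers_le]
      have hxS : x ∈ S := ⟨hxP, fun g => by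
        have h1 := Subgroup.mul_mem _ (Subgroup.mem_zpowers x) (hAx (hxg g))
        rwa [mul_inv_cancel_left] at h1, hAx hea⟩
      have hle : orderOf x ≤ orderOf a := by
        by_contra! hlt
        exact absurd (hmax hxS hlt.le) (by simpa using hlt)
      have : A = Subgroup.zpowers x := Subgroup.eq_of_le_of_card_ge hAx (by
        rw [hAdef, Nat.card_zpowers, Nat.card_zpowers]
        exact hle)
      exact hxA (this ▸ Subgroup.mem_zpowers x)
  have he2' : ∀ {m : ℤ}, Even m → e ^ m = 1 := fun {m} hm => by
    obtain ⟨r, rfl⟩ := hm.two_dvd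
    rw [_root_.zpow_mul, zpow_ofNat, he2, _root_.one_zpow]
  have heo : ∀ {m : ℤ}, Odd m → e ^ m = e := fun {m} hm => by
    obtain ⟨r, rfl⟩ := hm
    rw [_root_.zpow_add, he2' ⟨r, by ring⟩, one_mul, _root_.zpow_one]
  obtain ⟨l, hl⟩ := hea
  change a ^ l = e at hl
  rcases Int.even_or_odd' l with ⟨l, rfl | rfl⟩
  swap
  · have h1 := mem_zpowers_zpow_of_odd (hA2 a) (i := 2 * l + 1) ⟨l, rfl⟩
    rw [hl] at h1
    obtain ⟨m, hm⟩ := h1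
    change e ^ m = a at hm
    have hPA : P ≤ A := fun x hx => hcent x hx (by
      rw [← hm]
      exact (Commute.zpow_right (hec x) m).eq)
    exact (Subgroup.relIndex_eq_one.2 hPA).trans_le one_le_two
  set b := a ^ l with hb
  have hbA : b ∈ A := Subgroup.zpow_mem _ haA _
  have hb2 : b ^ 2 = e := by rw [hb, ← zpow_natCast, ← _root_.zpow_mul, mul_comm]; exact hl
  have hbg : ∀ g, g * b * g⁻¹ = b ∨ g * b * g⁻¹ = b * e := fun g => by
    have hgA := hA.conj_mem b hbA g
    have h1 : (b⁻¹ * (g * b * g⁻¹)) ^ 2 = 1 := by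
      rw [Commute.mul_pow (hAc _ (A.inv_mem hbA) _ hgA), inv_pow, conj_pow, hb2, hec,
        mul_inv_cancel_right, inv_mul_cancel]
    rcases hAe _ (A.mul_mem (A.inv_mem hbA) hgA) h1 with h2 | h2
    · left
      exact (inv_mul_eq_one.1 h2).symm
    · right
      exact inv_mul_eq_iff_eq_mul.1 h2
  by_cases hP0 : ∀ x ∈ P, x * b = b * x → x ∈ A
  · by_cases hPA : P ≤ A
    · exact (Subgroup.relIndex_eq_one.2 hPA).trans_le one_le_two
    · obtain ⟨x, hxP, hxA⟩ := SetLike.not_le_iff_exists.1 hPA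
      refine (Subgroup.relIndex_eq_two_iff_exists_notMem_and.2
        ⟨x, hxP, hxA, fun c hc => or_iff_not_imp_right.2 fun hcA => ?_⟩).le
      have hnb : ∀ y ∈ P, y ∉ A → y * b * y⁻¹ = b * e := fun y hy hyA =>
        (hbg y).resolve_left fun h => hyA (hP0 y hy (mul_inv_eq_iff_eq_mul.1 h))
      refine hP0 _ (P.mul_mem hc hxP) ?_
      rw [← mul_inv_eq_iff_eq_mul]
      calc c * x * b * (c * x)⁻¹ = c * (x * b * x⁻¹) * c⁻¹ := by group
        _ = (c * b * c⁻¹) * (c * e * c⁻¹) := by rw [hnb x hxP hxA]; group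
        _ = b := by rw [hec c, mul_inv_cancel_right, hnb c hc hcA, mul_assoc, ← pow_two, he2, mul_one]
  exfalso
  push Not at hP0
  obtain ⟨x₀, hx₀P, hx₀b, hx₀A⟩ := hP0
  have hbN : (Subgroup.zpowers b).Normal := zpowers_normal fun g => by
    rcases hbg g with h1 | h1
    · rw [h1]
      exact Subgroup.mem_zpowers b
    · rw [h1, ← hb2]
      exact Subgroup.mul_mem _ (Subgroup.mem_zpowers b)
        (Subgroup.pow_mem _ (Subgroup.mem_zpowers b) 2)
  have hcb : ∀ x, x ∈ Subgroup.centralizer (Subgroup.zpowers b : Set Q) ↔ x * b = b * x :=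
    fun x => by
      rw [Subgroup.zpowers_eq_closure, Subgroup.centralizer_closure,
        Subgroup.mem_centralizer_singleton_iff]
  have hlt : A < P ⊓ Subgroup.centralizer (Subgroup.zpowers b : Set Q) := by
    refine lt_of_le_of_ne (le_inf hAP fun y hy => ?_) fun heq => hx₀A ?_
    · rw [hcb]
      exact hAc y hy b hbA
    · rw [heq]
      exact ⟨hx₀P, (hcb x₀).2 hx₀b⟩
  obtain ⟨x, ⟨hxP, hxb⟩, hxA, hx2, hxg⟩ := exists_sq_mem_of_lt hQ hlt
  replace hxb := (hcb x).1 hxb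
  have hxa : x * a ≠ a * x := fun h => hxA (hcent x hxP h)
  have hxae : x * a * x⁻¹ = a * e := by
    obtain ⟨j, hj⟩ := haN x
    change a ^ j = x * a * x⁻¹ at hj
    have hconj : ∀ m : ℤ, x * a ^ m * x⁻¹ = a ^ (j * m) := fun m => by
      rw [← conj_zpow, ← hj, _root_.zpow_mul]
    have h4 : orderOf b = 2 ^ (1 + 1) := orderOf_eq_prime_pow (by rwa [pow_one, hb2])
      (by rw [pow_succ, pow_one, pow_mul, hb2, he2])
    have hbj : b ^ (j - 1) = 1 := by
      have h1 : b ^ j = b := by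
        rw [hb, ← _root_.zpow_mul, mul_comm, ← hconj, ← hb, hxb, mul_inv_cancel_right]
      rw [_root_.zpow_sub_one, h1, mul_inv_cancel]
    rw [← orderOf_dvd_iff_zpow_eq_one, h4] at hbj
    obtain ⟨s, hs⟩ := hbj
    norm_num at hs
    have h8 : ((a ^ (4 * s)) ^ 2) ^ (2 * s + 1) = 1 := by
      have h1 : a ^ (j * j) = a := by
        obtain ⟨i, hi⟩ := hx2
        change a ^ i = x ^ 2 at hi
        calc a ^ (j * j) = x * (x * a * x⁻¹) * x⁻¹ := by rw [← hj, hconj]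
          _ = x ^ 2 * a * (x ^ 2)⁻¹ := by
            rw [pow_two, _root_.mul_inv_rev]
            simp only [mul_assoc]
          _ = a := by
            rw [← hi, hAc _ (Subgroup.zpow_mem _ haA i) a haA, mul_inv_cancel_right]
      have h2 : a ^ (j * j - 1) = 1 := by rw [_root_.zpow_sub_one, h1, mul_inv_cancel]
      rw [← zpow_natCast, ← _root_.zpow_mul, ← _root_.zpow_mul, ← h2]
      congr 1
      rw [show j = 4 * s + 1 by omega]
      push_cast
      ring
    have h9 : (a ^ (4 * s)) ^ 2 = 1 := by
      have h1 := mem_zpowers_zpow_of_odd (hA2 ((a ^ (4 * s)) ^ 2)) (i := 2 * s + 1) ⟨s, rfl⟩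
      rwa [h8, Subgroup.zpowers_one_eq_bot, Subgroup.mem_bot] at h1
    have hj' : x * a * x⁻¹ = a * a ^ (4 * s) := by
      rw [← hj, ← _root_.zpow_one_add]
      congr 1
      omega
    rcases hAe _ (Subgroup.zpow_mem _ haA _) h9 with h10 | h10
    · rw [h10, mul_one, mul_inv_eq_iff_eq_mul] at hj'
      exact absurd hj' hxa
    · rw [hj', h10]
  have hconj : ∀ m : ℤ, x * a ^ m * x⁻¹ = a ^ m * e ^ m := fun m => by
    rw [← conj_zpow, hxae, Commute.mul_zpow (hec a)]
  obtain ⟨l, rfl⟩ : Even l := by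
    by_contra hodd
    have h1 := mem_zpowers_zpow_of_odd (hA2 a) (Int.not_even_iff_odd.1 hodd)
    rw [← hb] at h1
    obtain ⟨m, hm⟩ := h1
    change b ^ m = a at hm
    refine hxa ?_
    rw [← hm]
    exact (Commute.zpow_right hxb m).eq
  obtain ⟨i, hi⟩ := hx2
  change a ^ i = x ^ 2 at hi
  obtain ⟨c, rfl⟩ : Even i := by
    by_contra hodd
    have h1 := hconj i
    rw [heo (Int.not_even_iff_odd.1 hodd), hi, pow_two, ← mul_assoc, mul_inv_cancel_right] at h1
    exact he1 (mul_eq_left.1 h1.symm)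
  have hsq : ∀ d : ℤ, (x * a ^ d) ^ 2 = a ^ (2 * (c + d)) * e ^ d := fun d => by
    calc (x * a ^ d) ^ 2 = (x * a ^ d * x⁻¹) * (x ^ 2 * a ^ d) := by rw [pow_two, pow_two]; group
      _ = a ^ d * (a ^ (c + c) * a ^ d) * e ^ d := by
        rw [hconj, ← hi, mul_assoc, mul_assoc]
        congr 1
        exact ((Commute.zpow_left (hec _).symm d).eq)
      _ = _ := by
        rw [← _root_.zpow_add, ← _root_.zpow_add]
        congr 2
        ring
  obtain ⟨d, hd⟩ : ∃ d : ℤ, a ^ (2 * (c + d)) * e ^ d = 1 := by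
    rcases Int.even_or_odd c with hc | hc
    · refine ⟨-c, ?_⟩
      rw [add_neg_cancel, mul_zero, _root_.zpow_zero, one_mul, he2' hc.neg]
    · refine ⟨-c + (l + l), ?_⟩
      rw [add_neg_cancel_left, hl, heo (hc.neg.add_even ⟨l, rfl⟩), ← pow_two, he2]
  have hdA : a ^ d ∈ A := Subgroup.zpow_mem _ haA _
  refine hno (x * a ^ d) (P.mul_mem hxP (hAP hdA)) (fun hm => hxA ((A.mul_mem_cancel_right hdA).1 hm))
    ((hsq d).trans hd) (hshift x hxg _ hdA) ?_
  rintro _ ⟨m, rfl⟩ hty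
  change (x * a ^ d * a ^ m) ^ 2 = 1 at hty
  change (a ^ m) ^ 2 = 1
  have hy : (a ^ m) ^ 2 * e ^ m = 1 := by
    rw [mul_assoc, ← _root_.zpow_add, hsq] at hty
    rw [← hty, ← zpow_natCast, ← _root_.zpow_mul, ← one_mul (a ^ (m * (2 : ℕ)) * e ^ m), ← hd,
      mul_add, mul_add, mul_add, _root_.zpow_add, _root_.zpow_add, _root_.zpow_add, _root_.zpow_add]
    have hc1 : Commute (e ^ d) (a ^ (2 * m)) :=
      Commute.zpow_zpow (hec a).symm d (2 * m)
    rw [mul_assoc _ (e ^ d), ← mul_assoc (e ^ d), mul_comm m]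
    push_cast
    rw [hc1.eq]
    simp only [mul_assoc]
  rcases Int.even_or_odd m with hm | hm
  · rwa [he2' hm, mul_one] at hy
  · exfalso
    have hy4 : (a ^ m) ^ 4 = 1 := by
      rw [heo hm] at hy
      rw [show 4 = 2 * 2 from rfl, pow_mul, eq_inv_of_mul_eq_one_left hy, inv_pow, he2, inv_one]
    obtain ⟨r, hr⟩ := mem_zpowers_zpow_of_odd (hA2 a) hm
    change (a ^ m) ^ r = a at hr
    have ha4 : a ^ 4 = 1 := by
      rw [← hr, ← zpow_natCast, ← _root_.zpow_mul, mul_comm, _root_.zpow_mul, zpow_natCast, hy4,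
        _root_.one_zpow]
    refine he1 ?_
    rw [← hl, show (2 * (l + l) : ℤ) = (4 : ℕ) * l by push_cast; ring, _root_.zpow_mul, zpow_natCast,
      ha4, _root_.one_zpow]

end TwoGroups

section Conj

/-- Conjugation by `h` on the subgroup `M` admits no alternating invariant forms. -/
def NoAltConj {Γ : Type} [Group Γ] (M : Subgroup Γ) (h : Γ) : Prop :=
  ∀ ι : MulAut M, (∀ x : M, (ι x : Γ) = h * x * h⁻¹) → NoAlt ι

/-- The elements `g` such that `g * z * g⁻¹ = z ^ s g`. -/
def extCentralizer {Γ : Type} [Group Γ] (s : Γ →* ℤˣ) (z : Γ) : Subgroup Γ where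
  carrier := {g | g * z * g⁻¹ = z ^ ((s g : ℤˣ) : ℤ)}
  one_mem' := by simp
  mul_mem' {a b} ha hb := by
    simp only [Set.mem_ofPred_eq] at ha hb ⊢
    calc a * b * z * (a * b)⁻¹ = a * (b * z * b⁻¹) * a⁻¹ := by group
      _ = (a * z * a⁻¹) ^ ((s b : ℤˣ) : ℤ) := by rw [hb, conj_zpow]
      _ = _ := by rw [ha, map_mul, Units.val_mul, _root_.zpow_mul]
  inv_mem' {a} ha := by
    simp only [Set.mem_ofPred_eq] at ha ⊢
    have h2 : ((s a : ℤˣ) : ℤ) * ((s a : ℤˣ) : ℤ) = 1 := by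
      rw [← Units.val_mul, Int.units_mul_self, Units.val_one]
    have : (s a⁻¹ : ℤˣ) = s a := by rw [map_inv, Int.units_inv_eq_self]
    rw [this]
    have h3 : a⁻¹ * (a * z * a⁻¹) ^ ((s a : ℤˣ) : ℤ) * a⁻¹⁻¹ = z ^ ((s a : ℤˣ) : ℤ) := by
      rw [conj_zpow]; group
    rw [← h3, ha, ← _root_.zpow_mul, h2, _root_.zpow_one]

theorem mem_extCentralizer {Γ : Type} [Group Γ] {s : Γ →* ℤˣ} {z g : Γ} :
    g ∈ extCentralizer s z ↔ g * z * g⁻¹ = z ^ ((s g : ℤˣ) : ℤ) := Iff.rfl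

/-- The elements that fix `t` by conjugation up to the central involution `e`. -/
def quasiCentralizer {Γ : Type} [Group Γ] {e : Γ} (hec : ∀ g, g * e = e * g) (he2 : e ^ 2 = 1)
    (t : Γ) : Subgroup Γ where
  carrier := {g | g * t * g⁻¹ = t ∨ g * t * g⁻¹ = t * e}
  one_mem' := by simp
  mul_mem' {a b} ha hb := by
    have hee : e * e = 1 := by rw [← sq, he2]
    have hab : a * b * t * (a * b)⁻¹ = a * (b * t * b⁻¹) * a⁻¹ := by group
    have hae : a * (t * e) * a⁻¹ = a * t * a⁻¹ * e := by
      rw [← mul_assoc, mul_assoc (a * t), ← hec a⁻¹]; group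
    simp only [Set.mem_ofPred_eq] at ha hb ⊢
    rw [hab]
    rcases hb with hb | hb <;> rw [hb]
    · exact ha
    · rw [hae]
      rcases ha with ha | ha <;> rw [ha]
      · exact Or.inr rfl
      · rw [mul_assoc, hee, mul_one]
        exact Or.inl rfl
  inv_mem' {a} ha := by
    have hee : e * e = 1 := by rw [← sq, he2]
    simp only [Set.mem_ofPred_eq] at ha ⊢
    rcases ha with ha | ha
    · left
      calc a⁻¹ * t * a⁻¹⁻¹ = a⁻¹ * (a * t * a⁻¹) * a := by rw [ha]; group
        _ = t := by group
    · right
      calc a⁻¹ * t * a⁻¹⁻¹ = a⁻¹ * (t * e) * (e * a) := by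
            rw [mul_assoc a⁻¹ (t * e), mul_assoc t e, ← mul_assoc e e, hee]; group
        _ = a⁻¹ * (a * t * a⁻¹) * (a * e) := by rw [ha, hec a]
        _ = t * e := by group

theorem exists_odd_relIndex {Γ : Type} [Group Γ] [Finite Γ] (D : Subgroup Γ) :
    ∃ Q ≤ D, IsPGroup 2 Q ∧ Odd (Q.relIndex D) := by
  have : Fact (Nat.Prime 2) := ⟨Nat.prime_two⟩
  let S : Sylow 2 D := default
  refine ⟨(S : Subgroup D).map D.subtype, Subgroup.map_subtype_le _,
    S.isPGroup'.map D.subtype, ?_⟩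
  rw [Subgroup.relIndex, Subgroup.subgroupOf,
    Subgroup.comap_map_eq_self_of_injective D.subtype_injective, ← Nat.not_even_iff_odd,
    even_iff_two_dvd]
  exact S.not_dvd_index

theorem exists_conj_mem {Γ : Type} [Group Γ] [Finite Γ] {Q D : Subgroup Γ}
    (hodd : Odd (Q.relIndex D)) {k : Γ} (hkD : k ∈ D) (hk2 : k ^ 2 = 1) :
    ∃ g ∈ D, g * k * g⁻¹ ∈ Q := by
  have hfin : Fintype (D ⧸ Q.subgroupOf D) := Fintype.ofFinite _
  have hu : IsTwoElt (⟨k, hkD⟩ : D) := ⟨1, Subtype.ext (by simpa using hk2)⟩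
  have h := hu.odd_fixCount (X := D ⧸ Q.subgroupOf D)
    (by rwa [← Nat.card_eq_fintype_card])
  obtain ⟨x, hx⟩ := Finset.card_pos.1 h.pos
  induction x using QuotientGroup.induction_on with
  | H g =>
    have hx' : (⟨k, hkD⟩ : D) • (g : D ⧸ Q.subgroupOf D) = g := by
      simpa [fixCount] using hx
    have : (((⟨k, hkD⟩ : D) * g : D) : D ⧸ Q.subgroupOf D) = g := hx'
    have h3 := QuotientGroup.eq.1 this.symm
    refine ⟨(g : Γ)⁻¹, D.inv_mem g.2, ?_⟩
    have h4 : ((g⁻¹ * (⟨k, hkD⟩ * g) : D) : Γ) ∈ Q := h3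
    simpa [mul_assoc] using h4

theorem card_mul_relIndex {Γ : Type} [Group Γ] {H K : Subgroup Γ} (h : H ≤ K) :
    Nat.card H * H.relIndex K = Nat.card K := by
  rw [← Subgroup.relIndex_bot_left H, ← Subgroup.relIndex_bot_left K,
    Subgroup.relIndex_mul_relIndex _ _ _ bot_le h]

theorem card_eq_two_mul {Γ : Type} [Group Γ] [Finite Γ] (s : Γ →* ℤˣ) (X : Subgroup Γ) {h : Γ}
    (hX : h ∈ X) (hs : s h = -1) : Nat.card X = 2 * Nat.card (X.subgroupOf s.ker) := by
  have hsurj : Function.Surjective (s.comp X.subtype) := fun u => by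
    rcases Int.units_eq_one_or u with rfl | rfl
    · exact ⟨1, map_one _⟩
    · exact ⟨⟨h, hX⟩, hs⟩
  have h1 := (s.comp X.subtype).ker.card_mul_index
  rw [Subgroup.index_ker, MonoidHom.range_eq_top.2 hsurj, Subgroup.card_top,
    Nat.card_eq_fintype_card (α := ℤˣ), Fintype.card_units_int] at h1
  rw [← h1, mul_comm]
  congr 1
  exact Nat.card_congr
    ⟨fun x => ⟨⟨x, x.2⟩, x.1.2⟩, fun x => ⟨⟨x, x.2⟩, x.1.2⟩, fun _ => rfl, fun _ => rfl⟩

theorem exists_isIntegral_sum_normSq_of_noAltConj {Γ : Type} [Group Γ] [Finite Γ] {s : Γ →* ℤˣ}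
    {V : Type} [AddCommGroup V] [Module ℂ V] [FiniteDimensional ℂ V]
    {σ : Representation ℂ s.ker V} (hσ : σ.IsIrreducible) {B : V →ₗ[ℂ] V →ₗ[ℂ] ℂ} (hB : B.IsAlt)
    (h0 : B ≠ 0) {τ h : Γ} (hτ : s τ = -1) (hτ2 : τ ^ 2 = 1) (hh : s h = -1) (hh2 : h ^ 2 = 1)
    (hT : IsTwisted (MulAut.conjNormal τ) σ B) (z : s.ker) {P : Subgroup Γ} (hP : IsPGroup 2 P)
    (hPz : P ≤ extCentralizer s (z : Γ)) (hodd : Odd (P.relIndex (extCentralizer s (z : Γ))))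
    (hhP : h ∈ P) {M : Subgroup Γ} (hMs : M ≤ s.ker) (hM : ∀ x ∈ M, h * x * h⁻¹ ∈ M)
    (hzM : (z : Γ) ∈ M) (hPM : P ⊓ s.ker ≤ M) (hN : NoAltConj M h) :
    ∃ P : Subgroup s.ker, IsPGroup 2 P ∧
      P ≤ Subgroup.centralizer {z} ∧ Odd (P.relIndex (Subgroup.centralizer {z})) ∧
      ∃ a : ℂ, IsIntegral ℤ a ∧
      ((∑ u ∈ Finset.univ.filter (IsTwoElt (C := Subgroup.centralizer {z})),
        Complex.normSq (σ.character (z * u)) : ℝ) : ℂ) = 2 * Nat.card P * a := by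
  have hhinv : h⁻¹ = h := by rw [inv_eq_iff_mul_eq_one, ← sq, hh2]
  have hι : ∀ x : s.ker, MulAut.conjNormal h (MulAut.conjNormal h x) = x := fun x => by
    rw [← MulAut.mul_apply, ← map_mul, ← sq, hh2, map_one, MulAut.one_apply]
  have hm : τ * h ∈ s.ker := by rw [MonoidHom.mem_ker, map_mul, hτ, hh]; rfl
  have hτinv : τ⁻¹ = τ := by rw [inv_eq_iff_mul_eq_one, ← sq, hτ2]
  obtain ⟨hB', hT'⟩ := IsTwisted.compl₂_of_mul (ι := MulAut.conjNormal h)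
    (ι' := MulAut.conjNormal τ) (m := ⟨τ * h, hm⟩)
    (Subtype.ext (by
      have e1 : h * h = 1 := by rw [← sq, hh2]
      have e2 : τ * τ = 1 := by rw [← sq, hτ2]
      simp only [Subgroup.coe_mul, MulAut.conjNormal_apply, hhinv, Subgroup.coe_one]
      calc τ * h * (h * (τ * h) * h) = τ * (h * h) * τ * (h * h) := by group
        _ = 1 := by rw [e1, mul_one, mul_one, e2]))
    (fun x => Subtype.ext (by
      have e1 : h * h = 1 := by rw [← sq, hh2]
      simp only [Subgroup.coe_mul, Subgroup.coe_inv, MulAut.conjNormal_apply, _root_.mul_inv_rev, hhinv]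
      calc τ * x * τ⁻¹ = τ * 1 * x * 1 * τ⁻¹ := by group
        _ = _ := by rw [← e1]; simp only [mul_assoc])) hB hT
  have hB0 : B.compl₂ (σ ⟨τ * h, hm⟩) ≠ 0 := fun hc => h0 (by
    ext v w
    have := LinearMap.congr_fun₂ hc v (σ ⟨τ * h, hm⟩⁻¹ w)
    rwa [LinearMap.compl₂_apply, Representation.self_inv_apply] at this)
  have hker := ker_eq_bot_of_ne_zero hσ hι hT' hB0
  have hhC := hPz hhP
  have hz : MulAut.conjNormal h z = z⁻¹ := Subtype.ext (by
    rw [MulAut.conjNormal_apply, mem_extCentralizer.1 hhC, hh]; simp)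
  have hcent : ∀ x : s.ker, x ∈ Subgroup.centralizer {z} ↔ (x : Γ) ∈ extCentralizer s (z : Γ) :=
    fun x => by
      rw [Subgroup.mem_centralizer_singleton_iff, mem_extCentralizer, MonoidHom.mem_ker.1 x.2,
        Units.val_one, _root_.zpow_one, mul_inv_eq_iff_eq_mul, Subtype.ext_iff]
      rfl
  have hcent' : Subgroup.centralizer {z} = (extCentralizer s (z : Γ)).subgroupOf s.ker := by
    ext x; exact hcent x
  have hP' : IsPGroup 2 (P.subgroupOf s.ker) :=
    hP.comap_of_injective s.ker.subtype s.ker.subtype_injective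
  have hPz' : P.subgroupOf s.ker ≤ Subgroup.centralizer {z} := fun x hx => (hcent x).2 (hPz hx)
  have hodd' : Odd ((P.subgroupOf s.ker).relIndex (Subgroup.centralizer {z})) := by
    have e1 := card_mul_relIndex hPz'
    have e2 := card_mul_relIndex hPz
    rw [card_eq_two_mul s P hhP hh, card_eq_two_mul s _ hhC hh, ← hcent', ← e1, mul_assoc] at e2
    have e3 := Nat.eq_of_mul_eq_mul_left Nat.card_pos (Nat.eq_of_mul_eq_mul_left two_pos e2)
    rwa [← e3]
  refine ⟨P.subgroupOf s.ker, hP', hPz', hodd', ?_⟩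
  have hιM : ∀ x ∈ M.subgroupOf s.ker, MulAut.conjNormal h x ∈ M.subgroupOf s.ker :=
    fun x hx => hM x hx
  refine exists_isIntegral_sum_normSq_centralizer σ z (MulAut.conjNormal h) hι hz
    (P.subgroupOf s.ker) (M.subgroupOf s.ker)
    (fun x hx => P.mul_mem (P.mul_mem hhP hx) (P.inv_mem hhP))
    hιM hP' hPz' hodd' hzM (fun x hx => hPM ⟨hx, x.2⟩) ?_ hB' hT' ?_
  · refine (hN (restrictAut (MulAut.conj h) (fun x => ?_) M hM) (fun x => rfl)).of_surjective
      (Subgroup.subgroupOfEquivOfLe hMs).symm.toMonoidHom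
      (Subgroup.subgroupOfEquivOfLe hMs).symm.surjective fun x => rfl
    rw [← MulAut.mul_apply, ← map_mul, ← sq, hh2, map_one, MulAut.one_apply]
  · intro v hv
    have : v ∈ LinearMap.ker (B.compl₂ (σ ⟨τ * h, hm⟩)) := LinearMap.ext hv
    rwa [hker, Submodule.mem_bot] at this

end Conj

section Criterion

theorem conj_conj_of_sq {Γ : Type} [Group Γ] {h : Γ} (hh : h ^ 2 = 1) (x : Γ) :
    MulAut.conj h (MulAut.conj h x) = x := by
  rw [← MulAut.mul_apply, ← map_mul, ← sq, hh, map_one, MulAut.one_apply]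

/-- If `h` inverts the commuting elements `z` and `a`, then conjugation by `h` admits no alternating
invariant form on the product of `⟨z⟩` with a group in which `⟨a⟩` has index at most two. -/
theorem exists_noAltConj_zpowers {Γ : Type} [Group Γ] [Finite Γ] {P : Subgroup Γ} {z a h : Γ}
    (hzP : ∀ x ∈ P, Commute z x) (ha : a ∈ P) (hP : ∀ x ∈ P, h * x * h⁻¹ ∈ P) (hh : h ^ 2 = 1)
    (hz : h * z * h⁻¹ = z⁻¹) (hha : h * a * h⁻¹ = a⁻¹)
    (hcard : Nat.card P < 4 * Nat.card (Subgroup.zpowers a)) :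
    ∃ M : Subgroup Γ, P ≤ M ∧ z ∈ M ∧ (∀ x ∈ M, h * x * h⁻¹ ∈ M) ∧
      (∀ K : Subgroup Γ, z ∈ K → P ≤ K → M ≤ K) ∧ NoAltConj M h := by
  have hinv : ∀ b : Γ, h * b * h⁻¹ = b⁻¹ → ∀ x ∈ Subgroup.zpowers b, h * x * h⁻¹ = x⁻¹ := by
    rintro b hb _ ⟨i, rfl⟩
    simp only
    rw [← conj_zpow, hb, _root_.inv_zpow]
  have hstab : ∀ b : Γ, h * b * h⁻¹ = b⁻¹ →
      ∀ x ∈ Subgroup.zpowers b, MulAut.conj h x ∈ Subgroup.zpowers b := fun b hb x hx => by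
    rw [MulAut.conj_apply, hinv b hb x hx]
    exact Subgroup.inv_mem _ hx
  have hcyc : ∀ (b : Γ) (hb : h * b * h⁻¹ = b⁻¹),
      NoAlt (restrictAut (MulAut.conj h) (conj_conj_of_sq hh) _ (hstab b hb)) := fun b hb =>
    NoAlt.of_commute _ fun x y => Subtype.ext (by
      obtain ⟨i, hi⟩ := x.2
      obtain ⟨j, hj⟩ := y.2
      simp only at hi hj
      rw [Subgroup.coe_mul, Subgroup.coe_mul, ← hi, ← hj]
      exact ((Commute.refl b).zpow_zpow i j))
  have hconj : ∀ (b : Γ) (hb : h * b * h⁻¹ = b⁻¹) (x : Subgroup.zpowers b),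
      IsConj (restrictAut (MulAut.conj h) (conj_conj_of_sq hh) _ (hstab b hb) x) x⁻¹ :=
    fun b hb x => by
      have : restrictAut (MulAut.conj h) (conj_conj_of_sq hh) _ (hstab b hb) x = x⁻¹ :=
        Subtype.ext (hinv b hb x x.2)
      rw [this]
  have hNP : NoAlt (restrictAut (MulAut.conj h) (conj_conj_of_sq hh) P hP) :=
    (hcyc a hha).of_injective (fun x => Subtype.ext (conj_conj_of_sq hh _))
      (fun x => Subtype.ext (conj_conj_of_sq hh _)) (hconj a hha)
      (Subgroup.inclusion (Subgroup.zpowers_le.2 ha)) (Subgroup.inclusion_injective _)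
      (fun x => rfl) hcard
  have hprod := (hcyc z hz).prod hNP (fun x => Subtype.ext (conj_conj_of_sq hh _)) (hconj z hz)
  let j : Subgroup.zpowers z × P →* Γ :=
    (Subgroup.zpowers z).subtype.noncommCoprod P.subtype fun x y => by
      obtain ⟨i, hi⟩ := x.2
      simp only at hi
      change Commute (x : Γ) (y : Γ)
      rw [← hi]
      exact (hzP y y.2).zpow_left i
  have hj : ∀ x, j x = x.1 * x.2 := fun x => rfl
  have hjh : ∀ x, h * j x * h⁻¹ = j ⟨restrictAut (MulAut.conj h) (conj_conj_of_sq hh) _ (hstab z hz) x.1,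
      restrictAut (MulAut.conj h) (conj_conj_of_sq hh) P hP x.2⟩ := fun x => by
    rw [hj, hj]
    change h * (x.1 * x.2) * h⁻¹ = MulAut.conj h x.1 * MulAut.conj h x.2
    rw [← map_mul, MulAut.conj_apply]
  refine ⟨j.range, fun x hx => ⟨⟨1, ⟨x, hx⟩⟩, by simp [hj]⟩,
    ⟨⟨⟨z, Subgroup.mem_zpowers z⟩, 1⟩, by simp [hj]⟩, ?_, ?_, ?_⟩
  · rintro _ ⟨x, rfl⟩
    exact ⟨_, (hjh x).symm⟩
  · rintro K hzK hPK _ ⟨x, rfl⟩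
    exact K.mul_mem (Subgroup.zpowers_le.2 hzK x.1.2) (hPK x.2.2)
  · intro ι hι
    exact hprod.of_surjective j.rangeRestrict j.rangeRestrict_surjective fun x =>
      Subtype.ext ((hι _).trans (hjh x))

theorem mem_normalizer_zpowers {Γ : Type} [Group Γ] {a g : Γ}
    (h1 : g * a * g⁻¹ ∈ Subgroup.zpowers a) (h2 : g⁻¹ * a * g ∈ Subgroup.zpowers a) :
    g ∈ Subgroup.normalizer (Subgroup.zpowers a : Set Γ) := by
  rw [Subgroup.mem_normalizer_iff]
  refine fun x => ⟨fun hx => ?_, fun hx => ?_⟩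
  · obtain ⟨i, rfl⟩ := hx
    simp only
    rw [← conj_zpow]
    exact Subgroup.zpow_mem _ h1 i
  · obtain ⟨i, hi⟩ := hx
    simp only at hi
    have : x = (g⁻¹ * a * g⁻¹⁻¹) ^ i := by
      rw [conj_zpow, hi]; group
    rw [this, inv_inv]
    exact Subgroup.zpow_mem _ h2 i

theorem exists_pow_eq_of_coprime {Γ : Type} [Group Γ] {z a : Γ} (hc : Commute z a)
    (h : (orderOf z).Coprime (orderOf a)) : ∃ r : ℕ, (z * a) ^ r = z := by
  obtain ⟨r, h1, h2⟩ := Nat.chineseRemainder h 1 0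
  refine ⟨r, ?_⟩
  rw [hc.mul_pow, (pow_eq_pow_iff_modEq (x := z) (n := r) (m := 1)).2 h1,
    (pow_eq_pow_iff_modEq (x := a) (n := r) (m := 0)).2 h2, pow_one, pow_zero, mul_one]

theorem noAltConj_ker {Γ : Type} [Group Γ] [Finite Γ] (s : Γ →* ℤˣ) {e : Γ} (hes : s e = 1)
    (hec : ∀ g, g * e = e * g) (he2 : e ^ 2 = 1) (he1 : e ≠ 1)
    (hW : ∀ y, s y = 1 → ∃ k, s k = -1 ∧ k ^ 2 = 1 ∧ k * y * k⁻¹ = y⁻¹)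
    (hT : ∀ t, s t = 1 → t ^ 2 = 1 → t ≠ 1 → t ≠ e → ∀ h, s h = -1 → h ^ 2 = 1 →
      (h * t * h⁻¹ = t ∨ h * t * h⁻¹ = t * e) → ∀ M : Subgroup Γ,
      (∀ x, x ∈ M ↔ s x = 1 ∧ (x * t * x⁻¹ = t ∨ x * t * x⁻¹ = t * e)) → NoAltConj M h)
    {τ : Γ} (hτ : s τ = -1) (hτ2 : τ ^ 2 = 1) : NoAltConj s.ker τ := by
  intro ι hι V _ _ _ σ hσ B hB hBT
  by_contra h0
  have hιτ : ι = MulAut.conjNormal τ := MulEquiv.ext fun x => Subtype.ext (by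
    rw [hι, MulAut.conjNormal_apply])
  subst hιτ
  refine false_of_isTwisted hσ fun z hz => ?_
  obtain ⟨P, hPC, hP, hodd⟩ := exists_odd_relIndex (extCentralizer s (z : Γ))
  have hsz : s (z : Γ) = 1 := z.2
  have hinvmem : ∀ k, s k = -1 → k * (z : Γ) * k⁻¹ = (z : Γ)⁻¹ →
      k ∈ extCentralizer s (z : Γ) := fun k hk hkz => by
    rw [mem_extCentralizer, hkz, hk]; simp
  have hcomm : ∀ x ∈ P, s x = 1 → Commute (z : Γ) x := fun x hx hsx => by
    have := mem_extCentralizer.1 (hPC hx)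
    rw [hsx, Units.val_one, _root_.zpow_one, mul_inv_eq_iff_eq_mul] at this
    exact this.symm
  by_cases hcase : ∃ t ∈ P, s t = 1 ∧ t ^ 2 = 1 ∧ t ≠ 1 ∧ t ≠ e ∧
    ∀ g ∈ P, g * t * g⁻¹ = t ∨ g * t * g⁻¹ = t * e
  · obtain ⟨t, htP, hst, ht2, ht1, hte, htg⟩ := hcase
    obtain ⟨k, hk, hk2, hkz⟩ := hW z hsz
    obtain ⟨g, -, hgP⟩ := exists_conj_mem hodd (hinvmem k hk hkz) hk2
    have hh : s (g * k * g⁻¹) = -1 := by simp [hk]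
    have hh2 : (g * k * g⁻¹) ^ 2 = 1 := by rw [conj_pow, hk2, mul_one, mul_inv_cancel]
    have hQ : ∀ x ∈ P, x ∈ quasiCentralizer hec he2 t := fun x hx => htg x hx
    refine exists_isIntegral_sum_normSq_of_noAltConj hσ hB h0 hτ hτ2 hh hh2 hBT z hP hPC hodd hgP
      (M := quasiCentralizer hec he2 t ⊓ s.ker) inf_le_right
      (fun x hx => ⟨Subgroup.mul_mem _ (Subgroup.mul_mem _ (hQ _ hgP) hx.1)
        (Subgroup.inv_mem _ (hQ _ hgP)), s.normal_ker.conj_mem x hx.2 _⟩) ⟨Or.inl ?_, hsz⟩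
      (fun x hx => ⟨hQ x hx.1, hx.2⟩)
      (hT t hst ht2 ht1 hte _ hh hh2 (htg _ hgP) _ fun x => ⟨fun hx => ⟨hx.2, hx.1⟩,
        fun hx => ⟨hx.2, hx.1⟩⟩)
    rw [(hcomm t htP hst).eq, mul_inv_cancel_right]
  · push Not at hcase
    have heP : e ∈ P := by
      obtain ⟨g, -, hg⟩ := exists_conj_mem hodd (k := e) (by
        rw [mem_extCentralizer, hes, Units.val_one, _root_.zpow_one, ← hec, mul_inv_cancel_right]) he2
      rwa [hec, mul_inv_cancel_right] at hg
    obtain ⟨a, haP, hag, hidx⟩ := exists_zpowers_normal hP (s.ker.subgroupOf P) (e := ⟨e, heP⟩) hes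
      (Subtype.ext he2) (fun h => he1 (congrArg Subtype.val h)) (fun g => Subtype.ext (hec g))
      (fun t ht ht2 ht1 hte => by
        obtain ⟨g, hgP, hg⟩ := hcase t t.2 ht (congrArg Subtype.val ht2)
          (fun h => ht1 (Subtype.ext h)) (fun h => hte (Subtype.ext h))
        exact ⟨⟨g, hgP⟩, fun h => hg.1 (congrArg Subtype.val h),
          fun h => hg.2 (congrArg Subtype.val h)⟩)
    have hsa : s (a : Γ) = 1 := haP
    have hza := hcomm a a.2 hsa
    have hag' : ∀ g ∈ P, g * (a : Γ) * g⁻¹ ∈ Subgroup.zpowers (a : Γ) := fun g hg => by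
      obtain ⟨i, hi⟩ := hag ⟨g, hg⟩
      exact ⟨i, congrArg Subtype.val hi⟩
    have hcop : (orderOf (z : Γ)).Coprime (orderOf (a : Γ)) := by
      have : Fact (Nat.Prime 2) := ⟨Nat.prime_two⟩
      obtain ⟨j, hj⟩ := IsPGroup.iff_orderOf.1 hP a
      rw [Subgroup.orderOf_coe, Subgroup.orderOf_coe, hj]
      exact Nat.Coprime.pow_right _ (Nat.coprime_two_right.2 hz)
    obtain ⟨r, hr⟩ := exists_pow_eq_of_coprime hza hcop
    obtain ⟨r', hr'⟩ := exists_pow_eq_of_coprime hza.symm hcop.symm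
    rw [← hza.eq] at hr'
    obtain ⟨k, hk, hk2, hky⟩ := hW (z * a) (by rw [map_mul, hsz, hsa, mul_one])
    have hkz : k * (z : Γ) * k⁻¹ = (z : Γ)⁻¹ := by
      rw [← hr, ← conj_pow, hky, inv_pow]
    have hka : k * (a : Γ) * k⁻¹ = (a : Γ)⁻¹ := by
      rw [← hr', ← conj_pow, hky, inv_pow]
    have hkinv : k⁻¹ = k := by rw [inv_eq_iff_mul_eq_one, ← sq, hk2]
    set D := extCentralizer s (z : Γ) ⊓ Subgroup.normalizer (Subgroup.zpowers (a : Γ) : Set Γ) with hD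
    have hPD : P ≤ D := le_inf hPC fun g hg => mem_normalizer_zpowers (hag' g hg) (by
      simpa using hag' g⁻¹ (P.inv_mem hg))
    have hkD : k ∈ D := ⟨hinvmem k hk hkz, mem_normalizer_zpowers
      (hka ▸ Subgroup.inv_mem _ (Subgroup.mem_zpowers _)) (by
        have : k⁻¹ * (a : Γ) * k = (a : Γ)⁻¹ := by
          conv_lhs => rw [hkinv]
          conv_lhs => enter [2]; rw [← hkinv]
          exact hka
        rw [this]
        exact Subgroup.inv_mem _ (Subgroup.mem_zpowers _))⟩
    have hoddD : Odd (P.relIndex D) := by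
      rw [← Subgroup.relIndex_mul_relIndex P D _ hPD inf_le_left] at hodd
      exact (Nat.odd_mul.1 hodd).1
    obtain ⟨g, hgD, hgP⟩ := exists_conj_mem hoddD hkD hk2
    have hh : s (g * k * g⁻¹) = -1 := by simp [hk]
    have hh2 : (g * k * g⁻¹) ^ 2 = 1 := by rw [conj_pow, hk2, mul_one, mul_inv_cancel]
    have hhz : (g * k * g⁻¹) * (z : Γ) * (g * k * g⁻¹)⁻¹ = (z : Γ)⁻¹ := by
      rw [mem_extCentralizer.1 (hPC hgP), hh]; simp
    have hha : (g * k * g⁻¹) * (a : Γ) * (g * k * g⁻¹)⁻¹ = (a : Γ)⁻¹ := by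
      have h1 : g⁻¹ * (a : Γ) * g ∈ Subgroup.zpowers (a : Γ) := by
        have := (Subgroup.mem_normalizer_iff.1 (Subgroup.inv_mem _ hgD.2) (a : Γ)).1
          (Subgroup.mem_zpowers _)
        rwa [inv_inv] at this
      obtain ⟨i, hi⟩ := h1
      simp only at hi
      calc (g * k * g⁻¹) * (a : Γ) * (g * k * g⁻¹)⁻¹ = g * (k * (g⁻¹ * a * g) * k⁻¹) * g⁻¹ := by
            group
        _ = g * (g⁻¹ * a * g)⁻¹ * g⁻¹ := by rw [← hi, ← conj_zpow, hka, _root_.inv_zpow]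
        _ = _ := by group
    obtain ⟨M, hPM, hzM, hM, hMle, hN⟩ := exists_noAltConj_zpowers (P := P ⊓ s.ker) (z := (z : Γ))
      (a := (a : Γ)) (h := g * k * g⁻¹) (fun x hx => hcomm x hx.1 hx.2) ⟨a.2, hsa⟩
      (fun x hx => ⟨P.mul_mem (P.mul_mem hgP hx.1) (P.inv_mem hgP), s.normal_ker.conj_mem x hx.2 _⟩)
      hh2 hhz hha (by
        have h1 := card_mul_relIndex (Subgroup.zpowers_le.2 haP)
        have h2 : Nat.card (Subgroup.zpowers (a : Γ)) = Nat.card (Subgroup.zpowers a) := by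
          rw [Nat.card_zpowers, Nat.card_zpowers, Subgroup.orderOf_coe]
        have h3 : Nat.card (P ⊓ s.ker : Subgroup Γ) = Nat.card (s.ker.subgroupOf P) :=
          Nat.card_congr ⟨fun x => ⟨⟨x, x.2.1⟩, x.2.2⟩, fun x => ⟨x, x.1.2, x.2⟩,
            fun _ => rfl, fun _ => rfl⟩
        rw [h2, h3, ← h1]
        have h4 : 0 < Nat.card (Subgroup.zpowers a) := Nat.card_pos
        nlinarith)
    exact exists_isIntegral_sum_normSq_of_noAltConj hσ hB h0 hτ hτ2 hh hh2 hBT z hP hPC hodd hgP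
      (hMle _ hsz inf_le_right) hM hzM hPM hN

end Criterion

section Symplectic

variable {F V : Type} [Field F] [AddCommGroup V] [Module F V] {ω : V →ₗ[F] V →ₗ[F] F}

/-- An involution that negates the form `ω`. -/
def IsSkewInvolution (ω : V →ₗ[F] V →ₗ[F] F) (τ : V →ₗ[F] V) : Prop :=
  (∀ v w, ω (τ v) (τ w) = - ω v w) ∧ ∀ v, τ (τ v) = v

theorem isCompl_orthogonal_of_forall [FiniteDimensional F V] (hω : ω.IsAlt) {W : Submodule F V}
    (hW : ∀ v ∈ W, (∀ w ∈ W, ω v w = 0) → v = 0) :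
    IsCompl W (LinearMap.BilinForm.orthogonal ω W) := by
  refine (LinearMap.BilinForm.isCompl_orthogonal_iff_disjoint hω.isRefl).2 ?_
  rw [Submodule.disjoint_def]
  exact fun v hv hv' => hW v hv fun w hw => by rw [← hω.neg, hv' w hw, neg_zero]

theorem separatingLeft_restrict (hnd : ω.SeparatingLeft) {W W' : Submodule F V}
    (h : IsCompl W W') (hort : ∀ w ∈ W, ∀ w' ∈ W', ω w w' = 0) :
    (ω.domRestrict₁₂ W W).SeparatingLeft := fun v hv => by
  refine Subtype.ext (hnd v fun x => ?_)
  obtain ⟨a, b, rfl, -⟩ := Submodule.existsUnique_add_of_isCompl h x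
  rw [map_add, hort _ v.2 _ b.2, add_zero]
  exact hv a

/-- Glueing linear maps along an orthogonal decomposition. -/
theorem exists_linearMap_of_isCompl (hω : ω.IsAlt) {W W' : Submodule F V} (h : IsCompl W W')
    (hort : ∀ w ∈ W, ∀ w' ∈ W', ω w w' = 0) (c : F) (f : W →ₗ[F] W) (f' : W' →ₗ[F] W')
    (hf : ∀ v w : W, ω (f v) (f w) = c * ω v w) (hf' : ∀ v w : W', ω (f' v) (f' w) = c * ω v w) :
    ∃ g : V →ₗ[F] V, (∀ v w, ω (g v) (g w) = c * ω v w) ∧ (∀ w : W, g w = f w) ∧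
      ∀ w : W', g w = f' w := by
  have hort' : ∀ w ∈ W, ∀ w' ∈ W', ω w' w = 0 := fun w hw w' hw' => by
    rw [← hω.neg, hort w hw w' hw', neg_zero]
  have h1 : ∀ w : W, LinearMap.ofIsCompl h (W.subtype ∘ₗ f) (W'.subtype ∘ₗ f') w = f w := fun w => by
    simp
  have h2 : ∀ w : W', LinearMap.ofIsCompl h (W.subtype ∘ₗ f) (W'.subtype ∘ₗ f') w = f' w :=
    fun w => by simp
  refine ⟨LinearMap.ofIsCompl h (W.subtype ∘ₗ f) (W'.subtype ∘ₗ f'), fun v w => ?_, h1, h2⟩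
  obtain ⟨a, b, rfl, -⟩ := Submodule.existsUnique_add_of_isCompl h v
  obtain ⟨a', b', rfl, -⟩ := Submodule.existsUnique_add_of_isCompl h w
  simp only [map_add, h1, h2, LinearMap.add_apply, hf, hf', hort _ a.2 _ b'.2, hort' _ a'.2 _ b.2,
    hort _ (f a).2 _ (f' b').2, hort' _ (f a').2 _ (f' b).2]
  ring

theorem exists_isSkewInvolution_of_isCompl (hω : ω.IsAlt) {W W' : Submodule F V} (h : IsCompl W W')
    (hort : ∀ w ∈ W, ∀ w' ∈ W', ω w w' = 0) {τ : W →ₗ[F] W} {τ' : W' →ₗ[F] W'}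
    (hτ : IsSkewInvolution (ω.domRestrict₁₂ W W) τ)
    (hτ' : IsSkewInvolution (ω.domRestrict₁₂ W' W') τ') :
    ∃ θ : V →ₗ[F] V, IsSkewInvolution ω θ ∧ (∀ w : W, θ w = τ w) ∧ ∀ w : W', θ w = τ' w := by
  obtain ⟨θ, h1, h2, h3⟩ := exists_linearMap_of_isCompl hω h hort (-1) τ τ'
    (fun v w => by rw [neg_one_mul]; exact hτ.1 v w)
    (fun v w => by rw [neg_one_mul]; exact hτ'.1 v w)
  refine ⟨θ, ⟨fun v w => by rw [h1, neg_one_mul], fun v => ?_⟩, h2, h3⟩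
  obtain ⟨a, b, rfl, -⟩ := Submodule.existsUnique_add_of_isCompl h v
  simp only [map_add, h2, h3, hτ.2, hτ'.2]

/-- An operator whose adjoint has the same generalized kernel splits the space orthogonally. -/
theorem exists_isCompl_ker_range [FiniteDimensional F V] {s s' : Module.End F V}
    (hadj : ∀ v w, ω (s v) w = ω v (s' w)) (hss : ∀ n v, (s' ^ n) v = 0 → (s ^ n) v = 0) :
    ∃ n ≠ 0, IsCompl (LinearMap.ker (s' ^ n)) (LinearMap.range (s' ^ n)) ∧
      ∀ w ∈ LinearMap.ker (s' ^ n), ∀ w' ∈ LinearMap.range (s' ^ n), ω w w' = 0 := by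
  obtain ⟨n, hn, hn0⟩ := ((LinearMap.eventually_isCompl_ker_pow_range_pow s').and
    (Filter.eventually_ne_atTop 0)).exists
  have hadjn : ∀ m v w, ω ((s ^ m) v) w = ω v ((s' ^ m) w) := fun m => by
    induction m with
    | zero => intro v w; rfl
    | succ m ih =>
      intro v w
      rw [pow_succ, Module.End.mul_apply, ih, hadj, ← Module.End.mul_apply, ← pow_succ']
  refine ⟨n, hn0, hn, ?_⟩
  rintro w hw _ ⟨u, rfl⟩
  rw [← hadjn, hss n w hw, map_zero, LinearMap.zero_apply]

/-- A skew involution on the image of a parametrization. -/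
theorem exists_isSkewInvolution_of_surjective {A : Type} [AddCommGroup A] [Module F A]
    (hnd : ω.SeparatingLeft) (φ : A →ₗ[F] V) (hφ : Function.Surjective φ) (θ : A →ₗ[F] A)
    (hθ : ∀ a, θ (θ a) = a) (h : ∀ a b, ω (φ (θ a)) (φ (θ b)) = - ω (φ a) (φ b)) :
    ∃ τ : V →ₗ[F] V, IsSkewInvolution ω τ ∧ ∀ a, τ (φ a) = φ (θ a) := by
  obtain ⟨σ, hσ⟩ := LinearMap.exists_rightInverse_of_surjective φ (LinearMap.range_eq_top.2 hφ)
  have hker : ∀ a, φ a = 0 → φ (θ a) = 0 := fun a ha => hnd _ fun w => by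
    obtain ⟨b, rfl⟩ := hφ w
    rw [← hθ b, h, ha, map_zero, LinearMap.zero_apply, neg_zero]
  have hτ : ∀ a, (φ ∘ₗ θ ∘ₗ σ) (φ a) = φ (θ a) := fun a => by
    rw [← sub_eq_zero, LinearMap.comp_apply, LinearMap.comp_apply, ← map_sub, ← map_sub]
    apply hker
    rw [map_sub, ← LinearMap.comp_apply, hσ, LinearMap.id_apply, sub_self]
  refine ⟨φ ∘ₗ θ ∘ₗ σ, ⟨fun v w => ?_, fun v => ?_⟩, hτ⟩
  · obtain ⟨a, rfl⟩ := hφ v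
    obtain ⟨b, rfl⟩ := hφ w
    rw [hτ, hτ, h]
  · obtain ⟨a, rfl⟩ := hφ v
    rw [hτ, hτ, hθ]

end Symplectic

section SkewAdjoint

open Polynomial

variable {F V : Type} [Field F] [AddCommGroup V] [Module F V] {ω : V →ₗ[F] V →ₗ[F] F}

theorem apply_pow_of_skew {c : Module.End F V} (hc : ∀ v w, ω (c v) w = - ω v (c w)) (i : ℕ)
    (v w : V) : ω ((c ^ i) v) w = (-1) ^ i * ω v ((c ^ i) w) := by
  induction i generalizing w with
  | zero => simp
  | succ i ih =>
    rw [pow_succ', Module.End.mul_apply, hc, ih, ← Module.End.mul_apply, ← pow_succ, pow_succ',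
      pow_succ']
    ring

theorem aeval_aeval_neg_X (c : Module.End F V) (p : F[X]) :
    aeval c (aeval (-X : F[X]) p) = aeval (-c) p := by
  rw [← aeval_algHom_apply, map_neg, aeval_X]

theorem aeval_neg_X_involutive (p : F[X]) : aeval (-X : F[X]) (aeval (-X : F[X]) p) = p := by
  rw [← aeval_algHom_apply, map_neg, aeval_X, neg_neg, aeval_X_left_apply]

theorem apply_aeval_of_skew {c : Module.End F V} (hc : ∀ v w, ω (c v) w = - ω v (c w)) (p : F[X])
    (v w : V) : ω (aeval c p v) w = ω v (aeval c (aeval (-X : F[X]) p) w) := by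
  rw [aeval_aeval_neg_X]
  induction p using Polynomial.induction_on' with
  | add p q hp hq => simp only [map_add, LinearMap.add_apply, hp, hq]
  | monomial n a =>
    rw [aeval_monomial, aeval_monomial, neg_pow, Module.End.mul_apply, Module.End.mul_apply,
      Module.algebraMap_end_apply, Module.algebraMap_end_apply, map_smul, map_smul,
      LinearMap.smul_apply, apply_pow_of_skew hc, Module.End.mul_apply]
    congr 1
    rcases Nat.even_or_odd n with h | h
    · simp [h.neg_one_pow]
    · simp [h.neg_one_pow]

theorem exists_eq_expand_add (p : F[X]) : ∃ a b, p = expand F 2 a + X * expand F 2 b := by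
  induction p using Polynomial.induction_on' with
  | add p q hp hq =>
    obtain ⟨a, b, rfl⟩ := hp
    obtain ⟨a', b', rfl⟩ := hq
    exact ⟨a + a', b + b', by rw [map_add, map_add]; ring⟩
  | monomial n r =>
    obtain ⟨m, rfl | rfl⟩ := Nat.even_or_odd' n
    · exact ⟨monomial m r, 0, by rw [expand_monomial]; simp [mul_comm]⟩
    · exact ⟨0, monomial m r, by rw [expand_monomial, X_mul_monomial]; simp [mul_comm]⟩

theorem aeval_neg_X_expand (a : F[X]) : aeval (-X : F[X]) (expand F 2 a) = expand F 2 a := by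
  rw [expand_aeval, neg_sq, ← expand_aeval, aeval_X_left_apply]

/-- The cyclic subspace generated by a vector that is not isotropic for the form attached to a
socle generator is nondegenerate. -/
theorem aeval_eq_zero_of_forall_of_socle (h2 : (2 : F) ≠ 0) (hω : ω.IsAlt) {c N : Module.End F V}
    (hc : ∀ v w, ω (c v) w = - ω v (c w))
    (hN : ∀ q : F[X], aeval (c ^ 2) q = 0 ∨ ∃ r : F[X], aeval (c ^ 2) (q * r) = N) {v : V}
    (hv : ω (N (c v)) v ≠ 0) {p : F[X]} (hp : ∀ r : F[X], ω (aeval c p v) (aeval c r v) = 0) :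
    aeval c p v = 0 := by
  have hI : ∀ r, ω (aeval c (p * r) v) v = 0 := fun r => by
    rw [mul_comm, map_mul, Module.End.mul_apply, apply_aeval_of_skew hc]
    exact hp _
  have hI' : ∀ r, ω (aeval c (aeval (-X : F[X]) p * r) v) v = 0 := fun r => by
    rw [apply_aeval_of_skew hc, map_mul, aeval_neg_X_involutive, ← hω.neg, hI, neg_zero]
  obtain ⟨a, b, rfl⟩ := exists_eq_expand_add p
  have ha : ∀ r, ω (aeval c (expand F 2 a * r) v) v = 0 := fun r => by
    have e1 := hI r
    have e2 := hI' r
    simp only [map_add, map_mul, aeval_X, add_mul, aeval_neg_X_expand, LinearMap.add_apply,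
      neg_mul, map_neg, LinearMap.neg_apply] at e1 e2 ⊢
    have h3 : 2 * ω (((aeval c (expand F 2 a)) * (aeval c r)) v) v = 0 := by
      linear_combination e1 + e2
    exact (mul_eq_zero.1 h3).resolve_left h2
  have hb : ∀ r, ω (aeval c (X * expand F 2 b * r) v) v = 0 := fun r => by
    have e1 := hI r
    have e2 := ha r
    rw [add_mul, map_add, LinearMap.add_apply, map_add, LinearMap.add_apply, e2, zero_add] at e1
    exact e1
  have ha0 : aeval (c ^ 2) a = 0 := (hN a).resolve_right fun ⟨r, hr⟩ => hv (by
    have := ha (expand F 2 r * X)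
    rwa [← mul_assoc, ← map_mul, map_mul, expand_aeval, hr, aeval_X, Module.End.mul_apply] at this)
  have hb0 : aeval (c ^ 2) b = 0 := (hN b).resolve_right fun ⟨r, hr⟩ => hv (by
    have := hb (expand F 2 r)
    rwa [mul_assoc, ← map_mul, mul_comm, map_mul, expand_aeval, hr, aeval_X,
      Module.End.mul_apply] at this)
  rw [map_add, map_mul, expand_aeval, expand_aeval, ha0, hb0, mul_zero, add_zero,
    LinearMap.zero_apply]

theorem apply_aeval_neg_X_of_forall {c : Module.End F V}
    (hc : ∀ v w, ω (c v) w = - ω v (c w)) {v w : V} {k : F}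
    (h : ∀ r : F[X], ω v (aeval c (aeval (-X : F[X]) r) w) = k * ω v (aeval c r w)) (a b : F[X]) :
    ω (aeval c (aeval (-X : F[X]) a) v) (aeval c (aeval (-X : F[X]) b) w) =
      k * ω (aeval c a v) (aeval c b w) := by
  rw [apply_aeval_of_skew hc, apply_aeval_of_skew hc, ← Module.End.mul_apply,
    ← Module.End.mul_apply, ← map_mul, ← map_mul, ← map_mul (aeval c), h]

theorem apply_aeval_neg_X_self (hω : ω.IsAlt) {c : Module.End F V}
    (hc : ∀ v w, ω (c v) w = - ω v (c w)) (v : V) (r : F[X]) :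
    ω v (aeval c (aeval (-X : F[X]) r) v) = - 1 * ω v (aeval c r v) := by
  rw [← apply_aeval_of_skew hc, ← hω.neg, neg_one_mul]

theorem exists_isSkewInvolution_of_cyclic (hω : ω.IsAlt) (hnd : ω.SeparatingLeft)
    {c : Module.End F V} (hc : ∀ v w, ω (c v) w = - ω v (c w)) {v : V}
    (hv : ∀ w, ∃ p : F[X], aeval c p v = w) :
    ∃ τ : V →ₗ[F] V, IsSkewInvolution ω τ ∧ ∀ w, τ (c w) = - c (τ w) := by
  let φ : F[X] →ₗ[F] V := LinearMap.flip (aeval c : F[X] →ₐ[F] Module.End F V).toLinearMap v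
  obtain ⟨τ, hτ, h⟩ := exists_isSkewInvolution_of_surjective hnd φ hv
    (aeval (-X : F[X])).toLinearMap aeval_neg_X_involutive
    fun a b => (apply_aeval_neg_X_of_forall hc (apply_aeval_neg_X_self hω hc v) a b).trans
      (neg_one_mul _)
  refine ⟨τ, hτ, fun w => ?_⟩
  obtain ⟨p, rfl⟩ := hv w
  have e1 := h (X * p)
  have e2 := h p
  simp only [φ, LinearMap.flip_apply, AlgHom.toLinearMap_apply, map_mul, aeval_X,
    Module.End.mul_apply, map_neg, LinearMap.neg_apply] at e1 e2
  rw [e1, e2]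

end SkewAdjoint

section Indecomposable

open Polynomial

theorem exists_aeval_mul_eq {F A : Type} [Field F] [Ring A] [Algebra F A] (a : A) {f : F[X]}
    (hf : Irreducible f) (k : ℕ) (h : aeval a (f ^ (k + 1)) = 0) (q : F[X]) :
    aeval a q = 0 ∨ ∃ r, aeval a (q * r) = aeval a (f ^ k) := by
  obtain ⟨i, hi, hass⟩ := (dvd_prime_pow hf.prime (k + 1)).1
    (EuclideanDomain.gcd_dvd_right q (f ^ (k + 1)))
  rcases hi.eq_or_lt with rfl | hlt
  · left
    obtain ⟨s, hs⟩ := hass.symm.dvd.trans (EuclideanDomain.gcd_dvd_left q _)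
    rw [hs, map_mul, h, zero_mul]
  · right
    obtain ⟨s, hs⟩ := hass.dvd.trans (pow_dvd_pow f (Nat.lt_succ_iff.1 hlt))
    refine ⟨EuclideanDomain.gcdA q (f ^ (k + 1)) * s, ?_⟩
    rw [hs, EuclideanDomain.gcd_eq_gcd_ab q (f ^ (k + 1)), add_mul, map_add, mul_assoc (f ^ (k + 1)),
      map_mul _ (f ^ (k + 1)), h, zero_mul, add_zero, mul_assoc]

variable {F V : Type} [Field F] [AddCommGroup V] [Module F V] {ω : V →ₗ[F] V →ₗ[F] F}

/-- Every nondegenerate `c`-stable subspace is trivial. -/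
def IsIndecomposable (ω : V →ₗ[F] V →ₗ[F] F) (c : Module.End F V) : Prop :=
  ∀ W : Submodule F V, (∀ w ∈ W, c w ∈ W) → (∀ v ∈ W, (∀ w ∈ W, ω v w = 0) → v = 0) →
    W = ⊥ ∨ W = ⊤

theorem aeval_sq_adjoint {c : Module.End F V} (hc : ∀ v w, ω (c v) w = - ω v (c w)) (p : F[X])
    (v w : V) : ω (aeval (c ^ 2) p v) w = ω v (aeval (c ^ 2) p w) := by
  rw [← expand_aeval, apply_aeval_of_skew hc, aeval_neg_X_expand]

theorem commute_aeval_sq (c : Module.End F V) (p : F[X]) : Commute c (aeval (c ^ 2) p) := by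
  have h : aeval c (X : F[X]) = c := aeval_X c
  have hm := (Commute.all (X : F[X]) (expand F 2 p)).map (aeval c)
  rwa [h, expand_aeval] at hm

theorem isNilpotent_or_ker_eq_bot [FiniteDimensional F V] (hnd : ω.SeparatingLeft)
    {c s s' : Module.End F V} (hind : IsIndecomposable ω c)
    (hadj : ∀ v w, ω (s v) w = ω v (s' w))
    (hss : ∀ (n : ℕ) v, (s' ^ n) v = 0 → (s ^ n) v = 0) (hcs : Commute c s') :
    IsNilpotent s' ∨ LinearMap.ker s' = ⊥ := by
  obtain ⟨n, h0, hn, hort⟩ := exists_isCompl_ker_range hadj hss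
  have hst : ∀ w ∈ LinearMap.ker (s' ^ n), c w ∈ LinearMap.ker (s' ^ n) := fun w hw => by
    rw [LinearMap.mem_ker] at hw ⊢
    rw [← Module.End.mul_apply, ← (hcs.pow_right n).eq, Module.End.mul_apply, hw, map_zero]
  have hnd' : ∀ v ∈ LinearMap.ker (s' ^ n), (∀ w ∈ LinearMap.ker (s' ^ n), ω v w = 0) → v = 0 :=
    fun v hv h => hnd v fun x => by
      obtain ⟨a, b, rfl, -⟩ := Submodule.existsUnique_add_of_isCompl hn x
      rw [map_add, h _ a.2, zero_add]
      exact hort v hv b b.2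
  rcases hind _ hst hnd' with h | h
  · right
    obtain ⟨k, rfl⟩ := Nat.exists_eq_succ_of_ne_zero h0
    rw [eq_bot_iff, ← h]
    intro x hx
    rw [LinearMap.mem_ker] at hx ⊢
    rw [Nat.succ_eq_add_one, pow_succ, Module.End.mul_apply, hx, map_zero]
  · left
    exact ⟨n, LinearMap.ker_eq_top.1 h⟩

theorem exists_apply_ne_zero (h2 : (2 : F) ≠ 0) (hω : ω.IsAlt) (hnd : ω.SeparatingLeft)
    {c : Module.End F V} (hc : ∀ v w, ω (c v) w = - ω v (c w)) (p : F[X])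
    (h0 : aeval (c ^ 2) p * c ≠ 0) : ∃ v, ω (aeval (c ^ 2) p (c v)) v ≠ 0 := by
  by_contra! h
  refine h0 (LinearMap.ext fun v => hnd _ fun w => ?_)
  have e := h (v + w)
  have hcomm : ∀ v, aeval (c ^ 2) p (c v) = c (aeval (c ^ 2) p v) := fun v =>
    (LinearMap.congr_fun (commute_aeval_sq c p).eq v).symm
  have hs : ω (aeval (c ^ 2) p (c w)) v = ω (aeval (c ^ 2) p (c v)) w := by
    rw [aeval_sq_adjoint hc, hc, ← hω.neg, neg_neg, hcomm v]
  simp only [map_add, LinearMap.add_apply, h, hs, zero_add, add_zero, ← two_mul] at e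
  exact (mul_eq_zero.1 e).resolve_left h2

theorem exists_isSkewInvolution_of_ne_zero (h2 : (2 : F) ≠ 0) (hω : ω.IsAlt)
    (hnd : ω.SeparatingLeft) {c : Module.End F V} (hc : ∀ v w, ω (c v) w = - ω v (c w))
    (hind : IsIndecomposable ω c) {f : F[X]} (hf : Irreducible f) (k : ℕ)
    (h : aeval (c ^ 2) (f ^ (k + 1)) = 0) (h0 : aeval (c ^ 2) (f ^ k) * c ≠ 0) :
    ∃ τ : V →ₗ[F] V, IsSkewInvolution ω τ ∧ ∀ w, τ (c w) = - c (τ w) := by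
  obtain ⟨v, hv⟩ := exists_apply_ne_zero h2 hω hnd hc _ h0
  let φ : F[X] →ₗ[F] V := LinearMap.flip (aeval c : F[X] →ₐ[F] Module.End F V).toLinearMap v
  rcases hind (LinearMap.range φ) (by
    rintro _ ⟨p, rfl⟩
    refine ⟨X * p, ?_⟩
    simp [φ]) (by
    rintro _ ⟨p, rfl⟩ hp
    exact aeval_eq_zero_of_forall_of_socle h2 hω hc (exists_aeval_mul_eq _ hf k h) hv
      fun r => hp _ ⟨r, rfl⟩) with hW | hW
  · refine absurd ?_ hv
    have : v ∈ LinearMap.range φ := ⟨1, by simp [φ]⟩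
    rw [hW, Submodule.mem_bot] at this
    rw [this, map_zero]
  · exact exists_isSkewInvolution_of_cyclic hω hnd hc fun w => LinearMap.range_eq_top.1 hW w

end Indecomposable

section OddNilpotent

open Polynomial

variable {F V : Type} [Field F] [AddCommGroup V] [Module F V] {ω : V →ₗ[F] V →ₗ[F] F}

/-- A dual partner of the Jordan chain generated by `v`. -/
theorem exists_dual_chain (hnd : ω.SeparatingLeft) {c : Module.End F V}
    (hc : ∀ v w, ω (c v) w = - ω v (c w)) {m : ℕ} (hm : c ^ (2 * m + 1) = 0) {v : V}
    (hv : (c ^ (2 * m)) v ≠ 0) :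
    ∃ w, ∀ i, ω ((c ^ i) v) w = if i = 2 * m then 1 else 0 := by
  have hbig : ∀ i, 2 * m < i → ∀ x, (c ^ i) x = 0 := fun i hi x => by
    rw [pow_eq_zero_of_le hi hm, LinearMap.zero_apply]
  have key : ∀ j ≤ 2 * m, ∃ w, ω ((c ^ (2 * m)) v) w = 1 ∧
      ∀ i, 2 * m ≤ i + j → i < 2 * m → ω ((c ^ i) v) w = 0 := fun j => by
    induction j with
    | zero =>
      intro _
      obtain ⟨w, hw⟩ : ∃ w, ω ((c ^ (2 * m)) v) w ≠ 0 := by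
        by_contra! h
        exact hv (hnd _ h)
      refine ⟨(ω ((c ^ (2 * m)) v) w)⁻¹ • w, ?_, fun i h1 h2 => by omega⟩
      rw [map_smul, smul_eq_mul, inv_mul_cancel₀ hw]
    | succ j ih =>
      intro hj
      obtain ⟨w, h1, h0⟩ := ih (by omega)
      obtain ⟨i₀, hi₀⟩ : ∃ i₀, i₀ + (j + 1) = 2 * m := ⟨2 * m - (j + 1), by omega⟩
      have hadj : ∀ i, ω ((c ^ i) v) ((c ^ (j + 1)) w) =
          (-1) ^ (j + 1) * ω ((c ^ (i + (j + 1))) v) w := fun i => by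
          rw [add_comm i, pow_add c (j + 1) i, Module.End.mul_apply, apply_pow_of_skew hc (j + 1),
            ← mul_assoc,
            ← mul_pow, neg_one_mul, neg_neg, one_pow, one_mul]
      refine ⟨w - ((-1) ^ (j + 1) * ω ((c ^ i₀) v) w) • (c ^ (j + 1)) w, ?_, fun i hi hi' => ?_⟩
      · rw [map_sub, map_smul, hadj, hbig (2 * m + (j + 1)) (by omega), h1]
        simp
      · rw [map_sub, map_smul, hadj]
        by_cases h : i = i₀
        · subst h
          rw [hi₀, h1, mul_one, smul_eq_mul, mul_right_comm, ← mul_pow]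
          simp
        · rw [hbig (i + (j + 1)) (by omega), h0 i (by omega) hi']
          simp
  obtain ⟨w, h1, h0⟩ := key _ le_rfl
  refine ⟨w, fun i => ?_⟩
  split_ifs with h
  · rw [h, h1]
  · rcases Nat.lt_or_gt_of_ne h with h | h
    · exact h0 i (by omega) h
    · rw [hbig i h, map_zero, LinearMap.zero_apply]

theorem apply_aeval_neg_X_of_chain {c : Module.End F V} (hc : ∀ v w, ω (c v) w = - ω v (c w))
    {m : ℕ} {v w : V} (hw : ∀ i, ω ((c ^ i) v) w = if i = 2 * m then 1 else 0) (r : F[X]) :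
    ω v (aeval c (aeval (-X : F[X]) r) w) = 1 * ω v (aeval c r w) := by
  have hp : ∀ i, ω v ((c ^ i) w) = if i = 2 * m then 1 else 0 := fun i => by
    have := apply_pow_of_skew hc i v w
    rw [hw] at this
    split_ifs at this ⊢ with h
    · rw [this, h, pow_mul]; simp
    · exact (mul_eq_zero.1 this.symm).resolve_left (pow_ne_zero _ (by simp))
  rw [one_mul]
  induction r using Polynomial.induction_on' with
  | add p q hp hq => simp only [map_add, LinearMap.add_apply, hp, hq]
  | monomial n a =>
    rw [aeval_aeval_neg_X, aeval_monomial, aeval_monomial, neg_pow, Module.End.mul_apply,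
      Module.End.mul_apply, Module.End.mul_apply, Module.algebraMap_end_apply,
      Module.algebraMap_end_apply, map_smul, map_smul]
    congr 1
    have : ((-1 : Module.End F V) ^ n) ((c ^ n) w) = (-1 : F) ^ n • (c ^ n) w := by
      rcases Nat.even_or_odd n with h | h <;> simp [h.neg_one_pow]
    rw [this, map_smul, hp]
    split_ifs with h
    · rw [h, pow_mul]; simp
    · simp

theorem eq_zero_of_forall_of_chain (h2 : (2 : F) ≠ 0) (hω : ω.IsAlt) {c : Module.End F V}
    (hc : ∀ v w, ω (c v) w = - ω v (c w)) {m : ℕ} (hm : c ^ (2 * m + 1) = 0) {v w : V}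
    (hw : ω ((c ^ (2 * m)) v) w = 1) {x : V} (hx : ∃ p q : F[X], x = aeval c p v + aeval c q w)
    (hv0 : ∀ i, ω x ((c ^ i) v) = 0) (hw0 : ∀ i, ω x ((c ^ i) w) = 0) : x = 0 := by
  have hself : ∀ u, ω ((c ^ (2 * m)) u) u = 0 := fun u => by
    have h := apply_pow_of_skew hc (2 * m) u u
    rw [pow_mul (-1 : F), neg_one_sq, one_pow, one_mul] at h
    have h' : 2 * ω ((c ^ (2 * m)) u) u = 0 := by
      rw [two_mul, ← neg_eq_iff_add_eq_zero, hω.neg, h]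
    exact (mul_eq_zero.1 h').resolve_left h2
  have hwv : ω ((c ^ (2 * m)) w) v = -1 := by
    rw [apply_pow_of_skew hc, pow_mul (-1 : F), neg_one_sq, one_pow, one_mul, ← hω.neg, hw]
  have htail : ∀ (r : F[X]) u, (c ^ (2 * m)) (aeval c r u) = r.coeff 0 • (c ^ (2 * m)) u :=
    fun r u => by
      conv_lhs => rw [← divX_mul_X_add r]
      rw [map_add, mul_comm r.divX, map_mul, aeval_X, aeval_C, LinearMap.add_apply, map_add,
        Module.End.mul_apply, ← Module.End.mul_apply, ← pow_succ, hm, LinearMap.zero_apply,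
        zero_add, Module.algebraMap_end_apply, map_smul]
  have key : ∀ i ≤ 2 * m + 1, ∃ p q : F[X], x = (c ^ i) (aeval c p v + aeval c q w) := fun i => by
    induction i with
    | zero => exact fun _ => hx
    | succ i ih =>
      intro hi
      obtain ⟨p, q, rfl⟩ := ih (by omega)
      obtain ⟨j, hj⟩ : ∃ j, i + j = 2 * m := ⟨2 * m - i, by omega⟩
      have hpair : ∀ u, ω ((c ^ i) (aeval c p v + aeval c q w)) ((c ^ j) u) = 0 →
          p.coeff 0 * ω ((c ^ (2 * m)) v) u + q.coeff 0 * ω ((c ^ (2 * m)) w) u = 0 := fun u hu => by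
        have h := apply_pow_of_skew hc j ((c ^ i) (aeval c p v + aeval c q w)) u
        rw [hu, mul_zero, ← Module.End.mul_apply, ← pow_add, add_comm j, hj, map_add, htail,
          htail, map_add, map_smul, map_smul] at h
        exact h
      have hq := hpair v (hv0 j)
      have hp := hpair w (hw0 j)
      rw [hself, hwv, mul_zero, zero_add, mul_neg_one, neg_eq_zero] at hq
      rw [hself, hw, mul_zero, add_zero, mul_one] at hp
      refine ⟨p.divX, q.divX, ?_⟩
      conv_lhs => rw [← divX_mul_X_add p, ← divX_mul_X_add q]
      rw [hp, hq, map_zero, add_zero, add_zero, mul_comm, mul_comm q.divX, map_mul, map_mul, aeval_X,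
        pow_succ, Module.End.mul_apply, Module.End.mul_apply, Module.End.mul_apply, map_add c]
  obtain ⟨p, q, h⟩ := key _ le_rfl
  rw [h, hm, LinearMap.zero_apply]

theorem exists_isSkewInvolution_of_odd (h2 : (2 : F) ≠ 0) (hω : ω.IsAlt)
    (hnd : ω.SeparatingLeft) {c : Module.End F V} (hc : ∀ v w, ω (c v) w = - ω v (c w))
    (hind : IsIndecomposable ω c) {m : ℕ} (hm : c ^ (2 * m + 1) = 0) (hm0 : c ^ (2 * m) ≠ 0) :
    ∃ τ : V →ₗ[F] V, IsSkewInvolution ω τ ∧ ∀ w, τ (c w) = - c (τ w) := by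
  obtain ⟨v, hv⟩ : ∃ v, (c ^ (2 * m)) v ≠ 0 := by
    by_contra! h
    exact hm0 (LinearMap.ext h)
  obtain ⟨w, hw⟩ := exists_dual_chain hnd hc hm hv
  let E : V → F[X] →ₗ[F] V :=
    fun u => LinearMap.flip (aeval c : F[X] →ₐ[F] Module.End F V).toLinearMap u
  have hE : ∀ u p, E u p = aeval c p u := fun u p => rfl
  let φ : F[X] × F[X] →ₗ[F] V := (E v).coprod (E w)
  have hφ : ∀ a, φ a = aeval c a.1 v + aeval c a.2 w := fun a => rfl
  let σ : F[X] →ₗ[F] F[X] := (aeval (-X : F[X])).toLinearMap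
  have hσ : ∀ p, σ p = aeval (-X : F[X]) p := fun p => rfl
  rcases hind (LinearMap.range φ) (by
    rintro _ ⟨a, rfl⟩
    refine ⟨(X * a.1, X * a.2), ?_⟩
    simp [hφ]) (by
    rintro _ ⟨a, rfl⟩ ha
    refine eq_zero_of_forall_of_chain h2 hω hc hm (v := v) (w := w) (by rw [hw, if_pos rfl])
      ⟨a.1, a.2, rfl⟩ (fun i => ha _ ⟨(X ^ i, 0), by simp [hφ]⟩)
      fun i => ha _ ⟨(0, X ^ i), by simp [hφ]⟩) with hW | hW
  · refine absurd ?_ hv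
    have : v ∈ LinearMap.range φ := ⟨(1, 0), by simp [hφ]⟩
    rw [hW, Submodule.mem_bot] at this
    rw [this, map_zero]
  · have hsurj := LinearMap.range_eq_top.1 hW
    have hcross := apply_aeval_neg_X_of_forall hc (apply_aeval_neg_X_of_chain hc hw)
    have hcross' : ∀ a b : F[X], ω (aeval c (aeval (-X : F[X]) a) w)
        (aeval c (aeval (-X : F[X]) b) v) = ω (aeval c a w) (aeval c b v) := fun a b => by
      rw [← hω.neg, hcross, one_mul, hω.neg]
    obtain ⟨τ, hτ, h⟩ := exists_isSkewInvolution_of_surjective hnd φ hsurj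
      (σ.prodMap (-σ))
      (fun a => by simp [hσ, aeval_neg_X_involutive]) (fun a b => by
        simp only [hφ, LinearMap.prodMap_apply, hσ, LinearMap.neg_apply, map_neg, map_add,
          LinearMap.add_apply, hcross, hcross',
          apply_aeval_neg_X_of_forall hc (apply_aeval_neg_X_self hω hc v),
          apply_aeval_neg_X_of_forall hc (apply_aeval_neg_X_self hω hc w)]
        ring)
    refine ⟨τ, hτ, fun x => ?_⟩
    obtain ⟨a, rfl⟩ := hsurj x
    have e1 := h (X * a.1, X * a.2)
    have e2 : φ (X * a.1, X * a.2) = c (φ a) := by simp [hφ]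
    rw [← e2, e1, h a]
    simp [hφ, hσ, add_comm]

end OddNilpotent

section Wonenburger

open Polynomial

variable {F V : Type} [Field F] [AddCommGroup V] [Module F V] {ω : V →ₗ[F] V →ₗ[F] F}

theorem exists_isSkewInvolution_of_isIndecomposable [FiniteDimensional F V] (h2 : (2 : F) ≠ 0)
    (hω : ω.IsAlt) (hnd : ω.SeparatingLeft) {c : Module.End F V}
    (hc : ∀ v w, ω (c v) w = - ω v (c w)) (hind : IsIndecomposable ω c) :
    ∃ τ : V →ₗ[F] V, IsSkewInvolution ω τ ∧ ∀ w, τ (c w) = - c (τ w) := by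
  rcases subsingleton_or_nontrivial V with hV | hV
  · exact ⟨0, ⟨fun v w => by simp [Subsingleton.elim v 0], fun v => Subsingleton.elim _ _⟩,
      fun w => Subsingleton.elim _ _⟩
  have hsplit : ∀ p : F[X], IsNilpotent (aeval (c ^ 2) p) ∨ LinearMap.ker (aeval (c ^ 2) p) = ⊥ :=
    fun p => isNilpotent_or_ker_eq_bot hnd hind (aeval_sq_adjoint hc p) (fun _ _ h => h)
      (commute_aeval_sq c p)
  rcases hsplit X with h | h
  · rw [aeval_X] at h
    have hnil : ∃ K, c ^ K = 0 := by
      obtain ⟨n, hn⟩ := h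
      exact ⟨2 * n, by rw [pow_mul, hn]⟩
    have hK := Nat.find_spec hnil
    have hmin : ∀ i < Nat.find hnil, c ^ i ≠ 0 := fun i hi => Nat.find_min hnil hi
    have hK0 : Nat.find hnil ≠ 0 := fun h0 => by
      rw [h0, pow_zero] at hK
      exact one_ne_zero hK
    obtain ⟨k, hk | hk⟩ := Nat.even_or_odd' (Nat.find hnil)
    · obtain ⟨j, rfl⟩ : ∃ j, k = j + 1 := ⟨k - 1, by omega⟩
      refine exists_isSkewInvolution_of_ne_zero h2 hω hnd hc hind irreducible_X j ?_ ?_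
      · rw [map_pow, aeval_X, ← pow_mul, ← hk, hK]
      · rw [map_pow, aeval_X, ← pow_mul, ← pow_succ]
        exact hmin _ (by omega)
    · rw [hk] at hK hmin
      exact exists_isSkewInvolution_of_odd h2 hω hnd hc hind hK (hmin _ (by omega))
  · obtain ⟨f, hf, g, hg⟩ := WfDvdMonoid.exists_irreducible_factor
      (minpoly.not_isUnit F (c ^ 2)) (minpoly.ne_zero (Algebra.IsIntegral.isIntegral (c ^ 2)))
    have hnil : ∃ K, aeval (c ^ 2) f ^ K = 0 := by
      refine (hsplit f).resolve_right fun hker => hf.not_isUnit ?_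
      have h0 : aeval (c ^ 2) g = 0 := LinearMap.ext fun v => by
        have : aeval (c ^ 2) g v ∈ LinearMap.ker (aeval (c ^ 2) f) := by
          rw [LinearMap.mem_ker, ← Module.End.mul_apply, ← map_mul, ← hg, minpoly.aeval,
            LinearMap.zero_apply]
        rw [hker, Submodule.mem_bot] at this
        rw [this, LinearMap.zero_apply]
      have hg0 : g ≠ 0 := by
        rintro rfl
        rw [mul_zero] at hg
        exact minpoly.ne_zero (Algebra.IsIntegral.isIntegral (c ^ 2)) hg
      obtain ⟨r, hr⟩ := minpoly.dvd F _ h0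
      rw [hg] at hr
      exact IsUnit.of_mul_eq_one r (mul_left_cancel₀ hg0 (by rw [mul_one]; linear_combination -hr))
    have hK := Nat.find_spec hnil
    have hK0 : Nat.find hnil ≠ 0 := fun h0 => by
      rw [h0, pow_zero] at hK
      exact one_ne_zero hK
    obtain ⟨k, hk⟩ := Nat.exists_eq_succ_of_ne_zero hK0
    refine exists_isSkewInvolution_of_ne_zero h2 hω hnd hc hind hf k (by rw [map_pow, ← hK, hk])
      fun h0 => Nat.find_min hnil (m := k) (by omega) (LinearMap.ext fun v => ?_)
    have hsq : ∀ N : Module.End F V, N * c = 0 → N * c ^ 2 = 0 := fun N h => by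
      rw [sq, ← mul_assoc, h, zero_mul]
    have : aeval (c ^ 2) (f ^ k) v ∈ LinearMap.ker (aeval (c ^ 2) (X : F[X])) := by
      rw [LinearMap.mem_ker, aeval_X, ← Module.End.mul_apply,
        ((commute_aeval_sq c (f ^ k)).pow_left 2).eq, hsq _ h0, LinearMap.zero_apply]
    rw [h, Submodule.mem_bot] at this
    rw [← map_pow, this, LinearMap.zero_apply]

theorem exists_isSkewInvolution_of_ker_eq_bot [FiniteDimensional F V] (h2 : (2 : F) ≠ 0)
    (hω : ω.IsAlt) (hnd : ω.SeparatingLeft) {y : Module.End F V}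
    (hy : ∀ v w, ω (y v) (y w) = ω v w) (hind : IsIndecomposable ω y)
    (hker : LinearMap.ker (y + 1) = ⊥) :
    ∃ τ : V →ₗ[F] V, IsSkewInvolution ω τ ∧ ∀ v, τ (y (τ (y v))) = v := by
  obtain ⟨u, hu1, hu2⟩ := isUnit_iff_exists.1 ((LinearMap.isUnit_iff_ker_eq_bot (y + 1)).2 hker)
  have hu1' : ∀ v, y (u v) + u v = v := fun v => LinearMap.congr_fun hu1 v
  have hu2' : ∀ v, u (y v + v) = v := fun v => LinearMap.congr_fun hu2 v
  have hsurj : ∀ v, ∃ a, v = y a + a := fun v => ⟨u v, (hu1' v).symm⟩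
  let c : Module.End F V := (y - 1) * u
  have hc : ∀ v, c v = y (u v) - u v := fun v => rfl
  have hcu : ∀ v, (2 : F) • u v = v - c v := fun v => by
    rw [hc]; nth_rw 2 [← hu1' v]; rw [two_smul]; abel
  have hcy : ∀ v, (2 : F) • y (u v) = v + c v := fun v => by
    rw [hc]; nth_rw 2 [← hu1' v]; rw [two_smul]; abel
  have hskew : ∀ v w, ω (c v) w = - ω v (c w) := fun v w => by
    obtain ⟨a, rfl⟩ := hsurj v
    obtain ⟨b, rfl⟩ := hsurj w
    simp only [hc, hu2', map_add, map_sub, LinearMap.add_apply, LinearMap.sub_apply, hy]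
    ring
  have hindc : IsIndecomposable ω c := fun W hW hWnd => by
    refine hind W (fun w hw => ?_) hWnd
    have huW : ∀ w ∈ W, u w ∈ W := fun w hw => by
      have : (2 : F) • u w ∈ W := by rw [hcu]; exact W.sub_mem hw (hW w hw)
      exact (W.smul_mem_iff h2).1 this
    have hinj : Function.Injective (u.restrict huW) := fun a b hab => by
      have hab' : u a = u b := congrArg Subtype.val hab
      exact Subtype.ext (by rw [← hu1' a, ← hu1' b, hab'])
    obtain ⟨a, ha⟩ := LinearMap.surjective_of_injective hinj ⟨w, hw⟩
    have ha' : u a = w := congrArg Subtype.val ha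
    rw [← ha']
    have : (2 : F) • y (u a) ∈ W := by rw [hcy]; exact W.add_mem a.2 (hW a a.2)
    exact (W.smul_mem_iff h2).1 this
  obtain ⟨τ, hτ, hτc⟩ := exists_isSkewInvolution_of_isIndecomposable h2 hω hnd hskew hindc
  have h1 : ∀ v, τ (y (u v)) = u (τ v) := fun v => by
    refine smul_right_injective V h2 ?_
    change (2 : F) • _ = (2 : F) • _
    rw [← map_smul, hcy, hcu, map_add, hτc, sub_eq_add_neg]
  refine ⟨τ, hτ, fun v => ?_⟩
  have e := h1 (τ (y v + v))
  rw [hτ.2, hu2'] at e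
  have e' := h1 (y v + v)
  rw [hu2'] at e'
  rw [e', e]

/-- **Wonenburger's theorem**: an isometry of a symplectic space is a product of two
skew involutions. -/
theorem exists_isSkewInvolution_inverting [FiniteDimensional F V] (h2 : (2 : F) ≠ 0)
    (hω : ω.IsAlt) (hnd : ω.SeparatingLeft) (y : Module.End F V)
    (hy : ∀ v w, ω (y v) (y w) = ω v w) :
    ∃ τ : V →ₗ[F] V, IsSkewInvolution ω τ ∧ ∀ v, τ (y (τ (y v))) = v := by
  induction hn : Module.finrank F V using Nat.strong_induction_on generalizing V with
  | _ n ih =>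
  have hinj : Function.Injective y := (injective_iff_map_eq_zero y).2 fun v hv =>
    hnd v fun w => by rw [← hy, hv, map_zero, LinearMap.zero_apply]
  by_cases hind : IsIndecomposable ω y
  · have hker : IsNilpotent (y + 1) ∨ LinearMap.ker (y + 1) = ⊥ := by
      obtain ⟨z, hz1, hz2⟩ := isUnit_iff_exists.1
        ((LinearMap.isUnit_iff_ker_eq_bot y).2 (LinearMap.ker_eq_bot.2 hinj))
      have hz1' : ∀ v, y (z v) = v := fun v => LinearMap.congr_fun hz1 v
      refine isNilpotent_or_ker_eq_bot (s := z + 1) hnd hind (fun v w => ?_) (fun k v hv => ?_)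
        ((Commute.refl y).add_right (Commute.one_right y))
      · simp only [LinearMap.add_apply, Module.End.one_apply, map_add]
        rw [← hy (z v) w, hz1']
      · have hcomm : Commute z (y + 1) := Commute.add_right (hz2.trans hz1.symm)
          (Commute.one_right z)
        have : z + 1 = z * (y + 1) := by rw [mul_add, hz2, mul_one, add_comm]
        rw [this, hcomm.mul_pow, Module.End.mul_apply, hv, map_zero]
    rcases hker with ⟨k, hk⟩ | hker
    · obtain ⟨τ, hτ, h⟩ := exists_isSkewInvolution_of_ker_eq_bot (y := -y) h2 hω hnd
        (fun v w => by simp [hy]) (fun W hW => hind W fun w hw => by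
          simpa using W.neg_mem (hW w hw)) (by
          rw [eq_bot_iff]
          intro v hv
          rw [LinearMap.mem_ker, LinearMap.add_apply, LinearMap.neg_apply, Module.End.one_apply,
            neg_add_eq_zero] at hv
          have hpow : ∀ j, ((y + 1) ^ j) v = (2 : F) ^ j • v := fun j => by
            induction j with
            | zero => simp
            | succ j ih =>
              rw [pow_succ, Module.End.mul_apply, LinearMap.add_apply, hv, Module.End.one_apply,
                ← two_smul F, map_smul, ih, smul_smul, ← pow_succ']
          have := hpow k
          rw [hk, LinearMap.zero_apply, eq_comm, smul_eq_zero] at this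
          exact this.resolve_left (pow_ne_zero _ h2))
      exact ⟨τ, hτ, fun v => by simpa using h v⟩
    · exact exists_isSkewInvolution_of_ker_eq_bot h2 hω hnd hy hind hker
  · simp only [IsIndecomposable, not_forall, not_or] at hind
    obtain ⟨W, hW, hWnd, hW0, hW1⟩ := hind
    have hcompl := isCompl_orthogonal_of_forall hω hWnd
    have hort : ∀ w ∈ W, ∀ w' ∈ LinearMap.BilinForm.orthogonal ω W, ω w w' = 0 :=
      fun w hw w' hw' => hw' w hw
    have hort' : ∀ w ∈ LinearMap.BilinForm.orthogonal ω W, ∀ w' ∈ W, ω w w' = 0 :=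
      fun w hw w' hw' => by rw [← hω.neg, hw w' hw', neg_zero]
    have hW' : ∀ w ∈ LinearMap.BilinForm.orthogonal ω W, y w ∈ LinearMap.BilinForm.orthogonal ω W :=
      fun w' hw' w hw => by
        have hr : Function.Injective (y.restrict hW) := fun a b hab =>
          Subtype.ext (hinj (congrArg Subtype.val hab))
        obtain ⟨a, ha⟩ := LinearMap.surjective_of_injective hr ⟨w, hw⟩
        have ha' : y a = w := congrArg Subtype.val ha
        change ω w (y w') = 0
        rw [← ha', hy, hort a a.2 w' hw']
    have hlt : Module.finrank F W < n := hn ▸ Submodule.finrank_lt hW1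
    have hlt' : Module.finrank F (LinearMap.BilinForm.orthogonal ω W) < n := by
      have := Submodule.finrank_add_eq_of_isCompl hcompl
      have h0 := Submodule.finrank_eq_zero.not.2 hW0
      omega
    obtain ⟨τ, hτ, h⟩ := ih _ hlt (ω := ω.domRestrict₁₂ W W) (fun v => hω v)
      (separatingLeft_restrict hnd hcompl hort) (y.restrict hW) (fun v w => hy v w) rfl
    obtain ⟨τ', hτ', h'⟩ := ih _ hlt' (ω := ω.domRestrict₁₂ _ _) (fun v => hω v)
      (separatingLeft_restrict hnd hcompl.symm hort') (y.restrict hW') (fun v w => hy v w) rfl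
    obtain ⟨θ, hθ, h1, h2⟩ := exists_isSkewInvolution_of_isCompl hω hcompl hort hτ hτ'
    refine ⟨θ, hθ, fun v => ?_⟩
    obtain ⟨a, b, rfl, -⟩ := Submodule.existsUnique_add_of_isCompl hcompl v
    have ha := congrArg Subtype.val (h a)
    have hb := congrArg Subtype.val (h' b)
    have e1 : ∀ w : W, y w = (y.restrict hW w : W) := fun w => rfl
    have e2 : ∀ w : LinearMap.BilinForm.orthogonal ω W, y w = (y.restrict hW' w : _) := fun w => rfl
    rw [map_add, map_add, map_add, map_add, e1, h1, e1, h1, e2, h2, e2, h2, ha, hb]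

end Wonenburger

section Glue

variable {F V : Type} [Field F] [AddCommGroup V] [Module F V]

/-- The block diagonal embedding attached to a decomposition. -/
def glueHom {W W' : Submodule F V} (h : IsCompl W W') :
    (W ≃ₗ[F] W) × (W' ≃ₗ[F] W') →* (V ≃ₗ[F] V) where
  toFun k := (Submodule.prodEquivOfIsCompl W W' h).symm.trans
    ((k.1.prodCongr k.2).trans (Submodule.prodEquivOfIsCompl W W' h))
  map_one' := LinearEquiv.ext (Submodule.prodEquivOfIsCompl W W' h).apply_symm_apply
  map_mul' k l := by
    ext v
    simp

theorem glueHom_apply_left {W W' : Submodule F V} (h : IsCompl W W')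
    (k : (W ≃ₗ[F] W) × (W' ≃ₗ[F] W')) (w : W) : glueHom h k w = k.1 w := by
  simp [glueHom]

theorem glueHom_apply_right {W W' : Submodule F V} (h : IsCompl W W')
    (k : (W ≃ₗ[F] W) × (W' ≃ₗ[F] W')) (w : W') : glueHom h k w = k.2 w := by
  simp [glueHom]

theorem linearEquiv_ext_of_isCompl {W W' : Submodule F V} (h : IsCompl W W') {g g' : V ≃ₗ[F] V}
    (h1 : ∀ w : W, g w = g' w) (h2 : ∀ w : W', g w = g' w) : g = g' := by
  ext v
  obtain ⟨a, b, rfl, -⟩ := Submodule.existsUnique_add_of_isCompl h v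
  rw [map_add, map_add, h1, h2]

theorem glueHom_injective {W W' : Submodule F V} (h : IsCompl W W') :
    Function.Injective (glueHom h) := fun k l hkl => by
  refine Prod.ext (LinearEquiv.ext fun w => Subtype.ext ?_)
    (LinearEquiv.ext fun w => Subtype.ext ?_)
  · rw [← glueHom_apply_left h, hkl, glueHom_apply_left h]
  · rw [← glueHom_apply_right h, hkl, glueHom_apply_right h]

theorem exists_glueHom_eq [FiniteDimensional F V] {W W' : Submodule F V} (h : IsCompl W W')
    (g : V ≃ₗ[F] V) (h1 : ∀ w ∈ W, g w ∈ W) (h2 : ∀ w ∈ W', g w ∈ W') :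
    ∃ k, glueHom h k = g := by
  have key : ∀ U : Submodule F V, (∀ w ∈ U, g w ∈ U) → ∃ k : U ≃ₗ[F] U, ∀ w : U, (k w : V) = g w :=
    fun U hU => ⟨LinearEquiv.ofInjectiveEndo (g.toLinearMap.restrict hU) fun a b hab =>
      Subtype.ext (g.injective (congrArg Subtype.val hab)), fun w => rfl⟩
  obtain ⟨k, hk⟩ := key W h1
  obtain ⟨k', hk'⟩ := key W' h2
  refine ⟨(k, k'), linearEquiv_ext_of_isCompl h (fun w => ?_) fun w => ?_⟩
  · rw [glueHom_apply_left, hk]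
  · rw [glueHom_apply_right, hk']

end Glue

section SignedIsometry

variable {F V : Type} [Field F] [AddCommGroup V] [Module F V]

/-- The group of linear automorphisms multiplying the form `ω` by a sign. -/
def signedIsometry (ω : V →ₗ[F] V →ₗ[F] F) : Subgroup ((V ≃ₗ[F] V) × ℤˣ) where
  carrier := {x | ∀ v w, ω (x.1 v) (x.1 w) = ((x.2 : ℤ) : F) * ω v w}
  one_mem' v w := by simp
  mul_mem' {x y} hx hy v w := by
    change ω (x.1 (y.1 v)) (x.1 (y.1 w)) = _
    rw [hx, hy, ← mul_assoc]
    simp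
  inv_mem' {x} hx v w := by
    have h := hx (x.1⁻¹ v) (x.1⁻¹ w)
    have hv : ∀ v, x.1 (x.1⁻¹ v) = v := fun v => x.1.apply_symm_apply v
    rw [hv, hv] at h
    have hs : ((x.2 : ℤ) : F) * ((x.2 : ℤ) : F) = 1 := by
      rcases Int.units_eq_one_or x.2 with h | h <;> simp [h]
    change ω (x.1⁻¹ v) (x.1⁻¹ w) = (((x.2⁻¹ : ℤˣ) : ℤ) : F) * ω v w
    rw [Int.units_inv_eq_self, h, ← mul_assoc, hs, one_mul]

/-- The sign of a signed isometry. -/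
def isometrySign (ω : V →ₗ[F] V →ₗ[F] F) : signedIsometry ω →* ℤˣ :=
  (MonoidHom.snd _ _).comp (signedIsometry ω).subtype

variable {ω : V →ₗ[F] V →ₗ[F] F}

theorem signedIsometry_ext {x y : signedIsometry ω} (h : ∀ v, x.1.1 v = y.1.1 v)
    (hs : isometrySign ω x = isometrySign ω y) : x = y :=
  Subtype.ext (Prod.ext (LinearEquiv.ext h) hs)

/-- A skew involution as a signed isometry. -/
def IsSkewInvolution.toSignedIsometry {τ : V →ₗ[F] V} (hτ : IsSkewInvolution ω τ) :
    signedIsometry ω :=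
  ⟨(LinearEquiv.ofInvolutive τ hτ.2, -1), fun v w =>
    (hτ.1 v w).trans (by simp)⟩

theorem IsSkewInvolution.sq_toSignedIsometry {τ : V →ₗ[F] V} (hτ : IsSkewInvolution ω τ) :
    hτ.toSignedIsometry ^ 2 = 1 := by
  refine signedIsometry_ext (fun v => ?_) (by rw [map_pow, Int.units_sq, map_one])
  rw [sq]
  exact hτ.2 v

theorem exists_inverting_signedIsometry [FiniteDimensional F V] (h2 : (2 : F) ≠ 0)
    (hω : ω.IsAlt) (hnd : ω.SeparatingLeft) (y : signedIsometry ω) (hy : isometrySign ω y = 1) :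
    ∃ k, isometrySign ω k = -1 ∧ k ^ 2 = 1 ∧ k * y * k⁻¹ = y⁻¹ := by
  have hy' : y.1.2 = 1 := hy
  obtain ⟨τ, hτ, h⟩ := exists_isSkewInvolution_inverting h2 hω hnd y.1.1.toLinearMap
    (fun v w => by simpa [hy'] using y.2 v w)
  refine ⟨hτ.toSignedIsometry, rfl, hτ.sq_toSignedIsometry, ?_⟩
  have hinv : hτ.toSignedIsometry⁻¹ = hτ.toSignedIsometry :=
    inv_eq_of_mul_eq_one_left (by rw [← sq, hτ.sq_toSignedIsometry])
  rw [hinv, ← mul_eq_one_iff_eq_inv]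
  refine signedIsometry_ext h ?_
  rw [map_mul, map_mul, map_mul, hy, mul_one, mul_one, map_one]
  rfl

/-- Conjugation by a sign-reversing element inverts isometries up to conjugacy. -/
theorem isConj_inv_of_conj [FiniteDimensional F V] (h2 : (2 : F) ≠ 0)
    (hω : ω.IsAlt) (hnd : ω.SeparatingLeft) {τ : signedIsometry ω} (hτ : isometrySign ω τ = -1)
    (ι : MulAut (isometrySign ω).ker) (hι : ∀ x, (ι x : signedIsometry ω) = τ * x * τ⁻¹)
    (x : (isometrySign ω).ker) : IsConj (ι x) x⁻¹ := by
  obtain ⟨k, hk, -, h⟩ := exists_inverting_signedIsometry h2 hω hnd x x.2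
  refine isConj_iff.2 ⟨⟨k * τ⁻¹, ?_⟩, Subtype.ext ?_⟩
  · rw [MonoidHom.mem_ker, map_mul, map_inv, hk, hτ, mul_inv_cancel]
  · change k * τ⁻¹ * (ι x) * (k * τ⁻¹)⁻¹ = (x : signedIsometry ω)⁻¹
    rw [hι, ← h]
    group

end SignedIsometry

section QuasiCentralizer

theorem card_le_two_mul_card {M K : Type} [Group M] [Finite M] [Group K] [Finite K] (j : K →* M)
    (h : ∀ x y, x ∉ j.range → y ∉ j.range → x⁻¹ * y ∈ j.range) :
    Nat.card M ≤ 2 * Nat.card K := by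
  by_cases h0 : ∃ y, y ∉ j.range
  · obtain ⟨y, hy⟩ := h0
    have hs : Function.Surjective fun x : Bool × K => (if x.1 then y else 1) * j x.2 := fun x => by
      by_cases hx : x ∈ j.range
      · obtain ⟨k, rfl⟩ := hx
        exact ⟨(false, k), by simp⟩
      · obtain ⟨k, hk⟩ := h y x hy hx
        exact ⟨(true, k), by simp [hk]⟩
    simpa using Nat.card_le_card_of_surjective _ hs
  · have hs : Function.Surjective j := fun x => by
      by_contra hx
      exact h0 ⟨x, hx⟩
    have := Nat.card_le_card_of_surjective _ hs
    omega

/-- From the centralizer of an involution `t` to its centralizer modulo a central involution. -/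
theorem noAltConj_of_centralizer {Γ K : Type} [Group Γ] [Finite Γ] [Group K] [Finite K]
    (s : Γ →* ℤˣ) {e : Γ} (hec : ∀ g, g * e = e * g) {t : Γ}
    {h : Γ} (hs : s h = -1) (hh2 : h ^ 2 = 1) (ht : h * t * h⁻¹ = t ∨ h * t * h⁻¹ = t * e)
    {M : Subgroup Γ} (hM : ∀ x, x ∈ M ↔ s x = 1 ∧ (x * t * x⁻¹ = t ∨ x * t * x⁻¹ = t * e))
    {κ : MulAut K} (hκN : NoAlt κ) (hκ : ∀ x, κ (κ x) = x) (hI : ∀ x, IsConj (κ x) x⁻¹)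
    (j : K →* Γ) (hj : Function.Injective j)
    (hrange : ∀ x, x ∈ j.range ↔ s x = 1 ∧ x * t * x⁻¹ = t) {τ : Γ} (hτ : s τ = -1)
    (hτ2 : τ ^ 2 = 1) (hτt : τ * t * τ⁻¹ = t) (hτj : ∀ x, τ * j x * τ⁻¹ = j (κ x)) :
    NoAltConj M h := by
  intro ι hι
  have hte : ∀ x, x * (t * e) * x⁻¹ = x * t * x⁻¹ * e := fun x => by
    rw [mul_assoc (x * t), hec x⁻¹]
    group
  have hjM : ∀ x, j x ∈ M := fun x => by
    have := (hrange (j x)).1 ⟨x, rfl⟩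
    exact (hM _).2 ⟨this.1, Or.inl this.2⟩
  have hτM : ∀ x ∈ M, MulAut.conj τ x ∈ M := fun x hx => by
    rw [hM] at hx ⊢
    have e1 : MulAut.conj τ x * t * (MulAut.conj τ x)⁻¹ = τ * (x * t * x⁻¹) * τ⁻¹ := by
      nth_rw 1 [← hτt]
      rw [MulAut.conj_apply]
      group
    refine ⟨by rw [MulAut.conj_apply, map_mul, map_mul, hx.1, mul_one, ← map_mul, mul_inv_cancel,
      map_one], ?_⟩
    rw [e1]
    rcases hx.2 with h | h
    · left; rw [h, hτt]
    · right; rw [h, hte, hτt]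
  let ι' : MulAut M := restrictAut (MulAut.conj τ) (conj_conj_of_sq hτ2) M hτM
  have hι' : ∀ x : M, (ι' x : Γ) = τ * x * τ⁻¹ := fun x => coe_restrictAut _ _ _ _ x
  have hι'2 : ∀ x, ι' (ι' x) = x := fun x => Subtype.ext (by
    rw [hι', hι']
    exact conj_conj_of_sq hτ2 x)
  have hN : NoAlt ι' := by
    refine NoAlt.of_injective hκN hκ hι'2 hI (j.codRestrict M hjM)
      (fun a b hab => hj (congrArg Subtype.val hab)) (fun x => Subtype.ext ?_) ?_
    · rw [hι']
      exact hτj x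
    · have := card_le_two_mul_card (j.codRestrict M hjM) fun x y hx hy => ?_
      · have := Nat.card_pos (α := K)
        omega
      have hmem : ∀ x : M, x ∈ (j.codRestrict M hjM).range ↔ (x : Γ) ∈ j.range := fun x =>
        ⟨fun ⟨k, hk⟩ => ⟨k, congrArg Subtype.val hk⟩, fun ⟨k, hk⟩ => ⟨k, Subtype.ext hk⟩⟩
      rw [hmem, hrange] at hx hy ⊢
      have hx' := (hM x).1 x.2
      have hy' := (hM y).1 y.2
      have hx2 := hx'.2.resolve_left fun h => hx ⟨hx'.1, h⟩
      have hy2 := hy'.2.resolve_left fun h => hy ⟨hy'.1, h⟩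
      refine ⟨((hM _).1 (x⁻¹ * y).2).1, ?_⟩
      have e2 : ((x⁻¹ * y : M) : Γ) * t * ((x⁻¹ * y : M) : Γ)⁻¹ =
          (x : Γ)⁻¹ * (y * t * (y : Γ)⁻¹) * ((x : Γ)⁻¹)⁻¹ := by
        rw [Subgroup.coe_mul, Subgroup.coe_inv]
        group
      rw [e2, hy2, ← hx2]
      group
  have hτt' : τ⁻¹ * t * τ = t := by
    nth_rw 1 [← hτt]
    group
  have hmM : h * τ⁻¹ ∈ M := (hM _).2 ⟨by rw [map_mul, map_inv, hs, hτ, mul_inv_cancel], by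
    have : h * τ⁻¹ * t * (h * τ⁻¹)⁻¹ = h * (τ⁻¹ * t * τ) * h⁻¹ := by group
    rwa [this, hτt']⟩
  refine hN.of_mul ⟨h * τ⁻¹, hmM⟩ (Subtype.ext ?_) fun x => Subtype.ext ?_
  · rw [Subgroup.coe_mul, hι', Subgroup.coe_one]
    change h * τ⁻¹ * (τ * (h * τ⁻¹) * τ⁻¹) = 1
    have : h * τ⁻¹ * (τ * (h * τ⁻¹) * τ⁻¹) = h * h * (τ * τ)⁻¹ := by group
    rw [this, ← sq, ← sq, hh2, hτ2, inv_one, mul_one]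
  · rw [hι, Subgroup.coe_mul, Subgroup.coe_mul, hι', Subgroup.coe_inv]
    change h * x * h⁻¹ = h * τ⁻¹ * (τ * x * τ⁻¹) * (h * τ⁻¹)⁻¹
    group

end QuasiCentralizer

section SymplecticInduction

variable {F V : Type} [Field F] [AddCommGroup V] [Module F V] {ω : V →ₗ[F] V →ₗ[F] F}

theorem finite_signedIsometry [Finite F] [FiniteDimensional F V] (ω : V →ₗ[F] V →ₗ[F] F) :
    Finite (signedIsometry ω) := by
  have := Module.finite_of_finite F (M := V)
  have : Finite (V ≃ₗ[F] V) := DFunLike.finite _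
  infer_instance

theorem glueHom_mem (hω : ω.IsAlt) {W W' : Submodule F V} (h : IsCompl W W')
    (hort : ∀ w ∈ W, ∀ w' ∈ W', ω w w' = 0) {k : (W ≃ₗ[F] W) × (W' ≃ₗ[F] W')} {ε : ℤˣ}
    (h1 : (k.1, ε) ∈ signedIsometry (ω.domRestrict₁₂ W W))
    (h2 : (k.2, ε) ∈ signedIsometry (ω.domRestrict₁₂ W' W')) :
    (glueHom h k, ε) ∈ signedIsometry ω := fun v w => by
  obtain ⟨a, b, rfl, -⟩ := Submodule.existsUnique_add_of_isCompl h v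
  obtain ⟨a', b', rfl, -⟩ := Submodule.existsUnique_add_of_isCompl h w
  have hort' : ∀ w ∈ W, ∀ w' ∈ W', ω w' w = 0 := fun w hw w' hw' => by
    rw [← hω.neg, hort w hw w' hw', neg_zero]
  have e1 : ω (k.1 a) (k.1 a') = ((ε : ℤ) : F) * ω a a' := h1 a a'
  have e2 : ω (k.2 b) (k.2 b') = ((ε : ℤ) : F) * ω b b' := h2 b b'
  simp only [map_add, glueHom_apply_left, glueHom_apply_right, LinearMap.add_apply, e1, e2,
    hort _ (k.1 a).2 _ (k.2 b').2, hort' _ (k.1 a').2 _ (k.2 b).2, hort _ a.2 _ b'.2,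
    hort' _ a'.2 _ b.2]
  ring

/-- The block diagonal embedding of isometry groups. -/
def glueIsometry (hω : ω.IsAlt) {W W' : Submodule F V} (h : IsCompl W W')
    (hort : ∀ w ∈ W, ∀ w' ∈ W', ω w w' = 0) :
    (isometrySign (ω.domRestrict₁₂ W W)).ker × (isometrySign (ω.domRestrict₁₂ W' W')).ker →*
      signedIsometry ω where
  toFun x := ⟨(glueHom h (x.1.1.1.1, x.2.1.1.1), 1), by
    have h1 : x.1.1.1.2 = 1 := x.1.2
    have h2 : x.2.1.1.2 = 1 := x.2.2
    refine glueHom_mem hω h hort ?_ ?_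
    · rw [← h1]; exact x.1.1.2
    · rw [← h2]; exact x.2.1.2⟩
  map_one' := Subtype.ext (Prod.ext (map_one (glueHom h)) rfl)
  map_mul' x y := Subtype.ext (Prod.ext
    (map_mul (glueHom h) (x.1.1.1.1, x.2.1.1.1) (y.1.1.1.1, y.2.1.1.1)) (one_mul 1).symm)

theorem glueIsometry_injective (hω : ω.IsAlt) {W W' : Submodule F V} (h : IsCompl W W')
    (hort : ∀ w ∈ W, ∀ w' ∈ W', ω w w' = 0) :
    Function.Injective (glueIsometry hω h hort) := fun x y hxy => by
  have e := glueHom_injective h (congrArg (fun z : signedIsometry ω => z.1.1) hxy)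
  have hs : ∀ {U : Submodule F V} (a b : (isometrySign (ω.domRestrict₁₂ U U)).ker),
      a.1.1.1 = b.1.1.1 → a = b := fun a b hab =>
    Subtype.ext (Subtype.ext (Prod.ext hab (a.2.trans b.2.symm)))
  exact Prod.ext (hs _ _ (Prod.mk.inj e).1) (hs _ _ (Prod.mk.inj e).2)

/-- The automorphism of the isometry group given by conjugation with a skew involution. -/
def conjKer (τ : signedIsometry ω) (hτ2 : τ ^ 2 = 1) : MulAut (isometrySign ω).ker :=
  restrictAut (MulAut.conj τ) (conj_conj_of_sq hτ2) _ fun x hx =>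
    (isometrySign ω).normal_ker.conj_mem x hx τ

theorem coe_conjKer (τ : signedIsometry ω) (hτ2 : τ ^ 2 = 1) (x : (isometrySign ω).ker) :
    (conjKer τ hτ2 x : signedIsometry ω) = τ * x * τ⁻¹ :=
  coe_restrictAut _ _ _ _ x

theorem conjKer_conjKer (τ : signedIsometry ω) (hτ2 : τ ^ 2 = 1) (x : (isometrySign ω).ker) :
    conjKer τ hτ2 (conjKer τ hτ2 x) = x := Subtype.ext (by
  rw [coe_conjKer, coe_conjKer]
  exact conj_conj_of_sq hτ2 (x : signedIsometry ω))

theorem noAltConj_isometry [Finite F] [FiniteDimensional F V] (h2 : (2 : F) ≠ 0)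
    (hω : ω.IsAlt) (hnd : ω.SeparatingLeft) {τ : signedIsometry ω} (hτ : isometrySign ω τ = -1)
    (hτ2 : τ ^ 2 = 1) : NoAltConj (isometrySign ω).ker τ := by
  induction hn : Module.finrank F V using Nat.strong_induction_on generalizing V with
  | _ n ih =>
  have hfin := finite_signedIsometry ω
  rcases subsingleton_or_nontrivial V with hV | hV
  · refine fun ι _ => NoAlt.of_commute ι fun x y => Subtype.ext (signedIsometry_ext
      (fun v => Subsingleton.elim _ _) ?_)
    rw [Subgroup.coe_mul, Subgroup.coe_mul, map_mul, map_mul, mul_comm]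
  let e : signedIsometry ω := ⟨(LinearEquiv.neg F, 1), fun v w => by simp⟩
  have he : ∀ v, e.1.1 v = -v := fun v => rfl
  have hec : ∀ g, g * e = e * g := fun g => signedIsometry_ext
    (fun v => map_neg g.1.1 v) (by rw [map_mul, map_mul, mul_comm])
  refine noAltConj_ker (isometrySign ω) (e := e) rfl hec
    (signedIsometry_ext (fun v => neg_neg v) rfl) (fun h => ?_)
    (exists_inverting_signedIsometry h2 hω hnd) ?_ hτ hτ2
  · obtain ⟨v, hv⟩ := exists_ne (0 : V)
    have h' : -v = v := by rw [← he, h]; rfl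
    have h3 : (2 : F) • v = 0 := by rw [two_smul]; nth_rw 1 [← h']; exact neg_add_cancel v
    exact (smul_ne_zero h2 hv) h3
  intro t ht ht2 ht1 hte h hs hh2 hht M hM
  have ht' : t.1.2 = 1 := ht
  have htt : ∀ v, t.1.1 (t.1.1 v) = v := fun v => by
    have := congrArg (fun z : signedIsometry ω => z.1.1 v) ht2
    rwa [sq] at this
  have htω : ∀ v w, ω (t.1.1 v) (t.1.1 w) = ω v w := fun v w => by
    have := t.2 v w
    rwa [ht', Units.val_one, Int.cast_one, one_mul] at this
  let W : Submodule F V := LinearMap.ker (t.1.1.toLinearMap - 1)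
  let W' : Submodule F V := LinearMap.ker (t.1.1.toLinearMap + 1)
  have hW : ∀ v, v ∈ W ↔ t.1.1 v = v := fun v => by
    change t.1.1 v - v = 0 ↔ _
    rw [sub_eq_zero]
  have hW' : ∀ v, v ∈ W' ↔ t.1.1 v = -v := fun v => by
    change t.1.1 v + v = 0 ↔ _
    rw [add_eq_zero_iff_eq_neg]
  have hcompl : IsCompl W W' := by
    refine isCompl_iff.2 ⟨Submodule.disjoint_def.2 fun v hv hv' => ?_,
      codisjoint_iff.2 (eq_top_iff.2 fun v _ => ?_)⟩
    · rw [hW] at hv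
      rw [hW', hv] at hv'
      have h3 : (2 : F) • v = 0 := by rw [two_smul]; nth_rw 1 [hv']; exact neg_add_cancel v
      exact (smul_eq_zero.1 h3).resolve_left h2
    · have e1 : v = (2 : F)⁻¹ • (v + t.1.1 v) + (2 : F)⁻¹ • (v - t.1.1 v) := by
        rw [← smul_add, add_add_sub_cancel, ← two_smul F, smul_smul, inv_mul_cancel₀ h2, one_smul]
      rw [e1]
      refine Submodule.add_mem_sup (W.smul_mem _ ((hW _).2 ?_)) (W'.smul_mem _ ((hW' _).2 ?_))
      · rw [map_add, htt, add_comm]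
      · rw [map_sub, htt, neg_sub]
  have hort : ∀ w ∈ W, ∀ w' ∈ W', ω w w' = 0 := fun w hw w' hw' => by
    have h3 := htω w w'
    rw [(hW w).1 hw, (hW' w').1 hw', map_neg] at h3
    have h4 : 2 * ω w w' = 0 := by linear_combination -h3
    exact (mul_eq_zero.1 h4).resolve_left h2
  have hort' : ∀ w ∈ W', ∀ w' ∈ W, ω w w' = 0 := fun w hw w' hw' => by
    rw [← hω.neg, hort w' hw' w hw, neg_zero]
  have hWtop : W ≠ ⊤ := fun hc => ht1 (signedIsometry_ext
    (fun v => (hW v).1 (hc ▸ Submodule.mem_top)) ht)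
  have hWtop' : W' ≠ ⊤ := fun hc => hte (signedIsometry_ext
    (fun v => (hW' v).1 (hc ▸ Submodule.mem_top)) ht)
  have hnd1 := separatingLeft_restrict hnd hcompl hort
  have hnd2 := separatingLeft_restrict hnd hcompl.symm hort'
  have hω1 : (ω.domRestrict₁₂ W W).IsAlt := fun v => hω v
  have hω2 : (ω.domRestrict₁₂ W' W').IsAlt := fun v => hω v
  have hone : ∀ {U : Submodule F V}, (1 : signedIsometry (ω.domRestrict₁₂ U U)) ∈
    (isometrySign (ω.domRestrict₁₂ U U)).ker := fun {U} => one_mem _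
  obtain ⟨τ₁, hτ₁, hτ₁2, -⟩ := exists_inverting_signedIsometry h2 hω1 hnd1 1 hone
  obtain ⟨τ₂, hτ₂, hτ₂2, -⟩ := exists_inverting_signedIsometry h2 hω2 hnd2 1 hone
  have hN1 := ih _ (hn ▸ Submodule.finrank_lt hWtop) hω1 hnd1 hτ₁ hτ₁2 rfl _ (coe_conjKer τ₁ hτ₁2)
  have hN2 := ih _ (hn ▸ Submodule.finrank_lt hWtop') hω2 hnd2 hτ₂ hτ₂2 rfl _ (coe_conjKer τ₂ hτ₂2)
  have hI1 := isConj_inv_of_conj h2 hω1 hnd1 hτ₁ _ (coe_conjKer τ₁ hτ₁2)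
  have hI2 := isConj_inv_of_conj h2 hω2 hnd2 hτ₂ _ (coe_conjKer τ₂ hτ₂2)
  have hf1 := finite_signedIsometry (ω.domRestrict₁₂ W W)
  have hf2 := finite_signedIsometry (ω.domRestrict₁₂ W' W')
  have hτ₁' : τ₁.1.2 = -1 := hτ₁
  have hτ₂' : τ₂.1.2 = -1 := hτ₂
  let θ : signedIsometry ω := ⟨(glueHom hcompl (τ₁.1.1, τ₂.1.1), -1), glueHom_mem hω hcompl hort
    (by rw [← hτ₁']; exact τ₁.2) (by rw [← hτ₂']; exact τ₂.2)⟩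
  have hθ2 : θ ^ 2 = 1 := by
    rw [sq]
    refine Subtype.ext (Prod.ext ?_ rfl)
    change glueHom hcompl (τ₁.1.1, τ₂.1.1) * glueHom hcompl (τ₁.1.1, τ₂.1.1) = 1
    rw [← map_mul, Prod.mk_mul_mk]
    have e1 : τ₁.1.1 * τ₁.1.1 = 1 := by
      rw [sq] at hτ₁2
      exact congrArg (fun z : signedIsometry _ => z.1.1) hτ₁2
    have e2 : τ₂.1.1 * τ₂.1.1 = 1 := by
      rw [sq] at hτ₂2
      exact congrArg (fun z : signedIsometry _ => z.1.1) hτ₂2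
    rw [e1, e2]
    exact map_one _
  have hblock : ∀ x : signedIsometry ω, (∀ w ∈ W, x.1.1 w ∈ W) → (∀ w ∈ W', x.1.1 w ∈ W') →
      x * t * x⁻¹ = t := fun x h1 h2 => by
    rw [mul_inv_eq_iff_eq_mul]
    refine Subtype.ext (Prod.ext (linearEquiv_ext_of_isCompl hcompl (fun w => ?_) fun w => ?_)
      (mul_comm _ _))
    · change x.1.1 (t.1.1 w) = t.1.1 (x.1.1 w)
      rw [(hW _).1 w.2, (hW _).1 (h1 _ w.2)]
    · change x.1.1 (t.1.1 w) = t.1.1 (x.1.1 w)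
      rw [(hW' _).1 w.2, (hW' _).1 (h2 _ w.2), map_neg]
  have hglue : ∀ k, (∀ w ∈ W, glueHom hcompl k w ∈ W) ∧ ∀ w ∈ W', glueHom hcompl k w ∈ W' :=
    fun k => ⟨fun w hw => by
      rw [glueHom_apply_left hcompl k ⟨w, hw⟩]
      exact Subtype.property _, fun w hw => by
      rw [glueHom_apply_right hcompl k ⟨w, hw⟩]
      exact Subtype.property _⟩
  refine noAltConj_of_centralizer (isometrySign ω) hec hs hh2 hht hM
    (hN1.prod hN2 (conjKer_conjKer τ₁ hτ₁2) hI1)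
    (fun x => Prod.ext (conjKer_conjKer τ₁ hτ₁2 x.1) (conjKer_conjKer τ₂ hτ₂2 x.2))
    (fun x => ?_) (glueIsometry hω hcompl hort) (glueIsometry_injective hω hcompl hort)
    (fun x => ⟨?_, fun hx => ?_⟩) (τ := θ) rfl hθ2 (hblock θ (hglue _).1 (hglue _).2) fun x => ?_
  · obtain ⟨a, ha⟩ := isConj_iff.1 (hI1 x.1)
    obtain ⟨b, hb⟩ := isConj_iff.1 (hI2 x.2)
    exact isConj_iff.2 ⟨(a, b), Prod.ext ha hb⟩
  · rintro ⟨k, rfl⟩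
    exact ⟨rfl, hblock _ (hglue _).1 (hglue _).2⟩
  · have hcomm : ∀ v, x.1.1 (t.1.1 v) = t.1.1 (x.1.1 v) := fun v =>
      congrArg (fun z : signedIsometry ω => z.1.1 v) (mul_inv_eq_iff_eq_mul.1 hx.2)
    obtain ⟨k, hk⟩ := exists_glueHom_eq hcompl x.1.1
      (fun w hw => by rw [hW] at hw ⊢; rw [← hcomm, hw])
      (fun w hw => by rw [hW'] at hw ⊢; rw [← hcomm, hw, map_neg])
    have hx1 : x.1.2 = 1 := hx.1
    have hxω : ∀ v w, ω (x.1.1 v) (x.1.1 w) = ω v w := fun v w => by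
      have := x.2 v w
      rwa [hx1, Units.val_one, Int.cast_one, one_mul] at this
    refine ⟨(⟨⟨(k.1, 1), fun v w => ?_⟩, rfl⟩, ⟨⟨(k.2, 1), fun v w => ?_⟩, rfl⟩),
      Subtype.ext (Prod.ext hk hx1.symm)⟩
    · rw [Units.val_one, Int.cast_one, one_mul]
      change ω (k.1 v : V) (k.1 w : V) = ω (v : V) (w : V)
      rw [← glueHom_apply_left hcompl, ← glueHom_apply_left hcompl, hk, hxω]
    · rw [Units.val_one, Int.cast_one, one_mul]
      change ω (k.2 v : V) (k.2 w : V) = ω (v : V) (w : V)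
      rw [← glueHom_apply_right hcompl, ← glueHom_apply_right hcompl, hk, hxω]
  · rw [mul_inv_eq_iff_eq_mul]
    refine Subtype.ext (Prod.ext ?_ (mul_comm _ _))
    change glueHom hcompl (τ₁.1.1, τ₂.1.1) * glueHom hcompl (x.1.1.1.1, x.2.1.1.1) =
      glueHom hcompl ((conjKer τ₁ hτ₁2 x.1).1.1.1, (conjKer τ₂ hτ₂2 x.2).1.1.1) *
        glueHom hcompl (τ₁.1.1, τ₂.1.1)
    rw [← map_mul, ← map_mul]
    congr 1
    refine Prod.ext ?_ ?_
    · exact congrArg (fun z : signedIsometry _ => z.1.1)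
        (mul_inv_eq_iff_eq_mul.1 (coe_conjKer τ₁ hτ₁2 x.1).symm)
    · exact congrArg (fun z : signedIsometry _ => z.1.1)
        (mul_inv_eq_iff_eq_mul.1 (coe_conjKer τ₂ hτ₂2 x.2).symm)

end SymplecticInduction

section Indicator

variable {G : Type} [Group G] {V : Type} [AddCommGroup V] [Module ℂ V] [FiniteDimensional ℂ V]

/-- Schur's lemma. -/
theorem exists_eq_smul_one {ρ : Representation ℂ G V} (hρ : ρ.IsIrreducible)
    (f : V →ₗ[ℂ] V) (hf : ∀ g v, f (ρ g v) = ρ g (f v)) : ∃ c : ℂ, f = c • 1 := by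
  have := nontrivial_of_isIrreducible hρ
  obtain ⟨c, hc⟩ := Module.End.exists_eigenvalue f
  refine ⟨c, LinearMap.ext fun v => ?_⟩
  have h := (eq_bot_or_eq_top hρ (Module.End.eigenspace f c) fun g v hv => by
    rw [Module.End.mem_eigenspace_iff] at hv ⊢
    rw [hf, hv, map_smul]).resolve_left hc
  exact Module.End.mem_eigenspace_iff.1 (h ▸ Submodule.mem_top : v ∈ Module.End.eigenspace f c)

theorem isIrreducible_of_sum_character [Fintype G] (ρ : Representation ℂ G V)
    (h : ∑ g, ρ.character g * ρ.character g⁻¹ = Fintype.card G) : ρ.IsIrreducible := by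
  rw [sum_character_mul_inv] at h
  have h1 : Module.finrank ℂ (Representation.IntertwiningMap ρ ρ) = 1 := by
    have h' : (Fintype.card G : ℂ) * (Module.finrank ℂ (Representation.IntertwiningMap ρ ρ) : ℂ) =
      Fintype.card G * 1 := by rw [h, mul_one]
    exact_mod_cast mul_left_cancel₀ (by simp) h'
  have hV : Nontrivial V := by
    by_contra hV
    rw [not_nontrivial_iff_subsingleton] at hV
    obtain ⟨f, hf, -⟩ := finrank_eq_one_iff'.1 h1
    exact hf (Representation.IntertwiningMap.ext (Subsingleton.elim _ _))
  refine isIrreducible_of_forall ρ fun W hW => ?_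
  obtain ⟨C, hC, hWC⟩ := exists_stable_isCompl ρ W hW
  have hp : ∀ g v, W.projection C hWC (ρ g v) = ρ g (W.projection C hWC v) := fun g v => by
    obtain ⟨a, b, rfl, -⟩ := Submodule.existsUnique_add_of_isCompl hWC v
    simp only [map_add]
    rw [Submodule.projection_apply_left, Submodule.projection_apply_right]
    have e1 := Submodule.projection_apply_left hWC ⟨ρ g a, hW g a a.2⟩
    have e2 := Submodule.projection_apply_right hWC ⟨ρ g b, hC g b b.2⟩
    rw [e1, e2, map_zero]
  have hid : Representation.IntertwiningMap.id ρ ≠ 0 := fun h => by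
    obtain ⟨v, hv⟩ := exists_ne (0 : V)
    exact hv (by simpa using congrArg (fun f : Representation.IntertwiningMap ρ ρ => f v) h)
  obtain ⟨c, hc⟩ := (finrank_eq_one_iff_of_nonzero' _ hid).1 h1
    ((W.projection C hWC).intertwiningMap_of_isIntertwiningMap ρ ρ hp)
  have hc' : ∀ v, c • v = W.projection C hWC v := fun v =>
    congrArg (fun f : Representation.IntertwiningMap ρ ρ => f v) hc
  by_cases hc0 : c = 0
  · left
    rw [eq_bot_iff]
    intro w hw
    have := hc' w
    rw [Submodule.projection_apply_left hWC ⟨w, hw⟩, hc0, zero_smul] at this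
    exact this.symm
  · right
    rw [eq_top_iff]
    intro v _
    have hm : c • v ∈ W := by rw [hc']; exact Submodule.projection_apply_mem hWC v
    exact (W.smul_mem_iff hc0).1 hm

theorem sum_mul_mul_inv [Fintype G] {ρ : Representation ℂ G V} (hρ : ρ.IsIrreducible)
    (f : V →ₗ[ℂ] V) :
    ∑ g, ρ g * f * ρ g⁻¹ =
      (Fintype.card G * LinearMap.trace ℂ V f / Module.finrank ℂ V : ℂ) • 1 := by
  have := nontrivial_of_isIrreducible hρ
  have hd : (Module.finrank ℂ V : ℂ) ≠ 0 := by
    exact_mod_cast Module.finrank_pos.ne'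
  obtain ⟨c, hc⟩ := exists_eq_smul_one hρ (∑ g, ρ g * f * ρ g⁻¹) fun h v => by
    rw [LinearMap.sum_apply, LinearMap.sum_apply, map_sum]
    refine Fintype.sum_equiv (Equiv.mulLeft h⁻¹) _ _ fun x => ?_
    simp [map_mul]
  have ht := congrArg (LinearMap.trace ℂ V) hc
  have hg : ∀ g, LinearMap.trace ℂ V (ρ g * f * ρ g⁻¹) = LinearMap.trace ℂ V f := fun g => by
    rw [LinearMap.trace_mul_comm, ← mul_assoc, ← map_mul, inv_mul_cancel, map_one, one_mul]
  rw [map_sum, Finset.sum_congr rfl fun g _ => hg g, map_smul, LinearMap.trace_one, smul_eq_mul,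
    Finset.sum_const, Finset.card_univ, nsmul_eq_mul] at ht
  rw [hc, ht, mul_div_cancel_right₀ _ hd]

/-- The Frobenius–Schur indicator of an orthogonal representation. -/
theorem sum_character_sq_of_symm [Fintype G] {ρ : Representation ℂ G V} (hρ : ρ.IsIrreducible)
    {B : V →ₗ[ℂ] V →ₗ[ℂ] ℂ} (hB : IsTwisted 1 ρ B) (h0 : B ≠ 0) (hs : B.flip = B) :
    ∑ g, ρ.character (g * g) = Fintype.card G := by
  have := nontrivial_of_isIrreducible hρ
  have hd : (Module.finrank ℂ V : ℂ) ≠ 0 := by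
    exact_mod_cast Module.finrank_pos.ne'
  let b := Module.finBasis ℂ V
  let A : G → Matrix (Fin (Module.finrank ℂ V)) (Fin (Module.finrank ℂ V)) ℂ :=
    fun g => LinearMap.toMatrix b b (ρ g)
  have hA : ∀ x y, A (x * y) = A x * A y := fun x y => by
    simp [A, LinearMap.toMatrix_mul]
  have hA1 : A 1 = 1 := by simp [A]
  have hAinv : ∀ x, A x * A x⁻¹ = 1 := fun x => by rw [← hA, mul_inv_cancel, hA1]
  have htr : ∀ x, ρ.character x = (A x).trace := fun x =>
    LinearMap.trace_eq_matrix_trace ℂ b (ρ x)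
  have hsep : B.SeparatingLeft := by
    rw [LinearMap.separatingLeft_iff_ker_eq_bot]
    exact ker_eq_bot_of_ne_zero hρ (fun _ => rfl) hB h0
  set S := LinearMap.toMatrix₂ b b B with hS
  have hdet : IsUnit S.det := isUnit_iff_ne_zero.2
    ((LinearMap.separatingLeft_iff_det_ne_zero b).1 hsep)
  have hST : Sᵀ = S := by
    ext i j
    rw [Matrix.transpose_apply, hS, LinearMap.toMatrix₂_apply, LinearMap.toMatrix₂_apply]
    exact LinearMap.congr_fun₂ hs (b i) (b j)
  have hinv : ∀ g, (A g)ᵀ * S * A g = S := fun g => by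
    have e : B.compl₁₂ (ρ g) (ρ g) = B := LinearMap.ext₂ fun v w => hB g v w
    have := LinearMap.toMatrix₂_compl₁₂ b b b b B (ρ g) (ρ g)
    rw [e] at this
    exact this.symm
  have hAg : ∀ g, A g = S⁻¹ * (A g⁻¹)ᵀ * S := fun g => by
    have e1 : (A g⁻¹)ᵀ * S = S * A g := by
      have h1 := hinv g⁻¹
      have h2 : A g⁻¹ * A g = 1 := by simpa using hAinv g⁻¹
      calc (A g⁻¹)ᵀ * S = (A g⁻¹)ᵀ * S * (A g⁻¹ * A g) := by rw [h2, Matrix.mul_one]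
        _ = S * A g := by rw [← Matrix.mul_assoc, h1]
    rw [Matrix.mul_assoc, e1, ← Matrix.mul_assoc, Matrix.nonsing_inv_mul _ hdet, Matrix.one_mul]
  set κ : ℂ := Fintype.card G / Module.finrank ℂ V with hκ
  have hschur : ∀ i j k l, ∑ g, A g i j * A g⁻¹ l k =
      if j = l ∧ i = k then κ else 0 := fun i j k l => by
    have h1 := congrArg (LinearMap.toMatrix b b)
      (sum_mul_mul_inv hρ (Matrix.toLin b b (Matrix.single j l 1)))
    rw [map_sum, map_smul, LinearMap.toMatrix_one, LinearMap.trace_eq_matrix_trace ℂ b,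
      LinearMap.toMatrix_toLin] at h1
    simp only [LinearMap.toMatrix_mul, LinearMap.toMatrix_toLin] at h1
    have h2 := congrFun (congrFun h1 i) k
    rw [Matrix.sum_apply] at h2
    have h3 : ∀ g, (A g * (Matrix.single j l 1 : Matrix _ _ ℂ) * A g⁻¹) i k =
        A g i j * A g⁻¹ l k := fun g => by
      rw [Matrix.mul_assoc, Matrix.mul_apply, Finset.sum_eq_single j]
      · rw [Matrix.single_mul_apply_same, one_mul]
      · intro x _ hx
        rw [Matrix.single_mul_apply_of_ne _ _ _ _ _ hx, mul_zero]
      · simp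
    rw [← Finset.sum_congr rfl fun g _ => h3 g, h2, Matrix.smul_apply, Matrix.one_apply]
    by_cases hjl : j = l
    · subst hjl
      by_cases hik : i = k <;> simp [hik, hκ]
    · simp [hjl]
  have hexp : ∀ g, ρ.character (g * g) =
      ∑ i, ∑ j, ∑ k, ∑ l, S⁻¹ j k * S l i * (A g i j * A g⁻¹ l k) := fun g => by
    rw [htr, hA]
    nth_rw 2 [hAg]
    simp only [Matrix.trace, Matrix.diag_apply, Matrix.mul_apply, Finset.mul_sum, Finset.sum_mul,
      Matrix.transpose_apply]
    refine Finset.sum_congr rfl fun i _ => Finset.sum_congr rfl fun j _ => ?_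
    rw [Finset.sum_comm]
    refine Finset.sum_congr rfl fun k _ => Finset.sum_congr rfl fun l _ => ?_
    ring
  simp only [hexp]
  have hswap : ∑ g, ∑ i, ∑ j, ∑ k, ∑ l, S⁻¹ j k * S l i * (A g i j * A g⁻¹ l k) =
      ∑ i, ∑ j, ∑ k, ∑ l, S⁻¹ j k * S l i * ∑ g, A g i j * A g⁻¹ l k := by
    simp only [Finset.mul_sum]
    rw [Finset.sum_comm]
    refine Finset.sum_congr rfl fun i _ => ?_
    rw [Finset.sum_comm]
    refine Finset.sum_congr rfl fun j _ => ?_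
    rw [Finset.sum_comm]
    refine Finset.sum_congr rfl fun k _ => ?_
    rw [Finset.sum_comm]
  rw [hswap]
  have hSS : ∑ i, ∑ j, S⁻¹ j i * S j i = Module.finrank ℂ V := by
    have := congrArg Matrix.trace (Matrix.mul_nonsing_inv S hdet)
    rw [Matrix.trace_one, Fintype.card_fin] at this
    rw [← this]
    simp only [Matrix.trace, Matrix.diag_apply, Matrix.mul_apply]
    refine Finset.sum_congr rfl fun i _ => Finset.sum_congr rfl fun j _ => ?_
    rw [mul_comm]
    congr 1
    exact congrFun (congrFun hST i) j
  calc ∑ i, ∑ j, ∑ k, ∑ l, S⁻¹ j k * S l i * ∑ g, A g i j * A g⁻¹ l k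
      = ∑ i, ∑ j, S⁻¹ j i * S j i * κ := by
        refine Finset.sum_congr rfl fun i _ => Finset.sum_congr rfl fun j _ => ?_
        rw [Finset.sum_eq_single i, Finset.sum_eq_single j]
        · rw [hschur, if_pos ⟨rfl, rfl⟩]
        · intro l _ hl
          rw [hschur, if_neg fun h => hl h.1.symm, mul_zero]
        · simp
        · intro k _ hk
          refine Finset.sum_eq_zero fun l _ => ?_
          rw [hschur, if_neg fun h => hk h.2.symm, mul_zero]
        · simp
    _ = Fintype.card G := by
        simp only [← Finset.sum_mul]
        rw [hSS, hκ, mul_div_cancel₀ _ hd]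

end Indicator

section CentralProduct

variable {G : Type} [Group G] [Fintype G] {V : Type} [AddCommGroup V] [Module ℂ V]
  [FiniteDimensional ℂ V]

theorem normSq_character_mul_of_central {ρ : Representation ℂ G V} (hρ : ρ.IsIrreducible) (x : G)
    {z : G} (hz : ∀ g, z * g = g * z) :
    Complex.normSq (ρ.character (x * z)) = Complex.normSq (ρ.character x) := by
  have hV := nontrivial_of_isIrreducible hρ
  obtain ⟨c, hc⟩ := exists_eq_smul_one hρ (ρ z) fun g v => by
    rw [← Module.End.mul_apply, ← map_mul, hz, map_mul, Module.End.mul_apply]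
  have hc1 : c ^ orderOf z = 1 := by
    have h1 : ρ z ^ orderOf z = 1 := by rw [← map_pow, pow_orderOf_eq_one, map_one]
    rw [hc, smul_pow, one_pow] at h1
    obtain ⟨v, hv⟩ := exists_ne (0 : V)
    have h2 : c ^ orderOf z • v = (1 : ℂ) • v := by
      simpa using LinearMap.congr_fun h1 v
    exact smul_left_injective ℂ hv h2
  have hn : ‖c‖ = 1 := Complex.norm_eq_one_of_pow_eq_one hc1 (orderOf_pos z).ne'
  have hx : ρ.character (x * z) = c * ρ.character x := by
    rw [Representation.character, Representation.character, map_mul, hc, mul_smul_comm, mul_one,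
      map_smul, smul_eq_mul]
  rw [hx, map_mul, Complex.normSq_eq_norm_sq c, hn, one_pow, one_mul]

variable {N Z : Type} [Group N] [Fintype N] [Group Z] [Fintype Z]

theorem sum_normSq_comp_le {ρ : Representation ℂ G V} (hρ : ρ.IsIrreducible) {j : N →* G}
    (hj : Function.Injective j) {z : Z →* G} (hz : ∀ c g, z c * g = g * z c) {e : Z}
    (he : ∀ c n, z c = j n → c = 1 ∨ c = e) :
    (Fintype.card Z : ℝ) * ∑ n, Complex.normSq (ρ.character (j n)) ≤ 2 * Fintype.card G := by
  have hfib : ∀ g : G,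
      (Finset.univ.filter fun x : N × Z => j x.1 * z x.2 = g).card ≤ 2 := fun g => by
    rcases (Finset.univ.filter fun x : N × Z => j x.1 * z x.2 = g).eq_empty_or_nonempty with
      h | ⟨⟨n₀, c₀⟩, h₀⟩
    · rw [h]; simp
    rw [Finset.mem_filter_univ] at h₀
    refine (Finset.card_le_card_of_injOn (t := {c₀, e * c₀}) Prod.snd ?_ ?_).trans
      Finset.card_le_two
    · rintro ⟨n, c⟩ h
      have h : j n * z c = g := (Finset.mem_filter.1 (Finset.mem_coe.1 h)).2
      have h1 : z (c * c₀⁻¹) = j (n⁻¹ * n₀) := by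
        rw [map_mul, map_mul, map_inv, map_inv, eq_inv_mul_iff_mul_eq, ← mul_assoc, h, ← h₀,
          mul_inv_cancel_right]
      rw [Finset.coe_insert, Finset.coe_singleton, Set.mem_insert_iff, Set.mem_singleton_iff]
      rcases he _ _ h1 with h2 | h2
      · exact Or.inl (mul_inv_eq_one.1 h2)
      · exact Or.inr (mul_inv_eq_iff_eq_mul.1 h2)
    · rintro ⟨n, c⟩ h ⟨n', c'⟩ h' (hc : c = c')
      subst hc
      have h : j n * z c = g := (Finset.mem_filter.1 (Finset.mem_coe.1 h)).2
      have h' : j n' * z c = g := (Finset.mem_filter.1 (Finset.mem_coe.1 h')).2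
      exact Prod.ext (hj (mul_right_cancel (h.trans h'.symm))) rfl
  calc (Fintype.card Z : ℝ) * ∑ n, Complex.normSq (ρ.character (j n))
      = ∑ x : N × Z, Complex.normSq (ρ.character (j x.1 * z x.2)) := by
        rw [Fintype.sum_prod_type_right]
        simp only [normSq_character_mul_of_central hρ _ (hz _)]
        rw [Finset.sum_const, Finset.card_univ, nsmul_eq_mul]
    _ = ∑ g, ∑ x ∈ Finset.univ.filter fun x : N × Z => j x.1 * z x.2 = g,
          Complex.normSq (ρ.character (j x.1 * z x.2)) :=
        (Finset.sum_fiberwise _ _ _).symm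
    _ ≤ ∑ g, 2 * Complex.normSq (ρ.character g) := by
        refine Finset.sum_le_sum fun g _ => ?_
        rw [Finset.sum_congr rfl fun x hx => by rw [(Finset.mem_filter_univ _).1 hx],
          Finset.sum_const, nsmul_eq_mul]
        refine mul_le_mul_of_nonneg_right ?_ (Complex.normSq_nonneg _)
        exact_mod_cast hfib g
    _ = 2 * Fintype.card G := by
        rw [← Finset.mul_sum, sum_normSq_of_isIrreducible hρ]

theorem eq_zero_of_isAlt_of_central {ρ : Representation ℂ G V} (hρ : ρ.IsIrreducible) {j : N →* G}
    (hj : Function.Injective j) {z : Z →* G} (hz : ∀ c g, z c * g = g * z c) {e : Z}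
    (he : ∀ c n, z c = j n → c = 1 ∨ c = e) (hcard : Fintype.card G ≤ Fintype.card N * Fintype.card Z)
    {ι : MulAut N} (hι : ∀ x, ι (ι x) = x) (hN : NoAlt ι) (hI : ∀ x, IsConj (ι x) x⁻¹)
    {τ : G} (hτ : τ * τ = 1) (hτι : ∀ x, j (ι x) = τ * j x * τ⁻¹)
    {B : V →ₗ[ℂ] V →ₗ[ℂ] ℂ} (hB : B.IsAlt) (hT : IsTwisted 1 ρ B) : B = 0 := by
  have hV := nontrivial_of_isIrreducible hρ
  by_contra h0
  have hττ : ∀ v, ρ τ (ρ τ v) = v := fun v => by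
    rw [← Module.End.mul_apply, ← map_mul, hτ, map_one, Module.End.one_apply]
  have hτinv : τ⁻¹ = τ := inv_eq_of_mul_eq_one_left hτ
  have hinv : ∀ g v w, B (ρ g v) (ρ g w) = B v w := hT
  have halt : (B.compl₂ (ρ τ)).IsAlt := isAlt_of_skew fun v w => by
    rw [LinearMap.compl₂_apply, LinearMap.compl₂_apply, ← hinv τ, hττ, ← hB.neg]
  have htw : IsTwisted ι (ρ.comp j) (B.compl₂ (ρ τ)) := fun x v w => by
    change B (ρ (j x) v) (ρ τ (ρ (j (ι x)) w)) = B v (ρ τ w)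
    rw [← Module.End.mul_apply, ← map_mul, hτι, hτinv, ← mul_assoc, ← mul_assoc, hτ, one_mul,
      map_mul, Module.End.mul_apply, hinv]
  have hker := ker_eq_bot_of_ne_zero hρ (fun _ => rfl) hT h0
  have hnd : ∀ v, (∀ w, B.compl₂ (ρ τ) v w = 0) → v = 0 := fun v h => by
    rw [← LinearMap.separatingLeft_iff_ker_eq_bot] at hker
    refine hker v fun w => ?_
    have := h (ρ τ w)
    rwa [LinearMap.compl₂_apply, hττ] at this
  have h4 := four_mul_card_le_sum_normSq hι hN hI (ρ.comp j) halt htw hnd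
  have h2 := sum_normSq_comp_le hρ hj hz he
  have hcard' : (Fintype.card G : ℝ) ≤ Fintype.card N * Fintype.card Z := by exact_mod_cast hcard
  have hNpos : (0 : ℝ) < Fintype.card N := by exact_mod_cast Fintype.card_pos
  have hZpos : (0 : ℝ) < Fintype.card Z := by exact_mod_cast Fintype.card_pos
  have h5 := mul_le_mul_of_nonneg_left h4 hZpos.le
  have h6 : (Fintype.card Z : ℝ) * (4 * Fintype.card N) ≤ 2 * (Fintype.card N * Fintype.card Z) :=
    (h5.trans h2).trans (by linarith)
  nlinarith [mul_pos hNpos hZpos]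

theorem sum_character_sq_of_real {ρ : Representation ℂ G V} (hρ : ρ.IsIrreducible)
    (hreal : ∀ g, star (ρ.character g) = ρ.character g)
    (halt : ∀ B : V →ₗ[ℂ] V →ₗ[ℂ] ℂ, B.IsAlt → IsTwisted 1 ρ B → B = 0) :
    ∑ g, ρ.character (g * g) = Fintype.card G := by
  obtain ⟨B, hB, hB0, huniq⟩ := exists_twisted_form_of_character (ι := 1) hρ fun x => by
    rw [MulAut.one_apply, character_inv_eq_star, hreal]
  have hflip : ∀ v w, B.flip v w = B w v := fun v w => rfl
  obtain ⟨c, hc⟩ := huniq _ (hB.flip fun _ => rfl)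
  have hc' : ∀ v w, c * B v w = B w v := fun v w => LinearMap.congr_fun₂ hc v w
  have hcc : c * c = 1 := by
    by_contra hne
    refine hB0 (LinearMap.ext₂ fun v w => ?_)
    have h1 : (c * c - 1) * B v w = 0 := by linear_combination c * hc' v w + hc' w v
    exact (mul_eq_zero.1 h1).resolve_left (sub_ne_zero.2 hne)
  rcases mul_self_eq_one_iff.1 hcc with rfl | rfl
  · exact sum_character_sq_of_symm hρ hB hB0 (by rw [← hc, one_smul])
  · refine absurd (halt B (isAlt_of_skew fun v w => ?_) hB) hB0
    rw [← hc' w v, neg_one_mul]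

end CentralProduct

section SymplecticSimilitude

variable {n : ℕ} {F : Type} [Field F]

theorem Jsp_transpose : (Jsp n F)ᵀ = -Jsp n F := by
  simp [Jsp, Matrix.fromBlocks_transpose, Matrix.fromBlocks_neg]

theorem Jsp_mul_neg : Jsp n F * -Jsp n F = 1 := by
  simp [Jsp, Matrix.fromBlocks_neg, Matrix.fromBlocks_multiply]

variable (n F) in
/-- The standard symplectic form. -/
def spForm : (Fin n ⊕ Fin n → F) →ₗ[F] (Fin n ⊕ Fin n → F) →ₗ[F] F :=
  Matrix.toLinearMap₂' F (Jsp n F)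

theorem spForm_isAlt (h2 : (2 : F) ≠ 0) : (spForm n F).IsAlt := fun v => by
  have h : v ⬝ᵥ Jsp n F *ᵥ v = -(v ⬝ᵥ Jsp n F *ᵥ v) := by
    nth_rw 1 [dotProduct_mulVec, ← mulVec_transpose, Jsp_transpose, neg_mulVec, neg_dotProduct,
      dotProduct_comm]
  change Matrix.toLinearMap₂' F (Jsp n F) v v = 0
  rw [Matrix.toLinearMap₂'_apply']
  have h' : 2 * (v ⬝ᵥ Jsp n F *ᵥ v) = 0 := by linear_combination h
  exact (mul_eq_zero.1 h').resolve_left h2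

theorem spForm_separatingLeft : (spForm n F).SeparatingLeft :=
  LinearMap.separatingLeft_toLinearMap₂'_of_det_ne_zero'
    (Matrix.isUnit_det_of_right_inverse Jsp_mul_neg).ne_zero

variable (n F) in
/-- Linear automorphisms as invertible matrices. -/
def toGLEquiv : ((Fin n ⊕ Fin n → F) ≃ₗ[F] (Fin n ⊕ Fin n → F)) ≃* GL (Fin n ⊕ Fin n) F :=
  (LinearMap.GeneralLinearGroup.generalLinearEquiv F (Fin n ⊕ Fin n → F)).symm.trans
    Matrix.GeneralLinearGroup.toLin.symm

theorem toGLEquiv_mulVec (x : (Fin n ⊕ Fin n → F) ≃ₗ[F] (Fin n ⊕ Fin n → F)) (v) :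
    (toGLEquiv n F x : Matrix _ _ F) *ᵥ v = x v := by
  change LinearMap.toMatrix' (x : (Fin n ⊕ Fin n → F) →ₗ[F] (Fin n ⊕ Fin n → F)) *ᵥ v = x v
  rw [LinearMap.toMatrix'_mulVec]
  rfl

theorem transpose_mul_Jsp_mul_iff (g : Matrix (Fin n ⊕ Fin n) (Fin n ⊕ Fin n) F) (c : F) :
    gᵀ * Jsp n F * g = c • Jsp n F ↔
      ∀ v w, spForm n F (g *ᵥ v) (g *ᵥ w) = c * spForm n F v w := by
  have e : Matrix.toLinearMap₂' F (gᵀ * Jsp n F * g) =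
      (spForm n F).compl₁₂ (Matrix.toLin' g) (Matrix.toLin' g) :=
    (Matrix.toLinearMap₂'_comp _ _ _).symm
  have e' : Matrix.toLinearMap₂' F (c • Jsp n F) = c • spForm n F := map_smul _ _ _
  refine ⟨fun h v w => ?_, fun h => ?_⟩
  · have h' := (e.symm.trans (congrArg (Matrix.toLinearMap₂' F) h)).trans e'
    exact LinearMap.congr_fun₂ h' v w
  · refine LinearEquiv.injective (Matrix.toLinearMap₂' F (S₁ := F) (S₂ := F) (N₂ := F)) ?_
    rw [e, e']
    exact LinearMap.ext₂ h

theorem toGLEquiv_spec (x : (isometrySign (spForm n F)).ker) :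
    (toGLEquiv n F x.1.1.1 : Matrix (Fin n ⊕ Fin n) (Fin n ⊕ Fin n) F)ᵀ * Jsp n F *
      (toGLEquiv n F x.1.1.1 : Matrix (Fin n ⊕ Fin n) (Fin n ⊕ Fin n) F) = Jsp n F := by
  have h : x.1.1.2 = 1 := x.2
  refine ((transpose_mul_Jsp_mul_iff _ 1).2 fun v w => ?_).trans (one_smul F _)
  have h' := x.1.2 v w
  rw [h] at h'
  rw [toGLEquiv_mulVec, toGLEquiv_mulVec, h']
  simp

/-- The embedding of isometries into symplectic similitudes. -/
def isometryHom : (isometrySign (spForm n F)).ker →* GSp n F :=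
  ((toGLEquiv n F).toMonoidHom.comp ((MonoidHom.fst _ _).comp
    ((signedIsometry (spForm n F)).subtype.comp (Subgroup.subtype _)))).codRestrict _ fun x =>
      ⟨1, (toGLEquiv_spec x).trans (one_smul F _).symm⟩

theorem coe_isometryHom (x : (isometrySign (spForm n F)).ker) :
    (isometryHom x : GL (Fin n ⊕ Fin n) F) = toGLEquiv n F x.1.1.1 := rfl

theorem isometryHom_injective : Function.Injective (isometryHom (n := n) (F := F)) :=
  fun x y h => by
    have h' := (toGLEquiv n F).injective (congrArg Subtype.val h)
    exact Subtype.ext (Subtype.ext (Prod.ext h' (x.2.trans y.2.symm)))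

theorem mem_range_isometryHom (g : GSp n F)
    (hg : (matOf g)ᵀ * Jsp n F * matOf g = Jsp n F) : ∃ x, isometryHom x = g := by
  have h := (transpose_mul_Jsp_mul_iff (matOf g) 1).1 (hg.trans (one_smul F _).symm)
  have hv : ∀ v, (toGLEquiv n F).symm g v = matOf g *ᵥ v := fun v => by
    rw [← toGLEquiv_mulVec, MulEquiv.apply_symm_apply]
    rfl
  refine ⟨⟨⟨((toGLEquiv n F).symm g, 1), fun v w => ?_⟩, rfl⟩, Subtype.ext ?_⟩
  · rw [hv, hv, h, Units.val_one, Int.cast_one]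
  · rw [coe_isometryHom]
    exact (toGLEquiv n F).apply_symm_apply _

/-- The diagonal similitude `diag(c, 1)`. -/
def diagSimilitude (c : Fˣ) : GSp n F :=
  ⟨⟨Matrix.fromBlocks ((c : F) • 1) 0 0 1, Matrix.fromBlocks (((c⁻¹ : Fˣ) : F) • 1) 0 0 1,
    by simp [Matrix.fromBlocks_multiply, smul_smul],
    by simp [Matrix.fromBlocks_multiply, smul_smul]⟩, c, by
    simp [Jsp, Matrix.fromBlocks_transpose, Matrix.fromBlocks_multiply, Matrix.fromBlocks_smul]⟩

theorem matOf_diagSimilitude (c : Fˣ) :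
    matOf (diagSimilitude c : GSp n F) = Matrix.fromBlocks ((c : F) • 1) 0 0 1 := rfl

theorem diagSimilitude_spec (c : Fˣ) :
    (matOf (diagSimilitude c : GSp n F))ᵀ * Jsp n F * matOf (diagSimilitude c : GSp n F) =
      (c : F) • Jsp n F := by
  rw [matOf_diagSimilitude]
  simp [Jsp, Matrix.fromBlocks_transpose, Matrix.fromBlocks_multiply, Matrix.fromBlocks_smul]

theorem matOf_mul (g h : GSp n F) : matOf (g * h) = matOf g * matOf h := rfl

theorem diagSimilitude_neg_one_sq : diagSimilitude (n := n) (-1 : Fˣ) * diagSimilitude (-1) = 1 := by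
  refine Subtype.ext (Units.ext ?_)
  change matOf (diagSimilitude (-1) * diagSimilitude (-1) : GSp n F) = 1
  rw [matOf_mul, matOf_diagSimilitude]
  simp [Matrix.fromBlocks_multiply]

theorem coe_scalar (c : Fˣ) :
    (Matrix.GeneralLinearGroup.scalar (Fin n ⊕ Fin n) c : Matrix (Fin n ⊕ Fin n) (Fin n ⊕ Fin n) F) =
      (c : F) • 1 :=
  (Matrix.smul_one_eq_diagonal (c : F)).symm

/-- The embedding of the scalars into symplectic similitudes. -/
def scalarHom : Fˣ →* GSp n F :=
  (Matrix.GeneralLinearGroup.scalar (Fin n ⊕ Fin n)).codRestrict _ fun c => ⟨c * c, by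
    rw [coe_scalar]
    simp [smul_smul]⟩

theorem matOf_scalarHom (c : Fˣ) :
    matOf (scalarHom c : GSp n F) = (c : F) • 1 := coe_scalar c

theorem scalarHom_comm (c : Fˣ) (g : GSp n F) : scalarHom c * g = g * scalarHom c := by
  refine Subtype.ext (Units.ext ?_)
  change matOf (scalarHom c * g) = matOf (g * scalarHom c)
  rw [matOf_mul, matOf_mul, matOf_scalarHom]
  simp

theorem eq_one_or_eq_neg_one_of_scalarHom [NeZero n] (c : Fˣ) (x : (isometrySign (spForm n F)).ker)
    (h : scalarHom c = isometryHom x) : c = 1 ∨ c = -1 := by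
  have h1 : (matOf (isometryHom x))ᵀ * Jsp n F * matOf (isometryHom x) = Jsp n F :=
    toGLEquiv_spec x
  rw [← h, matOf_scalarHom] at h1
  have h2 := congrFun (congrFun h1 (Sum.inl 0)) (Sum.inr 0)
  have h3 : (c : F) * c = 1 := by simpa [Jsp] using h2
  rcases mul_self_eq_one_iff.1 h3 with h | h
  · exact Or.inl (Units.ext h)
  · exact Or.inr (Units.ext h)

theorem exists_isometryHom_mul_diagSimilitude (g : GSp n F) :
    ∃ x c, isometryHom x * diagSimilitude c = g := by
  obtain ⟨c, hc⟩ := g.2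
  obtain ⟨d, hd⟩ : ∃ d : GSp n F, d = diagSimilitude c := ⟨_, rfl⟩
  have hd' : (matOf d)ᵀ * Jsp n F * matOf d = (c : F) • Jsp n F := hd ▸ diagSimilitude_spec c
  have h : (matOf (g * d⁻¹))ᵀ * Jsp n F * matOf (g * d⁻¹) = ((c * c⁻¹ : Fˣ) : F) • Jsp n F :=
    sim_mul g.1 d.1⁻¹ c c⁻¹ hc (sim_inv d.1 c hd')
  rw [mul_inv_cancel, Units.val_one, one_smul] at h
  obtain ⟨x, hx⟩ := mem_range_isometryHom _ h
  exact ⟨x, c, by rw [hx, ← hd, inv_mul_cancel_right]⟩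

/-- The skew involution `diag(-1, 1)`. -/
def diagSkew : signedIsometry (spForm n F) :=
  ⟨((toGLEquiv n F).symm (diagSimilitude (-1) : GSp n F), -1), fun v w => by
    have h := (transpose_mul_Jsp_mul_iff _ _).1 (diagSimilitude_spec (n := n) (-1 : Fˣ)) v w
    have hv : ∀ v, (toGLEquiv n F).symm (diagSimilitude (-1) : GSp n F) v =
        matOf (diagSimilitude (-1) : GSp n F) *ᵥ v := fun v => by
      rw [← toGLEquiv_mulVec, MulEquiv.apply_symm_apply]
      rfl
    rw [hv, hv, h]
    simp⟩

theorem diagSkew_sq : (diagSkew : signedIsometry (spForm n F)) ^ 2 = 1 := by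
  refine Subtype.ext (Prod.ext ?_ (Int.units_sq _))
  rw [sq]
  change (toGLEquiv n F).symm _ * (toGLEquiv n F).symm _ = 1
  rw [← map_mul, ← Subgroup.coe_mul, diagSimilitude_neg_one_sq]
  exact map_one _

theorem isometryHom_conjKer (x : (isometrySign (spForm n F)).ker) :
    isometryHom (conjKer diagSkew diagSkew_sq x) =
      diagSimilitude (-1) * isometryHom x * (diagSimilitude (-1))⁻¹ := by
  refine Subtype.ext ?_
  rw [coe_isometryHom, coe_conjKer]
  change toGLEquiv n F ((toGLEquiv n F).symm _ * x.1.1.1 * ((toGLEquiv n F).symm _)⁻¹) = _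
  rw [map_mul, map_mul, map_inv, MulEquiv.apply_symm_apply]
  rfl

theorem isometrySign_diagSkew : isometrySign (spForm n F) diagSkew = -1 := rfl

theorem noAlt_conjKer_diagSkew [Finite F] (h2 : (2 : F) ≠ 0) :
    NoAlt (conjKer (diagSkew (n := n) (F := F)) diagSkew_sq) :=
  noAltConj_isometry h2 (spForm_isAlt h2) spForm_separatingLeft isometrySign_diagSkew diagSkew_sq _
    (coe_conjKer _ diagSkew_sq)

theorem isConj_conjKer_diagSkew_inv (h2 : (2 : F) ≠ 0) (x : (isometrySign (spForm n F)).ker) :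
    IsConj (conjKer diagSkew diagSkew_sq x) x⁻¹ :=
  isConj_inv_of_conj h2 (spForm_isAlt h2) spForm_separatingLeft isometrySign_diagSkew _
    (coe_conjKer _ diagSkew_sq) x

theorem card_GSp_le [Fintype F] [Fintype (isometrySign (spForm n F)).ker] :
    Fintype.card (GSp n F) ≤ Fintype.card (isometrySign (spForm n F)).ker * Fintype.card Fˣ := by
  rw [← Fintype.card_prod]
  refine Fintype.card_le_of_surjective
    (fun x : (isometrySign (spForm n F)).ker × Fˣ => isometryHom x.1 * diagSimilitude x.2)
    fun g => ?_
  obtain ⟨x, c, h⟩ := exists_isometryHom_mul_diagSimilitude g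
  exact ⟨(x, c), h⟩

theorem card_GSp_zero_le [Fintype F] [Fintype (isometrySign (spForm 0 F)).ker] :
    Fintype.card (GSp 0 F) ≤ Fintype.card (isometrySign (spForm 0 F)).ker * Fintype.card Unit := by
  have : Subsingleton (GSp 0 F) := ⟨fun a b => Subtype.ext (Units.ext (Subsingleton.elim _ _))⟩
  exact (Fintype.card_le_one_iff_subsingleton.2 this).trans
    (Nat.mul_pos Fintype.card_pos Fintype.card_pos)

theorem eq_zero_of_isAlt_GSp [Fintype F] (h2 : (2 : F) ≠ 0) {V : Type} [AddCommGroup V]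
    [Module ℂ V] [FiniteDimensional ℂ V] {ρ : Representation ℂ (GSp n F) V} (hρ : ρ.IsIrreducible)
    {B : V →ₗ[ℂ] V →ₗ[ℂ] ℂ} (hB : B.IsAlt) (hT : IsTwisted 1 ρ B) : B = 0 := by
  have hfin := finite_signedIsometry (spForm n F)
  have := Fintype.ofFinite (isometrySign (spForm n F)).ker
  have hι := conjKer_conjKer (diagSkew (n := n) (F := F)) diagSkew_sq
  have hN := noAlt_conjKer_diagSkew (n := n) h2
  have hI := isConj_conjKer_diagSkew_inv (n := n) h2
  have hd := diagSimilitude_neg_one_sq (n := n) (F := F)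
  have hc := isometryHom_conjKer (n := n) (F := F)
  have hinj := isometryHom_injective (n := n) (F := F)
  generalize conjKer (diagSkew (n := n) (F := F)) diagSkew_sq = ι at *
  generalize (diagSimilitude (-1) : GSp n F) = d at *
  rcases Nat.eq_zero_or_pos n with rfl | hn
  · exact eq_zero_of_isAlt_of_central (Z := Unit) hρ hinj
      (z := (1 : Unit →* GSp 0 F)) (e := ()) (fun _ _ => by simp) (fun _ _ _ => Or.inl rfl)
      card_GSp_zero_le hι hN hI hd hc hB hT
  · have : NeZero n := ⟨hn.ne'⟩
    have he := eq_one_or_eq_neg_one_of_scalarHom (n := n) (F := F)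
    have hs := scalarHom_comm (n := n) (F := F)
    have hcard := card_GSp_le (n := n) (F := F)
    exact eq_zero_of_isAlt_of_central hρ hinj hs he hcard hι hN hI hd hc hB hT

end SymplecticSimilitude

end TwistedForm

theorem stmt_1 (n : ℕ) (q : ℕ) (hq : ∃ p r : ℕ, p.Prime ∧ Odd p ∧ 0 < r ∧ q = p ^ r)
    (F : Type) [Field F] [Fintype F] [DecidableEq F] (hF : Fintype.card F = q)
    (ρ : FDRep ℂ ↥(GSp n F)) (hρ : Simple ρ) (hreal : IsRealValued ρ.character) :
    fsIndicator ↥(GSp n F) ρ.character = 1 := by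
  obtain ⟨p, r, -, hp, -, rfl⟩ := hq
  have h2 : (2 : F) ≠ 0 := by
    refine Ring.two_ne_zero fun hchar => ?_
    have := FiniteField.even_card_of_char_two hchar
    rw [hF] at this
    exact Nat.not_even_iff_odd.2 hp.pow (Nat.even_iff.2 this)
  have hchar : ∀ g, ρ.character g = Representation.character ρ.ρ g := fun g => rfl
  have hirr : Representation.IsIrreducible (V := ρ) ρ.ρ := by
    refine TwistedForm.isIrreducible_of_sum_character _ ?_
    have := (FDRep.simple_iff_char_is_norm_one ρ).1 hρ
    rwa [Nat.card_eq_fintype_card] at this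
  have h := TwistedForm.sum_character_sq_of_real hirr (fun g => by
      obtain ⟨r, hr⟩ := hreal g
      rw [← hchar, hr]
      exact Complex.conj_ofReal r)
    fun B hB hT => TwistedForm.eq_zero_of_isAlt_GSp h2 hirr hB hT
  have hsum : ∑ g, ρ.character (g * g) = Fintype.card (GSp n F) := h
  rw [fsIndicator, hsum, inv_mul_cancel₀ (by simp)]
end
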